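/- Let h: [0,∞) → [0,∞) be of class C² with h(0) = h'(0) = 0 and suppose there are constants c₁, c₂ > 0 and an exponent μ with 1 < μ < 2 such that c₁(1+t)^{−μ} ≤ min{h''(t), h'(t)/t} and max{h''(t), h'(t)/t} ≤ c₂/(1+t) for all t ≥ 0 (h'(t)/t extended by h''(0) at t = 0). Suppose u ∈ C¹(ℝ², ℝ²) is divergence-free, bounded on ℝ², and a weak solution of the stationary generalized Navier–Stokes system with dissipative potential H(ε) = h(|ε|), i.e. ∫_{ℝ²} (h'(|ε(u)|)/|ε(u)|) ε(u) : ε(φ) dx + ∫_{ℝ²} u^k ∂_k u^i φ^i dx = 0 for every divergence-free φ ∈ C_c^∞(ℝ², ℝ²). Then u is a constant vector. -/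

import Mathlib

noncomputable section

open MeasureTheory Real Filter

/-- Partial derivative ∂ₖu(x) ∈ ℝⁿ of a vector field u : ℝⁿ → ℝⁿ. -/
def pd {n : ℕ} (u : EuclideanSpace ℝ (Fin n) → EuclideanSpace ℝ (Fin n))
    (k : Fin n) (x : EuclideanSpace ℝ (Fin n)) : EuclideanSpace ℝ (Fin n) :=
  fderiv ℝ u x (EuclideanSpace.single k 1)

/-- Divergence of u at x. -/
def divg {n : ℕ} (u : EuclideanSpace ℝ (Fin n) → EuclideanSpace ℝ (Fin n))
    (x : EuclideanSpace ℝ (Fin n)) : ℝ :=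
  ∑ k, pd u k x k

/-- Symmetric gradient ε(u)(x) = (1/2)(∇u + (∇u)ᵀ), entry (i,j) = (∂ⱼuⁱ + ∂ᵢuʲ)/2. -/
def symGrad {n : ℕ} (u : EuclideanSpace ℝ (Fin n) → EuclideanSpace ℝ (Fin n))
    (x : EuclideanSpace ℝ (Fin n)) : Matrix (Fin n) (Fin n) ℝ :=
  fun i j => (pd u j x i + pd u i x j) / 2

/-- Full gradient ∇u(x), entry (i,j) = ∂ⱼuⁱ. -/
def gradM {n : ℕ} (u : EuclideanSpace ℝ (Fin n) → EuclideanSpace ℝ (Fin n))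
    (x : EuclideanSpace ℝ (Fin n)) : Matrix (Fin n) (Fin n) ℝ :=
  fun i j => pd u j x i

/-- Frobenius inner product A : B. -/
def frob {n : ℕ} (A B : Matrix (Fin n) (Fin n) ℝ) : ℝ := ∑ i, ∑ j, A i j * B i j

/-- Frobenius norm |A|. -/
def fnorm {n : ℕ} (A : Matrix (Fin n) (Fin n) ℝ) : ℝ := Real.sqrt (frob A A)

/-- DH(ε) = (h'(|ε|)/|ε|) ε, interpreted as 0 at ε = 0. -/
def DH {n : ℕ} (h : ℝ → ℝ) (A : Matrix (Fin n) (Fin n) ℝ) : Matrix (Fin n) (Fin n) ℝ :=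
  if fnorm A = 0 then 0 else (deriv h (fnorm A) / fnorm A) • A

/-- u is a weak solution of -div DH(ε(u)) + (u·∇)u + ∇π = 0, div u = 0:
for all smooth compactly supported divergence-free φ,
∫ DH(ε(u)) : ε(φ) dx + ∫ uᵏ ∂ₖuⁱ φⁱ dx = 0. -/
def IsWeakSolution {n : ℕ} (h : ℝ → ℝ)
    (u : EuclideanSpace ℝ (Fin n) → EuclideanSpace ℝ (Fin n)) : Prop :=
  ∀ φ : EuclideanSpace ℝ (Fin n) → EuclideanSpace ℝ (Fin n),
    ContDiff ℝ (⊤ : ℕ∞) φ → HasCompactSupport φ → (∀ x, divg φ x = 0) →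
    (∫ x, frob (DH h (symGrad u x)) (symGrad φ x)) +
      (∫ x, ∑ k, ∑ i, u x k * pd u k x i * φ x i) = 0

/-- u is a weak solution of the Stokes-type system -div DH(ε(u)) + ∇π = 0, div u = 0:
for all smooth compactly supported divergence-free φ, ∫ DH(ε(u)) : ε(φ) dx = 0. -/
def IsStokesWeakSolution {n : ℕ} (h : ℝ → ℝ)
    (u : EuclideanSpace ℝ (Fin n) → EuclideanSpace ℝ (Fin n)) : Prop :=
  ∀ φ : EuclideanSpace ℝ (Fin n) → EuclideanSpace ℝ (Fin n),
    ContDiff ℝ (⊤ : ℕ∞) φ → HasCompactSupport φ → (∀ x, divg φ x = 0) →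
    (∫ x, frob (DH h (symGrad u x)) (symGrad φ x)) = 0

/-- The open square Q_R(x₀) ⊂ ℝ². -/
def sqr (R : ℝ) (x₀ : EuclideanSpace ℝ (Fin 2)) : Set (EuclideanSpace ℝ (Fin 2)) :=
  {x | |x 0 - x₀ 0| < R ∧ |x 1 - x₀ 1| < R}

/-- h'(t)/t, extended by h''(0) at t = 0. -/
def slopeH (h : ℝ → ℝ) (t : ℝ) : ℝ :=
  if t = 0 then deriv (deriv h) 0 else deriv h t / t

/-! ### Pointwise properties of the stress tensor -/

lemma frob_sub_sub {n : ℕ} (A B C D : Matrix (Fin n) (Fin n) ℝ) :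
    frob (A - B) (C - D) = frob A C - frob A D - frob B C + frob B D := by
  simp only [frob, Matrix.sub_apply, ← Finset.sum_sub_distrib, ← Finset.sum_add_distrib]
  refine Finset.sum_congr rfl fun i _ => Finset.sum_congr rfl fun j _ => ?_
  ring

lemma frob_smul_left {n : ℕ} (r : ℝ) (A B : Matrix (Fin n) (Fin n) ℝ) :
    frob (r • A) B = r * frob A B := by
  simp only [frob, Matrix.smul_apply, smul_eq_mul, Finset.mul_sum]
  refine Finset.sum_congr rfl fun i _ => Finset.sum_congr rfl fun j _ => ?_
  ring

lemma frob_comm {n : ℕ} (A B : Matrix (Fin n) (Fin n) ℝ) : frob A B = frob B A := by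
  simp only [frob]
  refine Finset.sum_congr rfl fun i _ => Finset.sum_congr rfl fun j _ => ?_
  ring

lemma frob_smul_right {n : ℕ} (r : ℝ) (A B : Matrix (Fin n) (Fin n) ℝ) :
    frob A (r • B) = r * frob A B := by
  rw [frob_comm, frob_smul_left, frob_comm]

lemma frob_self_nonneg {n : ℕ} (A : Matrix (Fin n) (Fin n) ℝ) : 0 ≤ frob A A :=
  Finset.sum_nonneg fun i _ => Finset.sum_nonneg fun j _ => mul_self_nonneg _

lemma fnorm_nonneg {n : ℕ} (A : Matrix (Fin n) (Fin n) ℝ) : 0 ≤ fnorm A := Real.sqrt_nonneg _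

lemma fnorm_sq {n : ℕ} (A : Matrix (Fin n) (Fin n) ℝ) : fnorm A ^ 2 = frob A A :=
  Real.sq_sqrt (frob_self_nonneg A)

lemma frob_cauchy {n : ℕ} (A B : Matrix (Fin n) (Fin n) ℝ) :
    frob A B ≤ fnorm A * fnorm B := by
  have h1 : frob A B ^ 2 ≤ frob A A * frob B B := by
    simp only [frob, ← Fintype.sum_prod_type']
    have := Finset.sum_mul_sq_le_sq_mul_sq Finset.univ
      (fun p : Fin n × Fin n => A p.1 p.2) (fun p : Fin n × Fin n => B p.1 p.2)
    simpa only [sq] using this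
  rw [← fnorm_sq, ← fnorm_sq, ← mul_pow] at h1
  exact le_of_sq_le_sq h1 (mul_nonneg (fnorm_nonneg A) (fnorm_nonneg B))

lemma frob_self_eq_zero {n : ℕ} {A : Matrix (Fin n) (Fin n) ℝ} (hA : frob A A = 0) : A = 0 := by
  ext i j
  have h1 := (Finset.sum_eq_zero_iff_of_nonneg
    (fun i _ => Finset.sum_nonneg fun j _ => mul_self_nonneg (A i j))).1 hA i (Finset.mem_univ i)
  have h2 := (Finset.sum_eq_zero_iff_of_nonneg
    (fun j _ => mul_self_nonneg (A i j))).1 h1 j (Finset.mem_univ j)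
  simpa using h2

lemma DH_eq {n : ℕ} (h : ℝ → ℝ) (A : Matrix (Fin n) (Fin n) ℝ) :
    DH h A = slopeH h (fnorm A) • A := by
  unfold DH slopeH
  by_cases hA : fnorm A = 0
  · have : A = 0 := frob_self_eq_zero (by rw [← fnorm_sq, hA]; norm_num)
    simp [hA, this]
  · simp [hA]

/-- The structural hypotheses on the potential, bundled. -/
structure HypH (h : ℝ → ℝ) (c₁ c₂ μ : ℝ) : Prop where
  hc₁ : 0 < c₁
  hc₂ : 0 < c₂
  hμ₁ : 1 < μ
  hμ₂ : μ < 2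
  hreg : ContDiff ℝ 2 h
  h0' : deriv h 0 = 0
  hlow : ∀ t, 0 ≤ t → c₁ * (1 + t) ^ (-μ) ≤ min (deriv (deriv h) t) (slopeH h t)
  hup : ∀ t, 0 ≤ t → max (deriv (deriv h) t) (slopeH h t) ≤ c₂ / (1 + t)

namespace HypH

variable {h : ℝ → ℝ} {c₁ c₂ μ : ℝ}

lemma slope_mul (H : HypH h c₁ c₂ μ) (t : ℝ) : slopeH h t * t = deriv h t := by
  unfold slopeH
  split_ifs with ht
  · simp [ht, H.h0']
  · field_simp

lemma div_le (H : HypH h c₁ c₂ μ) {t : ℝ} (ht : 0 ≤ t) : c₂ / (1 + t) ≤ c₂ :=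
  div_le_self H.hc₂.le (by linarith)

lemma slope_le (H : HypH h c₁ c₂ μ) {t : ℝ} (ht : 0 ≤ t) : slopeH h t ≤ c₂ :=
  ((le_max_right _ _).trans (H.hup t ht)).trans (H.div_le ht)

lemma dd_le (H : HypH h c₁ c₂ μ) {t : ℝ} (ht : 0 ≤ t) : deriv (deriv h) t ≤ c₂ :=
  ((le_max_left _ _).trans (H.hup t ht)).trans (H.div_le ht)

lemma weight_mono (H : HypH h c₁ c₂ μ) {s t : ℝ} (hs : 0 ≤ s) (hst : s ≤ t) :
    c₁ * (1 + t) ^ (-μ) ≤ c₁ * (1 + s) ^ (-μ) := by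
  refine mul_le_mul_of_nonneg_left ?_ H.hc₁.le
  exact Real.rpow_le_rpow_of_nonpos (by linarith) (by linarith) (by linarith [H.hμ₁])

lemma slope_ge (H : HypH h c₁ c₂ μ) {s t : ℝ} (hs : 0 ≤ s) (hst : s ≤ t) :
    c₁ * (1 + t) ^ (-μ) ≤ slopeH h s :=
  (H.weight_mono hs hst).trans ((H.hlow s hs).trans (min_le_right _ _))

lemma dd_ge (H : HypH h c₁ c₂ μ) {s t : ℝ} (hs : 0 ≤ s) (hst : s ≤ t) :
    c₁ * (1 + t) ^ (-μ) ≤ deriv (deriv h) s :=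
  (H.weight_mono hs hst).trans ((H.hlow s hs).trans (min_le_left _ _))

lemma diff_deriv (H : HypH h c₁ c₂ μ) : Differentiable ℝ (deriv h) :=
  ((contDiff_succ_iff_deriv (n := 1)).1 H.hreg).2.2.differentiable (by norm_num)

lemma mvt (H : HypH h c₁ c₂ μ) {a b : ℝ} (ha : 0 ≤ a) (hab : a ≤ b) :
    c₁ * (1 + (a + b)) ^ (-μ) * (b - a) ≤ deriv h b - deriv h a ∧
      deriv h b - deriv h a ≤ c₂ * (b - a) := by
  constructor
  · refine (convex_Icc a b).mul_sub_le_image_sub_of_le_deriv H.diff_deriv.continuous.continuousOn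
      H.diff_deriv.differentiableOn ?_ a (by simp [hab]) b (by simp [hab]) hab
    intro x hx
    rw [interior_Icc] at hx
    exact H.dd_ge (by linarith [hx.1]) (by linarith [hx.2])
  · refine (convex_Icc a b).image_sub_le_mul_sub_of_deriv_le H.diff_deriv.continuous.continuousOn
      H.diff_deriv.differentiableOn ?_ a (by simp [hab]) b (by simp [hab]) hab
    intro x hx
    rw [interior_Icc] at hx
    exact H.dd_le (by linarith [hx.1])

lemma mvt2 (H : HypH h c₁ c₂ μ) {a b : ℝ} (ha : 0 ≤ a) (hb : 0 ≤ b) :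
    c₁ * (1 + (a + b)) ^ (-μ) * (a - b) ^ 2 ≤ (deriv h a - deriv h b) * (a - b) ∧
      (deriv h a - deriv h b) ^ 2 ≤ c₂ * ((deriv h a - deriv h b) * (a - b)) := by
  have hc₂ := H.hc₂
  rcases le_total a b with hab | hab
  · obtain ⟨h1, h2⟩ := H.mvt ha hab
    have hw : 0 ≤ c₁ * (1 + (a + b)) ^ (-μ) := mul_nonneg H.hc₁.le (by positivity)
    have h3 : 0 ≤ deriv h b - deriv h a := le_trans (mul_nonneg hw (by linarith)) h1
    constructor <;> nlinarith
  · obtain ⟨h1, h2⟩ := H.mvt hb hab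
    rw [add_comm b a] at h1
    have hw : 0 ≤ c₁ * (1 + (a + b)) ^ (-μ) := mul_nonneg H.hc₁.le (by positivity)
    have h3 : 0 ≤ deriv h a - deriv h b := le_trans (mul_nonneg hw (by linarith)) h1
    constructor <;> nlinarith

lemma coer (H : HypH h c₁ c₂ μ) {n : ℕ} (A B : Matrix (Fin n) (Fin n) ℝ) :
    frob (DH h A - DH h B) (DH h A - DH h B) ≤ c₂ * frob (DH h A - DH h B) (A - B) := by
  obtain ⟨-, h2⟩ := H.mvt2 (fnorm_nonneg A) (fnorm_nonneg B)
  have hp := frob_cauchy A B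
  have hA := H.slope_le (fnorm_nonneg A)
  have hB := H.slope_le (fnorm_nonneg B)
  have hw : 0 ≤ c₁ * (1 + (fnorm A + fnorm B)) ^ (-μ) :=
    mul_nonneg H.hc₁.le (by have := fnorm_nonneg A; have := fnorm_nonneg B; positivity)
  have hA0 := hw.trans (H.slope_ge (fnorm_nonneg A) (t := fnorm A + fnorm B)
    (by linarith [fnorm_nonneg B]))
  have hB0 := hw.trans (H.slope_ge (fnorm_nonneg B) (t := fnorm A + fnorm B)
    (by linarith [fnorm_nonneg A]))
  rw [← H.slope_mul, ← H.slope_mul] at h2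
  rw [frob_sub_sub, frob_sub_sub]
  simp only [DH_eq, frob_smul_left, frob_smul_right]
  rw [← fnorm_sq, ← fnorm_sq, frob_comm B A]
  set a := fnorm A
  set b := fnorm B
  set p := frob A B
  set s := slopeH h a
  set r := slopeH h b
  have hd : 0 ≤ a * b - p := by linarith
  have h3 : 2 * s * r ≤ c₂ * (s + r) := by nlinarith
  have h4 := mul_le_mul_of_nonneg_right h3 hd
  nlinarith

lemma mono (H : HypH h c₁ c₂ μ) {n : ℕ} (A B : Matrix (Fin n) (Fin n) ℝ) :
    c₁ * (1 + (fnorm A + fnorm B)) ^ (-μ) * frob (A - B) (A - B)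
      ≤ frob (DH h A - DH h B) (A - B) := by
  obtain ⟨h2, -⟩ := H.mvt2 (fnorm_nonneg A) (fnorm_nonneg B)
  have hp := frob_cauchy A B
  have hA0 := (H.slope_ge (fnorm_nonneg A) (t := fnorm A + fnorm B)
    (by linarith [fnorm_nonneg B]))
  have hB0 := (H.slope_ge (fnorm_nonneg B) (t := fnorm A + fnorm B)
    (by linarith [fnorm_nonneg A]))
  rw [← H.slope_mul, ← H.slope_mul] at h2
  rw [frob_sub_sub, frob_sub_sub]
  simp only [DH_eq, frob_smul_left]
  rw [← fnorm_sq, ← fnorm_sq, frob_comm B A]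
  set a := fnorm A
  set b := fnorm B
  set p := frob A B
  set s := slopeH h a
  set r := slopeH h b
  set w := c₁ * (1 + (a + b)) ^ (-μ)
  have hd : 0 ≤ a * b - p := by linarith
  have h3 : 2 * w ≤ (s + r) := by linarith
  have h4 := mul_le_mul_of_nonneg_right h3 hd
  nlinarith

lemma lip (H : HypH h c₁ c₂ μ) {n : ℕ} (A B : Matrix (Fin n) (Fin n) ℝ) :
    fnorm (DH h A - DH h B) ≤ c₂ * fnorm (A - B) := by
  have h1 := H.coer A B
  have h2 := frob_cauchy (DH h A - DH h B) (A - B)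
  rw [← fnorm_sq] at h1
  have h3 := fnorm_nonneg (DH h A - DH h B)
  have h4 := fnorm_nonneg (A - B)
  have hc₂ := H.hc₂
  by_contra hcon
  push Not at hcon
  have h5 : 0 < fnorm (DH h A - DH h B) := lt_of_le_of_lt (by positivity) hcon
  nlinarith [mul_le_mul_of_nonneg_left h2 hc₂.le]

end HypH

lemma fnorm_continuous : Continuous (fnorm : Matrix (Fin 2) (Fin 2) ℝ → ℝ) := by
  unfold fnorm frob
  fun_prop

lemma abs_le_fnorm {n : ℕ} (A : Matrix (Fin n) (Fin n) ℝ) (i j : Fin n) : |A i j| ≤ fnorm A := by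
  refine Real.abs_le_sqrt ?_
  unfold frob
  have h1 : A i j ^ 2 ≤ ∑ j, A i j * A i j := by
    rw [sq]
    exact Finset.single_le_sum (f := fun j => A i j * A i j)
      (fun j _ => mul_self_nonneg _) (Finset.mem_univ j)
  exact h1.trans (Finset.single_le_sum (f := fun i => ∑ j, A i j * A i j)
      (fun i _ => Finset.sum_nonneg fun j _ => mul_self_nonneg _) (Finset.mem_univ i))

lemma HypH.DH_continuous {h : ℝ → ℝ} {c₁ c₂ μ : ℝ} (H : HypH h c₁ c₂ μ) :
    Continuous (DH h : Matrix (Fin 2) (Fin 2) ℝ → Matrix (Fin 2) (Fin 2) ℝ) := by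
  refine continuous_pi fun i => continuous_pi fun j => ?_
  rw [continuous_iff_continuousAt]
  intro B
  have h1 : Tendsto (fun A : Matrix (Fin 2) (Fin 2) ℝ => c₂ * fnorm (A - B)) (nhds B)
      (nhds (c₂ * fnorm (B - B))) :=
    ((continuous_const.mul (fnorm_continuous.comp (by fun_prop))).tendsto B)
  have h2 : fnorm (B - B) = 0 := by simp [fnorm, frob]
  rw [h2, mul_zero] at h1
  unfold ContinuousAt
  rw [tendsto_iff_dist_tendsto_zero]
  refine squeeze_zero (fun _ => dist_nonneg) (fun A => ?_) h1
  rw [Real.dist_eq]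
  exact (abs_le_fnorm (DH h A - DH h B) i j).trans (H.lip A B)

/-! ### Calculus tools in the plane -/

abbrev E2 := EuclideanSpace ℝ (Fin 2)

def ee (k : Fin 2) : E2 := EuclideanSpace.single k 1

/-- Scalar partial derivative. -/
def dd (k : Fin 2) (f : E2 → ℝ) (x : E2) : ℝ := fderiv ℝ f x (ee k)

/-- `f` vanishes outside the closed ball of radius `r`. -/
def VO (r : ℝ) (f : E2 → ℝ) : Prop := ∀ x, r < ‖x‖ → f x = 0

lemma VO.hasCompactSupport {r : ℝ} {f : E2 → ℝ} (hf : VO r f) : HasCompactSupport f := by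
  refine HasCompactSupport.intro (isCompact_closedBall (0 : E2) r) fun x hx => hf x ?_
  simpa using hx

lemma VO.integrable {r : ℝ} {f : E2 → ℝ} (hf : VO r f) (hc : Continuous f) :
    Integrable f := hc.integrable_of_hasCompactSupport hf.hasCompactSupport

lemma VO.dd {r : ℝ} {f : E2 → ℝ} (hf : VO r f) (k : Fin 2) : VO r (dd k f) := by
  intro x hx
  have h1 : f =ᶠ[nhds x] fun _ => 0 := by
    have : {y : E2 | r < ‖y‖} ∈ nhds x := (isOpen_lt continuous_const continuous_norm).mem_nhds hx
    filter_upwards [this] with y hy using hf y hy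
  unfold _root_.dd
  rw [h1.fderiv_eq]
  simp

lemma dd_continuous {f : E2 → ℝ} (hf : ContDiff ℝ 1 f) (k : Fin 2) : Continuous (dd k f) :=
  (hf.continuous_fderiv (by norm_num)).clm_apply continuous_const

lemma dd_contDiff {f : E2 → ℝ} {n : ℕ} (hf : ContDiff ℝ (n + 1 : ℕ) f) (k : Fin 2) :
    ContDiff ℝ n (dd k f) :=
  (hf.fderiv_right (m := n) (by norm_cast)).clm_apply contDiff_const

lemma dd_add {f g : E2 → ℝ} (hf : ContDiff ℝ 1 f) (hg : ContDiff ℝ 1 g) (k : Fin 2) (x : E2) :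
    dd k (fun y => f y + g y) x = dd k f x + dd k g x := by
  unfold dd
  rw [fderiv_fun_add (hf.differentiable (by norm_num) x) (hg.differentiable (by norm_num) x)]
  rfl

lemma dd_mul {f g : E2 → ℝ} (hf : ContDiff ℝ 1 f) (hg : ContDiff ℝ 1 g) (k : Fin 2) (x : E2) :
    dd k (fun y => f y * g y) x = f x * dd k g x + dd k f x * g x := by
  unfold dd
  rw [fderiv_fun_mul (hf.differentiable (by norm_num) x) (hg.differentiable (by norm_num) x)]
  simp [mul_comm]

lemma dd_neg (f : E2 → ℝ) (k : Fin 2) (x : E2) :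
    dd k (fun y => - f y) x = - dd k f x := by
  unfold dd
  rw [fderiv_fun_neg]
  simp

lemma dd_pow {f : E2 → ℝ} (hf : ContDiff ℝ 1 f) (n : ℕ) (k : Fin 2) (x : E2) :
    dd k (fun y => f y ^ n) x = n * f x ^ (n - 1) * dd k f x := by
  unfold dd
  rw [fderiv_fun_pow n (hf.differentiable (by norm_num) x)]
  simp

lemma dd_shift {f : E2 → ℝ} (v : E2) (k : Fin 2) (x : E2) :
    dd k (fun y => f (y + v)) x = dd k f (x + v) := by
  unfold dd
  rw [fderiv_comp_add_right]

lemma dd_quot {f : E2 → ℝ} (hf : ContDiff ℝ 1 f) (v : E2) (t : ℝ) (k : Fin 2) (x : E2) :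
    dd k (fun y => (f (y + v) - f y) / t) x = (dd k f (x + v) - dd k f x) / t := by
  have hd := hf.differentiable (by norm_num)
  have h1 : DifferentiableAt ℝ (fun y => f (y + v)) x := by fun_prop
  have h2 : DifferentiableAt ℝ (fun y => f (y + v) - f y) x := by fun_prop
  unfold dd
  simp only [div_eq_inv_mul]
  rw [fderiv_const_mul h2, fderiv_fun_sub h1 (hd x), fderiv_comp_add_right]
  simp

lemma ibp {r : ℝ} {f g : E2 → ℝ} (hf : ContDiff ℝ 1 f) (hg : ContDiff ℝ 1 g) (hv : VO r f)
    (k : Fin 2) : ∫ x, f x * dd k g x = - ∫ x, dd k f x * g x := by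
  have c1 := dd_continuous hf k
  have c2 := dd_continuous hg k
  have c3 := hf.continuous
  have c4 := hg.continuous
  refine integral_mul_fderiv_eq_neg_fderiv_mul_of_integrable ?_ ?_ ?_ ?_ ?_
  · refine VO.integrable (r := r) (f := fun x => dd k f x * g x) (fun x hx => ?_) (by fun_prop)
    simp only [hv.dd k x hx, zero_mul]
  · refine VO.integrable (r := r) (f := fun x => f x * dd k g x) (fun x hx => ?_) (by fun_prop)
    simp only [hv x hx, zero_mul]
  · refine VO.integrable (r := r) (f := fun x => f x * g x) (fun x hx => ?_) (by fun_prop)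
    simp only [hv x hx, zero_mul]
  · exact fun x _ => hf.differentiable (by norm_num) x
  · exact fun x _ => hg.differentiable (by norm_num) x

lemma exists_quot {f : E2 → ℝ} (hf : ContDiff ℝ 1 f) (k : Fin 2) :
    ∃ G : ℝ × E2 → ℝ, Continuous G ∧ (∀ x, G (0, x) = dd k f x) ∧
      ∀ t : ℝ, t ≠ 0 → ∀ x, G (t, x) = (f (x + t • ee k) - f x) / t := by
  have c1 := dd_continuous hf k
  refine ⟨fun p => ∫ s in (0:ℝ)..1, dd k f (p.2 + (s * p.1) • ee k), ?_, ?_, ?_⟩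
  · refine intervalIntegral.continuous_parametric_intervalIntegral_of_continuous' ?_ 0 1
    exact c1.comp (by fun_prop)
  · intro x
    simp
  · intro t ht x
    have h1 : ∀ s ∈ Set.uIcc (0:ℝ) 1, HasDerivAt (fun s : ℝ => f (x + (s * t) • ee k) / t)
        (dd k f (x + (s * t) • ee k)) s := by
      intro s _
      have h2 : HasDerivAt (fun s : ℝ => x + (s * t) • ee k) (t • ee k) s := by
        have : HasDerivAt (fun s : ℝ => s * t) t s := by
          simpa using (hasDerivAt_id s).mul_const t
        simpa using (this.smul_const (ee k)).const_add x
      have h3 := ((hf.differentiable (by norm_num) (x + (s * t) • ee k)).hasFDerivAt.comp_hasDerivAt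
        s h2).div_const t
      refine h3.congr_deriv ?_
      rw [map_smul, smul_eq_mul, mul_div_cancel_left₀ _ ht]
      rfl
    have h4 := intervalIntegral.integral_eq_sub_of_hasDerivAt h1
      (Continuous.intervalIntegrable (by fun_prop) _ _)
    simp only [h4, one_mul, zero_mul, zero_smul, add_zero]
    ring

lemma tendsto_int {r : ℝ} {G : ℝ × E2 → ℝ} (hG : Continuous G)
    (hv : ∀ t : ℝ, |t| ≤ 1 → VO r (fun x => G (t, x))) :
    Tendsto (fun t => ∫ x, G (t, x)) (nhds 0) (nhds (∫ x, G (0, x))) := by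
  have h1 : Continuous fun t => ∫ x in Metric.closedBall (0 : E2) r, G (t, x) :=
    continuous_parametric_integral_of_continuous (f := fun t x => G (t, x))
      (by simpa [Function.uncurry_def] using hG) (isCompact_closedBall _ _)
  have h2 : ∀ t : ℝ, |t| ≤ 1 → ∫ x in Metric.closedBall (0 : E2) r, G (t, x) = ∫ x, G (t, x) := by
    intro t ht
    refine setIntegral_eq_integral_of_forall_compl_eq_zero fun x hx => hv t ht x ?_
    simpa using hx
  have h3 := h1.tendsto 0
  rw [h2 0 (by simp)] at h3
  refine h3.congr' ?_
  have : Set.Icc (-1:ℝ) 1 ∈ nhds (0:ℝ) := Icc_mem_nhds (by norm_num) (by norm_num)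
  filter_upwards [this] with t ht
  exact h2 t (abs_le.2 ht)

lemma dd_symm {f : E2 → ℝ} (hf : ContDiff ℝ 2 f) (i j : Fin 2) (x : E2) :
    dd i (dd j f) x = dd j (dd i f) x := by
  have hs : IsSymmSndFDerivAt ℝ f x :=
    (hf.contDiffAt).isSymmSndFDerivAt (by simp)
  have hd : DifferentiableAt ℝ (fderiv ℝ f) x :=
    (hf.fderiv_right (m := 1) (by norm_num)).differentiable (by norm_num) x
  have key : ∀ a b : Fin 2, dd a (dd b f) x = fderiv ℝ (fderiv ℝ f) x (ee a) (ee b) := by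
    intro a b
    unfold dd
    rw [fderiv_clm_apply hd (by fun_prop)]
    simp
  rw [key, key]
  exact hs (ee i) (ee j)

lemma comp_contDiff {u : E2 → E2} {n : WithTop ℕ∞} (hu : ContDiff ℝ n u) (i : Fin 2) :
    ContDiff ℝ n (fun x => u x i) := by
  fun_prop

def pj (i : Fin 2) : E2 →L[ℝ] ℝ := EuclideanSpace.proj i

lemma pj_apply (i : Fin 2) (x : E2) : pj i x = x i := rfl

lemma pd_eq {u : E2 → E2} (hu : ContDiff ℝ 1 u) (k i : Fin 2) (x : E2) :
    pd u k x i = dd k (fun y => u y i) x := by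
  unfold pd dd
  have h1 := hu.differentiable (by norm_num) x
  have := ((pj i).hasFDerivAt.comp x h1.hasFDerivAt).fderiv
  have h2 : (fun y => u y i) =
    (pj i) ∘ u := rfl
  rw [h2, this]
  rfl

lemma e2_decomp (y : E2) : y = y 0 • ee 0 + y 1 • ee 1 := by
  ext i
  fin_cases i <;> simp [ee]

lemma fderiv_apply_eq {f : E2 → ℝ} (x y : E2) :
    fderiv ℝ f x y = y 0 * dd 0 f x + y 1 * dd 1 f x := by
  conv_lhs => rw [e2_decomp y]
  simp [dd]

lemma exists_stream {u : E2 → E2} (hu : ContDiff ℝ 1 u) (hdiv : ∀ x, divg u x = 0) :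
    ∃ ψ : E2 → ℝ, ContDiff ℝ 1 ψ ∧ (∀ x, dd 1 ψ x = u x 0) ∧ (∀ x, dd 0 ψ x = - u x 1) := by
  let p0 : E2 →L[ℝ] ℝ := pj 0
  let p1 : E2 →L[ℝ] ℝ := pj 1
  have c0 := comp_contDiff hu 0
  have c1 := comp_contDiff hu 1
  have d0 := c0.differentiable (by norm_num)
  have d1 := c1.differentiable (by norm_num)
  let ω : E2 → (E2 →L[ℝ] ℝ) := fun x => u x 0 • p1 - u x 1 • p0
  have hω : ∀ x, HasFDerivAt ω ((fderiv ℝ (fun y => u y 0) x).smulRight p1 -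
      (fderiv ℝ (fun y => u y 1) x).smulRight p0) x := fun x =>
    ((d0 x).hasFDerivAt.smul_const p1).sub ((d1 x).hasFDerivAt.smul_const p0)
  obtain ⟨ψ, hψ⟩ := convex_univ.exists_forall_hasFDerivAt_of_fderiv_symmetric
    (ω := ω) isOpen_univ (fun x _ => (hω x).differentiableAt.differentiableWithinAt) (by
      intro a _ x y
      rw [(hω a).fderiv]
      have hd := hdiv a
      simp only [divg, Fin.sum_univ_two, pd_eq hu] at hd
      simp only [_root_.sub_apply, ContinuousLinearMap.smulRight_apply,
        _root_.smul_apply, smul_eq_mul, fderiv_apply_eq, p0, p1, pj_apply]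
      linear_combination (x 0 * y 1 - x 1 * y 0) * hd)
  have hψ' : ∀ x, HasFDerivAt ψ (ω x) x := fun x => hψ x trivial
  refine ⟨ψ, ?_, fun x => ?_, fun x => ?_⟩
  · rw [contDiff_one_iff_fderiv]
    refine ⟨fun x => (hψ' x).differentiableAt, ?_⟩
    have : fderiv ℝ ψ = ω := funext fun x => (hψ' x).fderiv
    rw [this]
    have := c0.continuous
    have := c1.continuous
    fun_prop
  · unfold dd
    rw [(hψ' x).fderiv]
    simp [ω, p0, p1, ee, pj_apply]
  · unfold dd
    rw [(hψ' x).fderiv]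
    simp [ω, p0, p1, ee, pj_apply]

/-! ### Mollification and the weak formulation for `C¹` test fields -/

section mollify

open scoped Convolution

def mo (b : ContDiffBump (0 : E2)) (f : E2 → ℝ) : E2 → ℝ :=
  b.normed volume ⋆[ContinuousLinearMap.lsmul ℝ ℝ, volume] f

lemma mo_contDiff (b : ContDiffBump (0 : E2)) {f : E2 → ℝ} (hf : Continuous f) :
    ContDiff ℝ (⊤ : ℕ∞) (mo b f) :=
  b.hasCompactSupport_normed.contDiff_convolution_left _ b.contDiff_normed hf.locallyIntegrable

lemma mo_dist (b : ContDiffBump (0 : E2)) {f : E2 → ℝ} (hf : Continuous f) {δ : ℝ} (x : E2)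
    (hd : ∀ y ∈ Metric.ball x b.rOut, dist (f y) (f x) ≤ δ) : |mo b f x - f x| ≤ δ := by
  have := b.dist_normed_convolution_le (μ := volume) (g := f) (x₀ := x)
    hf.aestronglyMeasurable hd
  rwa [Real.dist_eq] at this

lemma mo_VO (b : ContDiffBump (0 : E2)) {f : E2 → ℝ} (hf : Continuous f) {r : ℝ} (hv : VO r f) :
    VO (r + b.rOut) (mo b f) := by
  intro x hx
  have hb := b.rOut_pos
  have hfx : f x = 0 := hv x (by linarith)
  have h := mo_dist b hf (δ := 0) x (by
    intro y hy
    have h1 : r < ‖y‖ := by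
      rw [Metric.mem_ball, dist_comm, dist_eq_norm] at hy
      have := norm_sub_norm_le x y
      linarith
    rw [hv y h1, hfx, dist_self])
  rw [hfx, sub_zero] at h
  exact abs_nonpos_iff.1 h

lemma mo_dd (b : ContDiffBump (0 : E2)) {f : E2 → ℝ} (hf : ContDiff ℝ 1 f) {r : ℝ} (hv : VO r f)
    (k : Fin 2) (x : E2) : dd k (mo b f) x = mo b (dd k f) x := by
  have hli : LocallyIntegrable (b.normed (volume : Measure E2)) volume :=
    b.continuous_normed.locallyIntegrable
  have h1 := hv.hasCompactSupport.hasFDerivAt_convolution_right (ContinuousLinearMap.lsmul ℝ ℝ)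
    hli hf x
  have h2 : dd k (mo b f) x = _ := congrArg (fun L : E2 →L[ℝ] ℝ => L (ee k)) h1.fderiv
  rw [h2]
  exact convolution_precompR_apply (ContinuousLinearMap.lsmul ℝ ℝ) hli
    (hv.hasCompactSupport.fderiv ℝ) (hf.continuous_fderiv (by norm_num)) x (ee k)

lemma mo_add (b : ContDiffBump (0 : E2)) {f g : E2 → ℝ} (hf : Continuous f) (hg : Continuous g)
    (x : E2) : mo b (f + g) x = mo b f x + mo b g x := by
  have key : ∀ f : E2 → ℝ, Continuous f → ConvolutionExistsAt (b.normed (volume : Measure E2)) f x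
      (ContinuousLinearMap.lsmul ℝ ℝ) volume := fun f hf =>
    (b.hasCompactSupport_normed.convolutionExists_left _ b.continuous_normed
      hf.locallyIntegrable) x
  exact (key f hf).distrib_add (key g hg)

end mollify

lemma VO.unif {r : ℝ} {f : E2 → ℝ} (hv : VO r f) (hf : Continuous f) {δ : ℝ} (hδ : 0 < δ) :
    ∃ d > 0, ∀ x y, dist y x < d → dist (f y) (f x) ≤ δ := by
  have hu : UniformContinuous f := hv.hasCompactSupport.uniformContinuous_of_continuous hf
  obtain ⟨d, hd, h⟩ := Metric.uniformContinuous_iff.1 hu δ hδ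
  exact ⟨d, hd, fun x y hxy => (h hxy).le⟩

/-- The vector field with two given components. -/
def vf (f g : E2 → ℝ) : E2 → E2 := fun x => !₂[f x, g x]

lemma vf_zero (f g : E2 → ℝ) (x : E2) : vf f g x 0 = f x := by simp [vf]
lemma vf_one (f g : E2 → ℝ) (x : E2) : vf f g x 1 = g x := by simp [vf]

lemma vf_contDiff {f g : E2 → ℝ} {n : WithTop ℕ∞} (hf : ContDiff ℝ n f) (hg : ContDiff ℝ n g) :
    ContDiff ℝ n (vf f g) := by
  rw [contDiff_euclidean]
  intro i
  fin_cases i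
  · simpa [vf] using hf
  · simpa [vf] using hg

lemma vf_compact {f g : E2 → ℝ} {r : ℝ} (hf : VO r f) (hg : VO r g) :
    HasCompactSupport (vf f g) := by
  refine HasCompactSupport.intro (isCompact_closedBall (0 : E2) r) fun x hx => ?_
  have hx' : r < ‖x‖ := by simpa using hx
  ext i
  fin_cases i
  · simpa [vf] using hf x hx'
  · simpa [vf] using hg x hx'

lemma pd_vf_zero {f g : E2 → ℝ} (hf : ContDiff ℝ 1 f) (hg : ContDiff ℝ 1 g) (k : Fin 2) (x : E2) :
    pd (vf f g) k x 0 = dd k f x := by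
  rw [pd_eq (vf_contDiff hf hg)]
  simp only [vf_zero]

lemma pd_vf_one {f g : E2 → ℝ} (hf : ContDiff ℝ 1 f) (hg : ContDiff ℝ 1 g) (k : Fin 2) (x : E2) :
    pd (vf f g) k x 1 = dd k g x := by
  rw [pd_eq (vf_contDiff hf hg)]
  simp only [vf_one]

/-- Integrand of the weak formulation, for the test field `(f, g)`. -/
def wk (σ : E2 → Matrix (Fin 2) (Fin 2) ℝ) (F : Fin 2 → E2 → ℝ) (f g : E2 → ℝ) (x : E2) : ℝ :=
  σ x 0 0 * dd 0 f x + (σ x 0 1 + σ x 1 0) * ((dd 1 f x + dd 0 g x) / 2) + σ x 1 1 * dd 1 g x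
    + (F 0 x * f x + F 1 x * g x)

lemma wk_continuous {σ : E2 → Matrix (Fin 2) (Fin 2) ℝ} {F : Fin 2 → E2 → ℝ} {f g : E2 → ℝ}
    (hσ : Continuous σ) (hF : ∀ i, Continuous (F i)) (hf : ContDiff ℝ 1 f) (hg : ContDiff ℝ 1 g) :
    Continuous (wk σ F f g) := by
  have := dd_continuous hf
  have := dd_continuous hg
  have := hf.continuous
  have := hg.continuous
  unfold wk
  fun_prop

lemma wk_VO {σ : E2 → Matrix (Fin 2) (Fin 2) ℝ} {F : Fin 2 → E2 → ℝ} {f g : E2 → ℝ} {r : ℝ}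
    (hf : VO r f) (hg : VO r g) : VO r (wk σ F f g) := by
  intro x hx
  simp only [wk, hf x hx, hg x hx, hf.dd _ x hx, hg.dd _ x hx]
  ring

lemma weak_C1 {σ : E2 → Matrix (Fin 2) (Fin 2) ℝ} {F : Fin 2 → E2 → ℝ}
    (hσ : Continuous σ) (hF : ∀ i, Continuous (F i))
    (hw : ∀ (r : ℝ) (f g : E2 → ℝ), ContDiff ℝ (⊤ : ℕ∞) f → ContDiff ℝ (⊤ : ℕ∞) g → VO r f →
      VO r g → (∀ x, dd 0 f x + dd 1 g x = 0) → ∫ x, wk σ F f g x = 0)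
    {r : ℝ} {f g : E2 → ℝ} (hf : ContDiff ℝ 1 f) (hg : ContDiff ℝ 1 g) (vf : VO r f) (vg : VO r g)
    (hdiv : ∀ x, dd 0 f x + dd 1 g x = 0) : ∫ x, wk σ F f g x = 0 := by
  let S : E2 → ℝ := fun x => |σ x 0 0| + |σ x 0 1 + σ x 1 0| + |σ x 1 1| + |F 0 x| + |F 1 x|
  have hS : Continuous S := by fun_prop
  set C := ∫ x in Metric.closedBall (0 : E2) (r + 1), S x with hC
  have hC0 : 0 ≤ C := integral_nonneg fun x => by positivity
  have key : ∀ δ > 0, |∫ x, wk σ F f g x| ≤ δ * C := by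
    intro δ hδ
    obtain ⟨d1, hd1, h1⟩ := vf.unif hf.continuous hδ
    obtain ⟨d2, hd2, h2⟩ := vg.unif hg.continuous hδ
    obtain ⟨d3, hd3, h3⟩ := (vf.dd 0).unif (dd_continuous hf 0) hδ
    obtain ⟨d4, hd4, h4⟩ := (vf.dd 1).unif (dd_continuous hf 1) hδ
    obtain ⟨d5, hd5, h5⟩ := (vg.dd 0).unif (dd_continuous hg 0) hδ
    obtain ⟨d6, hd6, h6⟩ := (vg.dd 1).unif (dd_continuous hg 1) hδ
    obtain ⟨d, hd, hdl⟩ : ∃ d > 0, d ≤ 1 ∧ d ≤ d1 ∧ d ≤ d2 ∧ d ≤ d3 ∧ d ≤ d4 ∧ d ≤ d5 ∧ d ≤ d6 := by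
      refine ⟨min 1 (min d1 (min d2 (min d3 (min d4 (min d5 d6))))), by positivity, ?_⟩
      simp
    obtain ⟨e0, e1, e2, e3, e4, e5, e6⟩ := hdl
    let b : ContDiffBump (0 : E2) := ⟨d / 2, d, half_pos hd, half_lt_self hd⟩
    have hb : b.rOut = d := rfl
    have cf := mo_contDiff b hf.continuous
    have cg := mo_contDiff b hg.continuous
    have cf1 : ContDiff ℝ 1 (mo b f) := cf.of_le (by exact_mod_cast le_top)
    have cg1 : ContDiff ℝ 1 (mo b g) := cg.of_le (by exact_mod_cast le_top)
    have vf' : VO (r + 1) (mo b f) := fun x hx =>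
      mo_VO b hf.continuous vf x (by rw [hb]; linarith)
    have vg' : VO (r + 1) (mo b g) := fun x hx =>
      mo_VO b hg.continuous vg x (by rw [hb]; linarith)
    have vf1 : VO (r + 1) f := fun x hx => vf x (by linarith)
    have vg1 : VO (r + 1) g := fun x hx => vg x (by linarith)
    have hz := hw (r + 1) _ _ cf cg vf' vg' (fun x => by
      rw [mo_dd b hf vf, mo_dd b hg vg, ← mo_add b (dd_continuous hf 0) (dd_continuous hg 1)]
      have : dd 0 f + dd 1 g = fun _ => (0:ℝ) := funext hdiv
      rw [this]
      have := mo_dist b (f := fun _ => (0:ℝ)) continuous_const (δ := 0) x (by simp)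
      simpa using this)
    have q1 : ∀ x, |mo b f x - f x| ≤ δ := fun x => mo_dist b hf.continuous x
      fun y hy => h1 x y (lt_of_lt_of_le hy e1)
    have q2 : ∀ x, |mo b g x - g x| ≤ δ := fun x => mo_dist b hg.continuous x
      fun y hy => h2 x y (lt_of_lt_of_le hy e2)
    have q3 : ∀ x, |dd 0 (mo b f) x - dd 0 f x| ≤ δ := fun x => by
      rw [mo_dd b hf vf]
      exact mo_dist b (dd_continuous hf 0) x fun y hy => h3 x y (lt_of_lt_of_le hy e3)
    have q4 : ∀ x, |dd 1 (mo b f) x - dd 1 f x| ≤ δ := fun x => by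
      rw [mo_dd b hf vf]
      exact mo_dist b (dd_continuous hf 1) x fun y hy => h4 x y (lt_of_lt_of_le hy e4)
    have q5 : ∀ x, |dd 0 (mo b g) x - dd 0 g x| ≤ δ := fun x => by
      rw [mo_dd b hg vg]
      exact mo_dist b (dd_continuous hg 0) x fun y hy => h5 x y (lt_of_lt_of_le hy e5)
    have q6 : ∀ x, |dd 1 (mo b g) x - dd 1 g x| ≤ δ := fun x => by
      rw [mo_dd b hg vg]
      exact mo_dist b (dd_continuous hg 1) x fun y hy => h6 x y (lt_of_lt_of_le hy e6)
    have i1 := (wk_VO (σ := σ) (F := F) vf1 vg1).integrable (wk_continuous hσ hF hf hg)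
    have i2 := (wk_VO (σ := σ) (F := F) vf' vg').integrable (wk_continuous hσ hF cf1 cg1)
    have hsub : ∫ x, wk σ F f g x = - ∫ x, (wk σ F (mo b f) (mo b g) x - wk σ F f g x) := by
      rw [integral_sub i2 i1, hz]
      ring
    rw [hsub, abs_neg]
    have hset : ∫ x, (wk σ F (mo b f) (mo b g) x - wk σ F f g x) =
        ∫ x in Metric.closedBall (0 : E2) (r + 1),
          (wk σ F (mo b f) (mo b g) x - wk σ F f g x) := by
      refine (setIntegral_eq_integral_of_forall_compl_eq_zero fun x hx => ?_).symm
      have hx' : r + 1 < ‖x‖ := by simpa using hx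
      rw [wk_VO vf1 vg1 x hx', wk_VO vf' vg' x hx', sub_zero]
    rw [hset, hC, ← integral_const_mul, ← Real.norm_eq_abs]
    refine (norm_integral_le_of_norm_le
      (g := fun x => δ * S x) ?_ ?_)
    · exact (continuous_const.mul hS).continuousOn.integrableOn_compact (isCompact_closedBall _ _)
    · refine ae_of_all _ fun x => ?_
      rw [Real.norm_eq_abs]
      have hm : ∀ a b c : ℝ, |b| ≤ c → |a * b| ≤ c * |a| := fun a b c h => by
        rw [abs_mul, mul_comm]
        exact mul_le_mul_of_nonneg_right h (abs_nonneg a)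
      have p1 := hm (σ x 0 0) _ _ (q3 x)
      have p2 := hm (σ x 0 1 + σ x 1 0)
        (((dd 1 (mo b f) x - dd 1 f x) + (dd 0 (mo b g) x - dd 0 g x)) / 2) δ (by
          rw [abs_div, abs_two]
          have := abs_add_le (dd 1 (mo b f) x - dd 1 f x) (dd 0 (mo b g) x - dd 0 g x)
          linarith [q4 x, q5 x])
      have p3 := hm (σ x 1 1) _ _ (q6 x)
      have p4 := hm (F 0 x) _ _ (q1 x)
      have p5 := hm (F 1 x) _ _ (q2 x)
      have hid : wk σ F (mo b f) (mo b g) x - wk σ F f g x =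
        σ x 0 0 * (dd 0 (mo b f) x - dd 0 f x) + (σ x 0 1 + σ x 1 0) *
          (((dd 1 (mo b f) x - dd 1 f x) + (dd 0 (mo b g) x - dd 0 g x)) / 2) +
          σ x 1 1 * (dd 1 (mo b g) x - dd 1 g x) + F 0 x * (mo b f x - f x) +
          F 1 x * (mo b g x - g x) := by
        unfold wk; ring
      rw [hid]
      have hsum : δ * S x = δ * |σ x 0 0| + δ * |σ x 0 1 + σ x 1 0| + δ * |σ x 1 1| + δ * |F 0 x|
        + δ * |F 1 x| := by simp only [S]; ring
      rw [hsum]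
      refine (abs_add_le _ _).trans (add_le_add ?_ p5)
      refine (abs_add_le _ _).trans (add_le_add ?_ p4)
      refine (abs_add_le _ _).trans (add_le_add ?_ p3)
      exact (abs_add_le _ _).trans (add_le_add p1 p2)
  by_contra hne
  have hpos : 0 < |∫ x, wk σ F f g x| := abs_pos.2 hne
  have := key (|∫ x, wk σ F f g x| / (2 * (C + 1))) (by positivity)
  have h2 : |∫ x, wk σ F f g x| / (2 * (C + 1)) * C < |∫ x, wk σ F f g x| := by
    rw [div_mul_eq_mul_div, div_lt_iff₀ (by positivity)]
    nlinarith
  linarith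

/-! ### Setup for the solution -/

def eps (U : Fin 2 → E2 → ℝ) (x : E2) : Matrix (Fin 2) (Fin 2) ℝ :=
  fun i j => (dd j (U i) x + dd i (U j) x) / 2

def sg (h : ℝ → ℝ) (U : Fin 2 → E2 → ℝ) (x : E2) : Matrix (Fin 2) (Fin 2) ℝ := DH h (eps U x)

def Fc (U : Fin 2 → E2 → ℝ) (i : Fin 2) (x : E2) : ℝ :=
  U 0 x * dd 0 (U i) x + U 1 x * dd 1 (U i) x

structure Sol (h : ℝ → ℝ) (c₁ c₂ μ M : ℝ) (U : Fin 2 → E2 → ℝ) (ψ : E2 → ℝ) : Prop where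
  hH : HypH h c₁ c₂ μ
  hM : 1 ≤ M
  cU : ∀ i, ContDiff ℝ 1 (U i)
  hdiv : ∀ x, dd 0 (U 0) x + dd 1 (U 1) x = 0
  bd : ∀ i x, |U i x| ≤ M
  cψ : ContDiff ℝ 1 ψ
  s1 : ∀ x, dd 1 ψ x = U 0 x
  s0 : ∀ x, dd 0 ψ x = - U 1 x
  weak : ∀ (r : ℝ) (f g : E2 → ℝ), ContDiff ℝ 1 f → ContDiff ℝ 1 g → VO r f →
      VO r g → (∀ x, dd 0 f x + dd 1 g x = 0) → ∫ x, wk (sg h U) (Fc U) f g x = 0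

lemma eps_continuous {U : Fin 2 → E2 → ℝ} (cU : ∀ i, ContDiff ℝ 1 (U i)) : Continuous (eps U) := by
  have : ∀ i j, Continuous (dd i (U j)) := fun i j => dd_continuous (cU j) i
  refine continuous_pi fun i => continuous_pi fun j => ?_
  unfold eps
  fun_prop

lemma Fc_continuous {U : Fin 2 → E2 → ℝ} (cU : ∀ i, ContDiff ℝ 1 (U i)) (i : Fin 2) :
    Continuous (Fc U i) := by
  have : ∀ i j, Continuous (dd i (U j)) := fun i j => dd_continuous (cU j) i
  have : ∀ i, Continuous (U i) := fun i => (cU i).continuous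
  unfold Fc
  fun_prop

lemma sg_continuous {h : ℝ → ℝ} {c₁ c₂ μ : ℝ} (hH : HypH h c₁ c₂ μ)
    {U : Fin 2 → E2 → ℝ} (cU : ∀ i, ContDiff ℝ 1 (U i)) : Continuous (sg h U) :=
  hH.DH_continuous.comp (eps_continuous cU)

/-- Construction of the data from the hypotheses of the theorem. -/
lemma exists_sol {h : ℝ → ℝ} {c₁ c₂ μ : ℝ} (hH : HypH h c₁ c₂ μ) {u : E2 → E2}
    (hu : ContDiff ℝ 1 u) (hdiv : ∀ x, divg u x = 0) (hbdd : ∃ M : ℝ, ∀ x, ‖u x‖ ≤ M)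
    (hweak : IsWeakSolution h u) :
    ∃ M ψ, Sol h c₁ c₂ μ M (fun i x => u x i) ψ := by
  obtain ⟨M, hM⟩ := hbdd
  obtain ⟨ψ, cψ, s1, s0⟩ := exists_stream hu hdiv
  have cU : ∀ i, ContDiff ℝ 1 ((fun i x => u x i : Fin 2 → E2 → ℝ) i) :=
    fun i => comp_contDiff hu i
  refine ⟨|M| + 1, ψ, hH, by linarith [abs_nonneg M], cU, ?_, ?_, cψ, s1, s0, ?_⟩
  · intro x
    have := hdiv x
    simp only [divg, Fin.sum_univ_two, pd_eq hu] at this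
    exact this
  · intro i x
    have h1 : ‖u x i‖ ≤ ‖u x‖ := PiLp.norm_apply_le (u x) i
    rw [Real.norm_eq_abs] at h1
    have := hM x
    have := le_abs_self M
    linarith
  · intro r f g hf hg vf' vg hd
    refine weak_C1 (sg_continuous hH cU) (Fc_continuous cU) ?_ hf hg vf' vg hd
    clear hf hg vf' vg hd f g r
    intro r f g hf hg vf' vg hd
    have hf1 : ContDiff ℝ 1 f := hf.of_le (by exact_mod_cast le_top)
    have hg1 : ContDiff ℝ 1 g := hg.of_le (by exact_mod_cast le_top)
    have := hweak (vf f g) (vf_contDiff hf hg) (vf_compact vf' vg) (fun x => by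
      simp only [divg, Fin.sum_univ_two, pd_vf_zero hf1 hg1, pd_vf_one hf1 hg1]
      exact hd x)
    have e1 : symGrad u = eps (fun i x => u x i) := by
      funext x i j
      simp only [symGrad, eps, pd_eq hu]
    have e2 : (fun x => frob (DH h (symGrad u x)) (symGrad (vf f g) x)) =
        wk (sg h (fun i x => u x i)) (fun _ _ => 0) f g := by
      funext x
      rw [e1]
      simp only [frob, wk, symGrad, Fin.sum_univ_two, pd_vf_zero hf1 hg1, pd_vf_one hf1 hg1, sg]
      ring
    have e3 : (fun x => ∑ k, ∑ i, u x k * pd u k x i * vf f g x i) =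
        wk (fun _ => 0) (Fc (fun i x => u x i)) f g := by
      funext x
      simp only [wk, Fin.sum_univ_two, pd_eq hu, Fc, vf_zero, vf_one]
      simp
      ring
    rw [e2, e3, ← integral_add] at this
    · rw [← this]
      congr 1
      funext x
      simp only [wk]
      simp
    · exact (wk_VO vf' vg).integrable
        (wk_continuous (sg_continuous hH cU) (fun i => continuous_const) hf1 hg1)
    · exact (wk_VO vf' vg).integrable
        (wk_continuous continuous_const (Fc_continuous cU) hf1 hg1)

/-- Difference quotient. -/
def dq (k : Fin 2) (t : ℝ) (f : E2 → ℝ) (x : E2) : ℝ := (f (x + t • ee k) - f x) / t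

/-- Difference quotient of a matrix field. -/
def dqm (k : Fin 2) (t : ℝ) (A : E2 → Matrix (Fin 2) (Fin 2) ℝ) (x : E2) :
    Matrix (Fin 2) (Fin 2) ℝ := t⁻¹ • (A (x + t • ee k) - A x)

lemma dqm_apply (k : Fin 2) (t : ℝ) (A : E2 → Matrix (Fin 2) (Fin 2) ℝ) (x : E2) (i j : Fin 2) :
    dqm k t A x i j = (A (x + t • ee k) i j - A x i j) / t := by
  simp only [dqm, Matrix.smul_apply, Matrix.sub_apply, smul_eq_mul]
  ring

lemma dq_contDiff {f : E2 → ℝ} {n : WithTop ℕ∞} (hf : ContDiff ℝ n f) (k : Fin 2) (t : ℝ) :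
    ContDiff ℝ n (dq k t f) := by
  unfold dq
  fun_prop

lemma dq_continuous {f : E2 → ℝ} (hf : Continuous f) (k : Fin 2) (t : ℝ) :
    Continuous (dq k t f) := by
  unfold dq
  fun_prop

lemma dqm_continuous {A : E2 → Matrix (Fin 2) (Fin 2) ℝ} (hf : Continuous A) (k : Fin 2) (t : ℝ) :
    Continuous (dqm k t A) := by
  unfold dqm
  fun_prop

lemma dd_dq {f : E2 → ℝ} (hf : ContDiff ℝ 1 f) (j k : Fin 2) (t : ℝ) (x : E2) :
    dd j (dq k t f) x = dq k t (dd j f) x := dd_quot hf _ t j x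

lemma Sol.weak_dq {h : ℝ → ℝ} {c₁ c₂ μ M : ℝ} {U : Fin 2 → E2 → ℝ} {ψ : E2 → ℝ}
    (S : Sol h c₁ c₂ μ M U ψ) (k : Fin 2) {t : ℝ}
    {r : ℝ} {f g : E2 → ℝ} (hf : ContDiff ℝ 1 f) (hg : ContDiff ℝ 1 g) (vf : VO r f) (vg : VO r g)
    (hd : ∀ x, dd 0 f x + dd 1 g x = 0) :
    ∫ x, wk (dqm k t (sg h U)) (fun i => dq k t (Fc U i)) f g x = 0 := by
  set v := t • ee k with hv
  have cσ := sg_continuous S.hH S.cU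
  have cF := Fc_continuous S.cU
  have i0 := S.weak r f g hf hg vf vg hd
  have hsh : ∀ f : E2 → ℝ, VO r f → VO (r + ‖v‖) (fun y => f (y + -v)) := by
    intro f hf x hx
    refine hf _ ?_
    have := norm_add_le (x + -v) v
    simp only [neg_add_cancel_right] at this
    linarith
  have i1 := S.weak (r + ‖v‖) (fun y => f (y + -v)) (fun y => g (y + -v)) (by fun_prop)
    (by fun_prop) (hsh f vf) (hsh g vg) (fun x => by
      rw [dd_shift, dd_shift]; exact hd _)
  rw [← integral_add_right_eq_self _ v] at i1
  have e1 : ∀ x, wk (sg h U) (Fc U) (fun y => f (y + -v)) (fun y => g (y + -v)) (x + v) =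
      wk (fun x => sg h U (x + v)) (fun i x => Fc U i (x + v)) f g x := by
    intro x
    simp only [wk, dd_shift, add_neg_cancel_right]
  simp only [e1] at i1
  have e2 : ∀ x, wk (dqm k t (sg h U)) (fun i => dq k t (Fc U i)) f g x =
      t⁻¹ * (wk (fun x => sg h U (x + v)) (fun i x => Fc U i (x + v)) f g x -
        wk (sg h U) (Fc U) f g x) := by
    intro x
    simp only [wk, dqm_apply, dq]
    ring
  simp only [e2]
  rw [integral_const_mul, integral_sub, i0, i1]
  · simp
  · exact (wk_VO vf vg).integrable (wk_continuous (by fun_prop) (by fun_prop) hf hg)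
  · exact (wk_VO vf vg).integrable (wk_continuous cσ cF hf hg)

/-- Dissipation density of the difference quotients. -/
def Pd (h : ℝ → ℝ) (U : Fin 2 → E2 → ℝ) (k : Fin 2) (t : ℝ) (x : E2) : ℝ :=
  frob (dqm k t (sg h U) x) (dqm k t (eps U) x)

lemma frob_dqm (k : Fin 2) (t : ℝ) (A B : E2 → Matrix (Fin 2) (Fin 2) ℝ) (x : E2) :
    frob (dqm k t A x) (dqm k t B x) =
      t⁻¹ ^ 2 * frob (A (x + t • ee k) - A x) (B (x + t • ee k) - B x) := by
  simp only [dqm, frob_smul_left, frob_smul_right]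
  ring

lemma Sol.Pd_coer {h : ℝ → ℝ} {c₁ c₂ μ M : ℝ} {U : Fin 2 → E2 → ℝ} {ψ : E2 → ℝ}
    (S : Sol h c₁ c₂ μ M U ψ) (k : Fin 2) (t : ℝ) (x : E2) :
    frob (dqm k t (sg h U) x) (dqm k t (sg h U) x) ≤ c₂ * Pd h U k t x := by
  rw [Pd, frob_dqm, frob_dqm]
  have := S.hH.coer (eps U (x + t • ee k)) (eps U x)
  calc _ ≤ t⁻¹ ^ 2 * (c₂ * _) := mul_le_mul_of_nonneg_left this (by positivity)
    _ = _ := by simp only [sg]; ring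

lemma Sol.Pd_mono {h : ℝ → ℝ} {c₁ c₂ μ M : ℝ} {U : Fin 2 → E2 → ℝ} {ψ : E2 → ℝ}
    (S : Sol h c₁ c₂ μ M U ψ) (k : Fin 2) (t : ℝ) (x : E2) :
    c₁ * (1 + (fnorm (eps U (x + t • ee k)) + fnorm (eps U x))) ^ (-μ) *
      frob (dqm k t (eps U) x) (dqm k t (eps U) x) ≤ Pd h U k t x := by
  rw [Pd, frob_dqm, frob_dqm]
  have := S.hH.mono (eps U (x + t • ee k)) (eps U x)
  calc _ = t⁻¹ ^ 2 * _ := by ring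
    _ ≤ _ := mul_le_mul_of_nonneg_left this (by positivity)

lemma Sol.Pd_nonneg {h : ℝ → ℝ} {c₁ c₂ μ M : ℝ} {U : Fin 2 → E2 → ℝ} {ψ : E2 → ℝ}
    (S : Sol h c₁ c₂ μ M U ψ) (k : Fin 2) (t : ℝ) (x : E2) : 0 ≤ Pd h U k t x := by
  have := (frob_self_nonneg _).trans (S.Pd_coer k t x)
  exact nonneg_of_mul_nonneg_right this S.hH.hc₂

lemma Sol.Pd_continuous {h : ℝ → ℝ} {c₁ c₂ μ M : ℝ} {U : Fin 2 → E2 → ℝ} {ψ : E2 → ℝ}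
    (S : Sol h c₁ c₂ μ M U ψ) (k : Fin 2) (t : ℝ) : Continuous (Pd h U k t) := by
  have c1 := dqm_continuous (sg_continuous S.hH S.cU) k t
  have c2 := dqm_continuous (eps_continuous S.cU) k t
  unfold Pd frob
  fun_prop

/-! ### Caccioppoli-type inequality for difference quotients -/

def HD (k : Fin 2) (f : E2 → ℝ) (x : E2) (d : ℝ) : Prop := DifferentiableAt ℝ f x ∧ dd k f x = d

lemma HD.of {f : E2 → ℝ} (hf : ContDiff ℝ 1 f) (k : Fin 2) (x : E2) : HD k f x (dd k f x) :=
  ⟨hf.differentiable (by norm_num) x, rfl⟩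

lemma HD.add {k : Fin 2} {f g : E2 → ℝ} {x : E2} {a b : ℝ} (hf : HD k f x a) (hg : HD k g x b) :
    HD k (fun y => f y + g y) x (a + b) := by
  refine ⟨hf.1.fun_add hg.1, ?_⟩
  rw [← hf.2, ← hg.2]
  unfold dd
  rw [fderiv_fun_add hf.1 hg.1]
  rfl

lemma HD.mul {k : Fin 2} {f g : E2 → ℝ} {x : E2} {a b : ℝ} (hf : HD k f x a) (hg : HD k g x b) :
    HD k (fun y => f y * g y) x (f x * b + a * g x) := by
  refine ⟨hf.1.fun_mul hg.1, ?_⟩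
  rw [← hf.2, ← hg.2]
  unfold dd
  rw [fderiv_fun_mul hf.1 hg.1]
  simp [mul_comm]

lemma HD.neg {k : Fin 2} {f : E2 → ℝ} {x : E2} {a : ℝ} (hf : HD k f x a) :
    HD k (fun y => - f y) x (-a) := by
  refine ⟨hf.1.fun_neg, ?_⟩
  rw [dd_neg, hf.2]

lemma HD.cmul {k : Fin 2} {f : E2 → ℝ} {x : E2} {a : ℝ} (c : ℝ) (hf : HD k f x a) :
    HD k (fun y => c * f y) x (c * a) := by
  refine ⟨hf.1.const_mul c, ?_⟩
  rw [← hf.2]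
  unfold dd
  rw [fderiv_const_mul hf.1]
  rfl

lemma int_dd {r : ℝ} {f : E2 → ℝ} (hf : ContDiff ℝ 1 f) (hv : VO r f) (k : Fin 2) :
    ∫ x, dd k f x = 0 := by
  have := ibp hf (contDiff_const (c := (1:ℝ))) hv k
  have h0 : ∀ x, dd k (fun _ : E2 => (1:ℝ)) x = 0 := fun x => by simp [dd]
  simp only [h0, mul_zero, mul_one, integral_zero] at this
  linarith

structure Cut (K R r : ℝ) (θ q : E2 → ℝ) : Prop where
  cθ : ContDiff ℝ 2 θ
  θ0 : ∀ x, 0 ≤ θ x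
  vθ : VO r θ
  cq : Continuous q
  q0 : ∀ x, 0 ≤ q x
  vq : VO r q
  d1 : ∀ j x, |dd j (fun y => θ y ^ 2) x| ≤ K / R * (θ x * q x)
  d1' : ∀ j x, |dd j (fun y => θ y ^ 2) x| ≤ K / R * q x ^ 2
  d2 : ∀ i j x, |dd i (dd j (fun y => θ y ^ 2)) x| ≤ K / R ^ 2 * (θ x * q x)
  d2' : ∀ i j x, |dd i (dd j (fun y => θ y ^ 2)) x| ≤ K / R ^ 2 * q x ^ 2

def conv (η : ℝ) (n : Fin 2 → ℝ) (e : Fin 2 → Fin 2 → ℝ) (w : Fin 2 → ℝ) (a : ℝ)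
    (Ut U : Fin 2 → ℝ) (g : Fin 2 → Fin 2 → ℝ) : ℝ :=
  - η * (w 0 * w 0 * g 0 0 + w 0 * w 1 * g 0 1 + w 1 * w 0 * g 1 0 + w 1 * w 1 * g 1 1)
  + 1 / 2 * (n 0 * Ut 0 + n 1 * Ut 1) * (w 0 * w 0 + w 1 * w 1)
  + (Ut 0 * w 0 + w 0 * U 0) * (- w 1 * n 1 + a * e 0 1)
  + (Ut 1 * w 0 + w 1 * U 0) * (w 0 * n 1 + a * e 1 1)
  + (Ut 0 * w 1 + w 0 * U 1) * (w 1 * n 0 - a * e 0 0)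
  + (Ut 1 * w 1 + w 1 * U 1) * (- w 0 * n 0 - a * e 1 0)

def tau (K R q : ℝ) (w : Fin 2 → ℝ) (a : ℝ) : ℝ := K * q * (|a| / R ^ 2 + (|w 0| + |w 1|) / R)

lemma alg_young {c P θ τ s00 s01 s10 s11 T00 T01 T11 : ℝ} (hc : 0 < c) (hθ : 0 ≤ θ)
    (hs : s00 ^ 2 + s01 ^ 2 + s10 ^ 2 + s11 ^ 2 ≤ c * P)
    (h0 : |T00| ≤ θ * τ) (h1 : |T01| ≤ θ * τ) (h2 : |T11| ≤ θ * τ) :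
    -(s00 * T00 + (s01 + s10) * T01 + s11 * T11) ≤ 1 / 2 * θ ^ 2 * P + 2 * c * τ ^ 2 := by
  have key : ∀ s T : ℝ, |T| ≤ θ * τ → -(s * T) ≤ θ ^ 2 * s ^ 2 / (2 * c) + c * τ ^ 2 / 2 := by
    intro s T hT
    have h3 : -(s * T) ≤ |s| * (θ * τ) := by
      calc -(s * T) ≤ |s * T| := neg_le_abs _
        _ = |s| * |T| := abs_mul _ _
        _ ≤ _ := mul_le_mul_of_nonneg_left hT (abs_nonneg _)
    have h4 : θ ^ 2 * s ^ 2 / (2 * c) + c * τ ^ 2 / 2 - |s| * (θ * τ) =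
        (θ * |s| - c * τ) ^ 2 / (2 * c) := by
      rw [← sq_abs s]
      field_simp
      ring
    have h5 : 0 ≤ (θ * |s| - c * τ) ^ 2 / (2 * c) := by positivity
    linarith
  have k1 := key s00 T00 h0
  have k2 := key s01 T01 h1
  have k3 := key s10 T01 h1
  have k4 := key s11 T11 h2
  have k5 : θ ^ 2 / (2 * c) * (s00 ^ 2 + s01 ^ 2 + s10 ^ 2 + s11 ^ 2) ≤ θ ^ 2 / (2 * c) * (c * P) :=
    mul_le_mul_of_nonneg_left hs (by positivity)
  have k6 : θ ^ 2 / (2 * c) * (c * P) = 1 / 2 * θ ^ 2 * P := by field_simp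
  have k7 : θ ^ 2 / (2 * c) * (s00 ^ 2 + s01 ^ 2 + s10 ^ 2 + s11 ^ 2) =
    θ ^ 2 * s00 ^ 2 / (2 * c) + θ ^ 2 * s01 ^ 2 / (2 * c) + θ ^ 2 * s10 ^ 2 / (2 * c)
     + θ ^ 2 * s11 ^ 2 / (2 * c) := by ring
  linarith

lemma Sol.dq_stream {h : ℝ → ℝ} {c₁ c₂ μ M : ℝ} {U : Fin 2 → E2 → ℝ} {ψ : E2 → ℝ}
    (S : Sol h c₁ c₂ μ M U ψ) (k : Fin 2) (t : ℝ) (x : E2) :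
    dd 0 (dq k t ψ) x = - dq k t (U 1) x ∧ dd 1 (dq k t ψ) x = dq k t (U 0) x := by
  rw [dd_dq S.cψ, dd_dq S.cψ]
  simp only [dq, S.s0, S.s1]
  refine ⟨by ring, trivial⟩

lemma Sol.caccio_t {h : ℝ → ℝ} {c₁ c₂ μ M : ℝ} {U : Fin 2 → E2 → ℝ} {ψ : E2 → ℝ}
    (S : Sol h c₁ c₂ μ M U ψ) {K R r : ℝ} (hK : 0 ≤ K) (hR : 1 ≤ R) {θ q : E2 → ℝ}
    (C : Cut K R r θ q) (k : Fin 2) (t : ℝ) :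
    1 / 2 * ∫ x, θ x ^ 2 * Pd h U k t x ≤
      ∫ x, (2 * c₂ * tau K R (q x) (fun i => dq k t (U i) x) (dq k t ψ x) ^ 2 +
        conv (θ x ^ 2) (fun j => dd j (fun y => θ y ^ 2) x)
          (fun i j => dd i (dd j (fun y => θ y ^ 2)) x) (fun i => dq k t (U i) x) (dq k t ψ x)
          (fun i => U i (x + t • ee k)) (fun i => U i x) (fun i j => dd j (U i) x)) := by
  set η : E2 → ℝ := fun y => θ y ^ 2 with hη
  have cη : ContDiff ℝ 2 η := C.cθ.pow 2
  have cη1 : ContDiff ℝ 1 η := cη.of_le (by norm_num)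
  have cn : ∀ j, ContDiff ℝ 1 (dd j η) := fun j => dd_contDiff (n := 1) cη j
  have vη : VO r η := fun x hx => by simp [hη, C.vθ x hx]
  set a := dq k t ψ with ha
  set w : Fin 2 → E2 → ℝ := fun i => dq k t (U i) with hw
  set Ut : Fin 2 → E2 → ℝ := fun i y => U i (y + t • ee k) with hUt
  have ca : ContDiff ℝ 1 a := dq_contDiff S.cψ k t
  have cw : ∀ i, ContDiff ℝ 1 (w i) := fun i => dq_contDiff (S.cU i) k t
  have cUt : ∀ i, ContDiff ℝ 1 (Ut i) := fun i => (S.cU i).comp (by fun_prop)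
  have cU := S.cU
  have da0 : ∀ x, dd 0 a x = - w 1 x := fun x => (S.dq_stream k t x).1
  have da1 : ∀ x, dd 1 a x = w 0 x := fun x => (S.dq_stream k t x).2
  have dw : ∀ j i x, dd j (w i) x = dq k t (dd j (U i)) x := fun j i x => dd_dq (S.cU i) j k t x
  have dUt : ∀ j i x, dd j (Ut i) x = dd j (U i) (x + t • ee k) := fun j i x => dd_shift _ j x
  -- the test field
  have cn0 := cn 0
  have cn1 := cn 1
  have cw0 := cw 0
  have cw1 := cw 1
  have cU0 := cU 0
  have cU1 := cU 1
  have cUt0 := cUt 0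
  have cUt1 := cUt 1
  let f : E2 → ℝ := fun y => dd 1 η y * a y + η y * w 0 y
  let g : E2 → ℝ := fun y => -(dd 0 η y * a y) + η y * w 1 y
  have cf : ContDiff ℝ 1 f := (cn1.mul ca).add (cη1.mul cw0)
  have cg : ContDiff ℝ 1 g := (cn0.mul ca).neg.add (cη1.mul cw1)
  have vf' : VO r f := fun x hx => by simp [f, vη x hx, vη.dd 1 x hx]
  have vg : VO r g := fun x hx => by simp [g, vη x hx, vη.dd 0 x hx]
  have Df : ∀ j x, dd j f x = _ := fun j x =>
    (((HD.of cn1 j x).mul (HD.of ca j x)).add ((HD.of cη1 j x).mul (HD.of cw0 j x))).2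
  have Dg : ∀ j x, dd j g x = _ := fun j x =>
    (((HD.of cn0 j x).mul (HD.of ca j x)).neg.add ((HD.of cη1 j x).mul (HD.of cw1 j x))).2
  have esym : ∀ x, dd 0 (dd 1 η) x = dd 1 (dd 0 η) x := fun x => dd_symm cη 0 1 x
  have divw : ∀ x, dd 0 (w 0) x + dd 1 (w 1) x = 0 := fun x => by
    rw [dw, dw]
    simp only [dq]
    rw [← add_div]
    have h1 := S.hdiv x
    have h2 := S.hdiv (x + t • ee k)
    rw [show dd 0 (U 0) (x + t • ee k) - dd 0 (U 0) x + (dd 1 (U 1) (x + t • ee k) - dd 1 (U 1) x)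
      = 0 by linarith, zero_div]
  have hd : ∀ x, dd 0 f x + dd 1 g x = 0 := fun x => by
    rw [Df, Dg, da0, da1, esym]
    linear_combination η x * divw x
  have hweak := S.weak_dq k (t := t) cf cg vf' vg hd
  -- the divergence terms
  let F0 : E2 → ℝ := fun y => 1 / 2 * (η y * (Ut 0 y * (w 0 y * w 0 y + w 1 y * w 1 y))) +
    a y * (dd 1 η y * (Ut 0 y * w 0 y + w 0 y * U 0 y) +
      -(dd 0 η y * (Ut 0 y * w 1 y + w 0 y * U 1 y)))
  let F1 : E2 → ℝ := fun y => 1 / 2 * (η y * (Ut 1 y * (w 0 y * w 0 y + w 1 y * w 1 y))) +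
    a y * (dd 1 η y * (Ut 1 y * w 0 y + w 1 y * U 0 y) +
      -(dd 0 η y * (Ut 1 y * w 1 y + w 1 y * U 1 y)))
  have cF0 : ContDiff ℝ 1 F0 := by fun_prop
  have cF1 : ContDiff ℝ 1 F1 := by fun_prop
  have vF0 : VO r F0 := fun x hx => by simp [F0, vη x hx, vη.dd _ x hx]
  have vF1 : VO r F1 := fun x hx => by simp [F1, vη x hx, vη.dd _ x hx]
  have DF0 : ∀ x, dd 0 F0 x = _ := fun x =>
    (((HD.of cη1 0 x).mul ((HD.of cUt0 0 x).mul (((HD.of cw0 0 x).mul (HD.of cw0 0 x)).add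
      ((HD.of cw1 0 x).mul (HD.of cw1 0 x))))).cmul (1 / 2) |>.add
    ((HD.of ca 0 x).mul (((HD.of cn1 0 x).mul (((HD.of cUt0 0 x).mul (HD.of cw0 0 x)).add
      ((HD.of cw0 0 x).mul (HD.of cU0 0 x)))).add ((HD.of cn0 0 x).mul
        (((HD.of cUt0 0 x).mul (HD.of cw1 0 x)).add ((HD.of cw0 0 x).mul (HD.of cU1 0 x)))).neg))).2
  have DF1 : ∀ x, dd 1 F1 x = _ := fun x =>
    (((HD.of cη1 1 x).mul ((HD.of cUt1 1 x).mul (((HD.of cw0 1 x).mul (HD.of cw0 1 x)).add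
      ((HD.of cw1 1 x).mul (HD.of cw1 1 x))))).cmul (1 / 2) |>.add
    ((HD.of ca 1 x).mul (((HD.of cn1 1 x).mul (((HD.of cUt1 1 x).mul (HD.of cw0 1 x)).add
      ((HD.of cw1 1 x).mul (HD.of cU0 1 x)))).add ((HD.of cn0 1 x).mul
        (((HD.of cUt1 1 x).mul (HD.of cw1 1 x)).add ((HD.of cw1 1 x).mul (HD.of cU1 1 x)))).neg))).2
  have i0 := int_dd cF0 vF0 0
  have i1 := int_dd cF1 vF1 1
  have I0 := (vF0.dd 0).integrable (dd_continuous cF0 0)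
  have I1 := (vF1.dd 1).integrable (dd_continuous cF1 1)
  have cwk := wk_continuous (dqm_continuous (sg_continuous S.hH S.cU) k t)
      (fun i => dq_continuous (Fc_continuous S.cU i) k t) cf cg
  have Iw := (wk_VO (σ := dqm k t (sg h U)) (F := fun i => dq k t (Fc U i)) vf' vg).integrable cwk
  set G : E2 → ℝ := fun x => 2 * c₂ * tau K R (q x) (fun i => w i x) (a x) ^ 2 +
        conv (η x) (fun j => dd j η x)
          (fun i j => dd i (dd j η) x) (fun i => w i x) (a x)
          (fun i => Ut i x) (fun i => U i x) (fun i j => dd j (U i) x) with hG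
  have cG : Continuous G := by
    have k1 : ∀ i j, Continuous (dd i (dd j η)) := fun i j => dd_continuous (cn j) i
    have k2 : ∀ i j, Continuous (dd i (U j)) := fun i j => dd_continuous (cU j) i
    have k3 := C.cq
    have k4 := cη1.continuous
    have k5 := fun i => (cn i).continuous
    have k6 := ca.continuous
    have k7 := fun i => (cw i).continuous
    have k8 := fun i => (cU i).continuous
    have k9 := fun i => (cUt i).continuous
    simp only [hG, tau, conv]
    fun_prop
  have vG : VO r G := fun x hx => by
    simp [hG, tau, conv, vη x hx, vη.dd _ x hx, (vη.dd _).dd _ x hx, C.vq x hx]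
  have IG := vG.integrable cG
  have IP : Integrable (fun x => θ x ^ 2 * Pd h U k t x) :=
    VO.integrable (r := r) (fun x hx => by simp [C.vθ x hx])
      ((C.cθ.continuous.pow 2).mul (S.Pd_continuous k t))
  have hR0 : 0 < R := by linarith
  have key : ∀ x, 1 / 2 * (θ x ^ 2 * Pd h U k t x) ≤
      wk (dqm k t (sg h U)) (fun i => dq k t (Fc U i)) f g x - dd 0 F0 x - dd 1 F1 x + G x := by
    intro x
    set s := dqm k t (sg h U) x with hs
    have hP : Pd h U k t x = s 0 0 * dd 0 (w 0) x + (s 0 1 + s 1 0) * ((dd 1 (w 0) x +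
        dd 0 (w 1) x) / 2) + s 1 1 * dd 1 (w 1) x := by
      simp only [Pd, frob, Fin.sum_univ_two, dw, dq, ← hs]
      simp only [dqm_apply, eps]
      ring
    have hco : s 0 0 ^ 2 + s 0 1 ^ 2 + s 1 0 ^ 2 + s 1 1 ^ 2 ≤ c₂ * Pd h U k t x := by
      have := S.Pd_coer k t x
      simp only [frob, Fin.sum_univ_two, ← hs] at this
      linarith
    let T00 := dd 0 (dd 1 η) x * a x - dd 1 η x * w 1 x + dd 0 η x * w 0 x
    let T11 := -(dd 1 (dd 0 η) x * a x) - dd 0 η x * w 0 x + dd 1 η x * w 1 x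
    let T01 := ((dd 1 (dd 1 η) x - dd 0 (dd 0 η) x) * a x + 2 * (dd 1 η x * w 0 x)
      + 2 * (dd 0 η x * w 1 x)) / 2
    set τ := tau K R (q x) (fun i => w i x) (a x) with hτ
    have hτe : θ x * τ = K / R ^ 2 * (θ x * q x) * |a x| + K / R * (θ x * q x) * |w 0 x| +
        K / R * (θ x * q x) * |w 1 x| := by
      simp only [hτ, tau]; ring
    have m1 : ∀ i j, |dd i (dd j η) x * a x| ≤ K / R ^ 2 * (θ x * q x) * |a x| := fun i j => by
      rw [abs_mul]; exact mul_le_mul_of_nonneg_right (C.d2 i j x) (abs_nonneg _)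
    have m2 : ∀ i j, |dd i η x * w j x| ≤ K / R * (θ x * q x) * |w j x| := fun i j => by
      rw [abs_mul]; exact mul_le_mul_of_nonneg_right (C.d1 i x) (abs_nonneg _)
    have b0 : |T00| ≤ θ x * τ := by
      rw [hτe, abs_le]
      have := abs_le.1 (m1 0 1); have := abs_le.1 (m2 1 1); have := abs_le.1 (m2 0 0)
      constructor <;> simp only [T00] <;> linarith
    have b2 : |T11| ≤ θ x * τ := by
      rw [hτe, abs_le]
      have := abs_le.1 (m1 1 0); have := abs_le.1 (m2 1 1); have := abs_le.1 (m2 0 0)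
      constructor <;> simp only [T11] <;> linarith
    have b1 : |T01| ≤ θ x * τ := by
      rw [hτe, abs_le]
      have := abs_le.1 (m1 1 1); have := abs_le.1 (m1 0 0)
      have := abs_le.1 (m2 1 0); have := abs_le.1 (m2 0 1)
      constructor <;> simp only [T01] <;> linarith
    have hy := alg_young S.hH.hc₂ (C.θ0 x) hco b0 b1 b2
    have hFc : ∀ i, dq k t (Fc U i) x = Ut 0 x * dd 0 (w i) x + Ut 1 x * dd 1 (w i) x +
        w 0 x * dd 0 (U i) x + w 1 x * dd 1 (U i) x := fun i => by
      rw [dw, dw]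
      simp only [hw, hUt, dq, Fc]
      ring
    have hdU := S.hdiv x
    have hdUt : dd 0 (Ut 0) x + dd 1 (Ut 1) x = 0 := by
      rw [dUt, dUt]; exact S.hdiv _
    have hdw := divw x
    have hes := esym x
    have hid : wk (dqm k t (sg h U)) (fun i => dq k t (Fc U i)) f g x - dd 0 F0 x - dd 1 F1 x =
        η x * Pd h U k t x + (s 0 0 * T00 + (s 0 1 + s 1 0) * T01 + s 1 1 * T11) -
        conv (η x) (fun j => dd j η x)
          (fun i j => dd i (dd j η) x) (fun i => w i x) (a x)
          (fun i => Ut i x) (fun i => U i x) (fun i j => dd j (U i) x) := by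
      rw [hP, DF0, DF1]
      simp only [wk, hFc, Df, Dg, da0, da1, conv, T00, T01, T11, f, g, ← hs]
      linear_combination (-(1 / 2) * η x * (w 0 x * w 0 x + w 1 x * w 1 x) - a x * dd 1 η x * w 0 x
        + a x * dd 0 η x * w 1 x) * hdUt + (- a x * dd 1 η x * U 0 x + a x * dd 0 η x * U 1 x) * hdw
    rw [hid]
    simp only [hG]
    have : η x = θ x ^ 2 := rfl
    rw [this]
    linarith
  have j2 : Integrable (fun x => wk (dqm k t (sg h U)) (fun i => dq k t (Fc U i)) f g x -
      dd 0 F0 x) := Iw.sub I0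
  have j1 : Integrable (fun x => wk (dqm k t (sg h U)) (fun i => dq k t (Fc U i)) f g x -
      dd 0 F0 x - dd 1 F1 x) := j2.sub I1
  have hfin : ∫ x, 1 / 2 * (θ x ^ 2 * Pd h U k t x) ≤
      ∫ x, (wk (dqm k t (sg h U)) (fun i => dq k t (Fc U i)) f g x - dd 0 F0 x - dd 1 F1 x + G x) :=
    integral_mono (IP.const_mul _) (j1.add IG) key
  rw [integral_const_mul] at hfin
  refine hfin.trans (le_of_eq ?_)
  rw [integral_add j1 IG, integral_sub j2 I1, integral_sub Iw I0, hweak,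
    i0, i1]
  ring

/-- Squared full gradient. -/
def VV (U : Fin 2 → E2 → ℝ) (x : E2) : ℝ :=
  dd 0 (U 0) x ^ 2 + dd 1 (U 0) x ^ 2 + dd 0 (U 1) x ^ 2 + dd 1 (U 1) x ^ 2

lemma VV_nonneg (U : Fin 2 → E2 → ℝ) (x : E2) : 0 ≤ VV U x := by unfold VV; positivity

lemma VV_continuous {U : Fin 2 → E2 → ℝ} (cU : ∀ i, ContDiff ℝ 1 (U i)) : Continuous (VV U) := by
  have : ∀ i j, Continuous (dd i (U j)) := fun i j => dd_continuous (cU j) i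
  unfold VV
  fun_prop

def Et (h : ℝ → ℝ) (U : Fin 2 → E2 → ℝ) (θ : E2 → ℝ) (t : ℝ) : ℝ :=
  ∫ x, θ x ^ 2 * (Pd h U 0 t x + Pd h U 1 t x)

set_option maxHeartbeats 1000000 in
lemma alg_conv {c K ρ M q η a : ℝ} {n w U : Fin 2 → ℝ} {e g : Fin 2 → Fin 2 → ℝ} (hc : 0 < c)
    (hK : 0 ≤ K) (hρ : 0 < ρ) (hρ1 : ρ ≤ 1) (hM : 1 ≤ M) (ha : |a| ≤ M)
    (hn : ∀ i, |n i| ≤ K * ρ * q ^ 2) (he : ∀ i j, |e i j| ≤ K * ρ ^ 2 * q ^ 2)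
    (hU : ∀ i, |U i| ≤ M) :
    2 * c * (K * q * (|a| * ρ ^ 2 + (|w 0| + |w 1|) * ρ)) ^ 2 + conv η n e w a U U g
      + η * (w 0 * w 0 * g 0 0 + w 0 * w 1 * g 0 1 + w 1 * w 0 * g 1 0 + w 1 * w 1 * g 1 1) ≤
    (40 * M ^ 2 * K + 8 * c * K ^ 2 * M ^ 2) * (ρ * (q ^ 2 * (w 0 ^ 2 + w 1 ^ 2)) + ρ ^ 3 * q ^ 2) := by
  set s := |w 0| + |w 1| with hs
  have hs0 : 0 ≤ s := by positivity
  have hw0 : |w 0| ≤ s := by linarith [abs_nonneg (w 1)]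
  have hw1 : |w 1| ≤ s := by linarith [abs_nonneg (w 0)]
  set W := w 0 ^ 2 + w 1 ^ 2 with hW
  have hW0 : 0 ≤ W := by positivity
  have hsW : s ^ 2 ≤ 2 * W := by
    rw [hs, hW, ← sq_abs (w 0), ← sq_abs (w 1)]
    nlinarith [sq_nonneg (|w 0| - |w 1|)]
  set N := K * ρ * q ^ 2 with hN
  set E := K * ρ ^ 2 * q ^ 2 with hE
  have hN0 : 0 ≤ N := by positivity
  have hE0 : 0 ≤ E := by positivity
  have mm : ∀ {x y X Y : ℝ}, |x| ≤ X → |y| ≤ Y → |x * y| ≤ X * Y := by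
    intro x y X Y h1 h2
    rw [abs_mul]
    exact mul_le_mul h1 h2 (abs_nonneg _) ((abs_nonneg _).trans h1)
  have aa : ∀ {x y X Y : ℝ}, |x| ≤ X → |y| ≤ Y → |x + y| ≤ X + Y := by
    intro x y X Y h1 h2
    exact (abs_add_le _ _).trans (add_le_add h1 h2)
  have nn : ∀ {x X : ℝ}, |x| ≤ X → |-x| ≤ X := by
    intro x X h1
    rwa [abs_neg]
  have hww : |w 0 * w 0 + w 1 * w 1| ≤ W := by
    rw [abs_of_nonneg (by nlinarith [mul_self_nonneg (w 0), mul_self_nonneg (w 1)])]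
    rw [hW]; linarith
  have t1 : |1 / 2 * (n 0 * U 0 + n 1 * U 1) * (w 0 * w 0 + w 1 * w 1)| ≤ N * M * W := by
    have := mm (mm (show |(1:ℝ) / 2| ≤ 1 / 2 by norm_num) (aa (mm (hn 0) (hU 0)) (mm (hn 1) (hU 1)))) hww
    linarith
  have t2 := mm (aa (mm (hU 0) hw0) (mm hw0 (hU 0))) (aa (mm (nn hw1) (hn 1)) (mm ha (he 0 1)))
  have t3 := mm (aa (mm (hU 1) hw0) (mm hw1 (hU 0))) (aa (mm (hw0) (hn 1)) (mm ha (he 1 1)))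
  have t4 := mm (aa (mm (hU 0) hw1) (mm hw0 (hU 1))) (aa (mm (hw1) (hn 0)) (nn (mm ha (he 0 0))))
  have t5 := mm (aa (mm (hU 1) hw1) (mm hw1 (hU 1))) (aa (mm (nn hw0) (hn 0)) (nn (mm ha (he 1 0))))
  have hconv : conv η n e w a U U g
      + η * (w 0 * w 0 * g 0 0 + w 0 * w 1 * g 0 1 + w 1 * w 0 * g 1 0 + w 1 * w 1 * g 1 1) ≤
      N * M * W + 8 * M * N * s ^ 2 + 8 * M ^ 2 * E * s := by
    unfold conv
    have := le_abs_self (1 / 2 * (n 0 * U 0 + n 1 * U 1) * (w 0 * w 0 + w 1 * w 1))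
    have := (le_abs_self _).trans t2
    have := (le_abs_self _).trans t3
    have := (le_abs_self _).trans t4
    have := (le_abs_self _).trans t5
    linarith
  have hM2 : M ≤ M ^ 2 := le_self_pow₀ hM (by norm_num)
  have hA : N * M * W + 8 * M * N * s ^ 2 ≤ 17 * (M ^ 2 * K * (ρ * (q ^ 2 * W))) := by
    have h1 : 8 * M * N * s ^ 2 ≤ 8 * M * N * (2 * W) :=
      mul_le_mul_of_nonneg_left hsW (by positivity)
    have h2 : M * (N * W) ≤ M ^ 2 * (N * W) := mul_le_mul_of_nonneg_right hM2 (by positivity)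
    have h3 : M ^ 2 * (N * W) = M ^ 2 * K * (ρ * (q ^ 2 * W)) := by rw [hN]; ring
    linarith
  have hB : 8 * M ^ 2 * E * s ≤ 8 * (M ^ 2 * K * (ρ * (q ^ 2 * W))) + 4 * (M ^ 2 * K * (ρ ^ 3 * q ^ 2)) := by
    have h1 : ρ ^ 2 * s ≤ ρ * W + ρ ^ 3 / 2 := by
      have : 0 ≤ ρ * (s - ρ) ^ 2 := by positivity
      have h9 : ρ * s ^ 2 ≤ ρ * (2 * W) := mul_le_mul_of_nonneg_left hsW hρ.le
      have h8 : ρ * (s - ρ) ^ 2 = ρ * s ^ 2 - 2 * (ρ ^ 2 * s) + ρ ^ 3 := by ring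
      linarith
    have h2 : (8 * M ^ 2 * K * q ^ 2) * (ρ ^ 2 * s) ≤ (8 * M ^ 2 * K * q ^ 2) * (ρ * W + ρ ^ 3 / 2) :=
      mul_le_mul_of_nonneg_left h1 (by positivity)
    have h3 : 8 * M ^ 2 * E * s = (8 * M ^ 2 * K * q ^ 2) * (ρ ^ 2 * s) := by rw [hE]; ring
    rw [h3]
    refine h2.trans (le_of_eq ?_)
    ring
  have hC : 2 * c * (K * q * (|a| * ρ ^ 2 + s * ρ)) ^ 2 ≤
      8 * c * K ^ 2 * M ^ 2 * (ρ * (q ^ 2 * W)) + 4 * (c * K ^ 2 * M ^ 2 * (ρ ^ 3 * q ^ 2)) := by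
    have h1 : (|a| * ρ ^ 2 + s * ρ) ^ 2 ≤ 2 * (M ^ 2 * ρ ^ 3) + 4 * (M ^ 2 * (ρ * W)) := by
      have e1 : (|a| * ρ ^ 2 + s * ρ) ^ 2 ≤ 2 * (|a| * ρ ^ 2) ^ 2 + 2 * (s * ρ) ^ 2 := by
        have h6 := sq_nonneg (|a| * ρ ^ 2 - s * ρ)
        rw [sub_sq] at h6
        rw [add_sq]
        linarith
      have e2 : (|a| * ρ ^ 2) ^ 2 ≤ M ^ 2 * ρ ^ 3 := by
        have : |a| ^ 2 ≤ M ^ 2 := pow_le_pow_left₀ (abs_nonneg _) ha 2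
        have h4 : ρ ^ 4 ≤ ρ ^ 3 := pow_le_pow_of_le_one hρ.le hρ1 (by norm_num)
        calc (|a| * ρ ^ 2) ^ 2 = |a| ^ 2 * ρ ^ 4 := by ring
          _ ≤ M ^ 2 * ρ ^ 3 := mul_le_mul this h4 (by positivity) (by positivity)
      have e3 : (s * ρ) ^ 2 ≤ 2 * (M ^ 2 * (ρ * W)) := by
        have h4 : ρ ^ 2 ≤ M ^ 2 * ρ := by
          have h6 : 1 ≤ M ^ 2 := one_le_pow₀ hM
          have h7 : ρ ^ 2 ≤ ρ := by
            have := pow_le_pow_of_le_one hρ.le hρ1 (show 1 ≤ 2 by norm_num)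
            rwa [pow_one] at this
          have h8 : 1 * ρ ≤ M ^ 2 * ρ := mul_le_mul_of_nonneg_right h6 hρ.le
          linarith
        calc (s * ρ) ^ 2 = s ^ 2 * ρ ^ 2 := by ring
          _ ≤ (2 * W) * (M ^ 2 * ρ) := mul_le_mul hsW h4 (by positivity) (by positivity)
          _ = _ := by ring
      linarith
    calc 2 * c * (K * q * (|a| * ρ ^ 2 + s * ρ)) ^ 2
        = (2 * c * K ^ 2 * q ^ 2) * (|a| * ρ ^ 2 + s * ρ) ^ 2 := by ring
      _ ≤ (2 * c * K ^ 2 * q ^ 2) * (2 * (M ^ 2 * ρ ^ 3) + 4 * (M ^ 2 * (ρ * W))) :=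
        mul_le_mul_of_nonneg_left h1 (by positivity)
      _ = _ := by ring
  have p1 : 0 ≤ M ^ 2 * K * (ρ * (q ^ 2 * W)) := by positivity
  have p2 : 0 ≤ M ^ 2 * K * (ρ ^ 3 * q ^ 2) := by positivity
  have p3 : 0 ≤ c * K ^ 2 * M ^ 2 * (ρ ^ 3 * q ^ 2) := by positivity
  have : (40 * M ^ 2 * K + 8 * c * K ^ 2 * M ^ 2) * (ρ * (q ^ 2 * W) + ρ ^ 3 * q ^ 2) =
    40 * (M ^ 2 * K * (ρ * (q ^ 2 * W))) + 40 * (M ^ 2 * K * (ρ ^ 3 * q ^ 2)) +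
    8 * c * K ^ 2 * M ^ 2 * (ρ * (q ^ 2 * W)) + 8 * (c * K ^ 2 * M ^ 2 * (ρ ^ 3 * q ^ 2)) := by ring
  linarith

lemma Sol.caccio {h : ℝ → ℝ} {c₁ c₂ μ M : ℝ} {U : Fin 2 → E2 → ℝ} {ψ : E2 → ℝ}
    (S : Sol h c₁ c₂ μ M U ψ) {K : ℝ} (hK : 0 ≤ K) :
    ∃ C : ℝ, 0 < C ∧ ∀ (R r : ℝ) (θ q : E2 → ℝ), 1 ≤ R → Cut K R r θ q → ∀ δ > 0,
      ∀ᶠ t in nhdsWithin (0 : ℝ) (Set.Ioi 0), Et h U θ t ≤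
        C / R * (∫ x, q x ^ 2 * VV U x) + C / R ^ 3 * (∫ x, q x ^ 2) + δ := by
  have hM0 : 0 < M := by linarith [S.hM]
  have hc := S.hH.hc₂
  set C0 := 40 * M ^ 2 * K + 8 * c₂ * K ^ 2 * M ^ 2 with hC0
  have hC00 : 0 ≤ C0 := by positivity
  refine ⟨4 * C0 + 1, by positivity, ?_⟩
  intro R r θ q hR C δ hδ
  have hR0 : 0 < R := by linarith
  choose W cW W0 Wt using fun k i => exists_quot (S.cU i) k
  choose A cA A0 At using fun k => exists_quot S.cψ k
  set η : E2 → ℝ := fun y => θ y ^ 2 with hη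
  have cη : ContDiff ℝ 2 η := C.cθ.pow 2
  have cη1 : ContDiff ℝ 1 η := cη.of_le (by norm_num)
  have cn : ∀ j, ContDiff ℝ 1 (dd j η) := fun j => dd_contDiff (n := 1) cη j
  have vη : VO r η := fun x hx => by simp [hη, C.vθ x hx]
  let Φ : Fin 2 → ℝ × E2 → ℝ := fun k p =>
    2 * c₂ * tau K R (q p.2) (fun i => W k i p) (A k p) ^ 2 +
        conv (η p.2) (fun j => dd j η p.2)
          (fun i j => dd i (dd j η) p.2) (fun i => W k i p) (A k p)
          (fun i => U i (p.2 + p.1 • ee k)) (fun i => U i p.2) (fun i j => dd j (U i) p.2)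
  have cΦ : ∀ k, Continuous (Φ k) := by
    intro k
    have k1 : ∀ i j, Continuous (dd i (dd j η)) := fun i j => dd_continuous (cn j) i
    have k2 : ∀ i j, Continuous (dd i (U j)) := fun i j => dd_continuous (S.cU j) i
    have k3 := C.cq
    have k4 := cη1.continuous
    have k5 := fun i => (cn i).continuous
    have k6 := cA k
    have k7 := cW k
    have k8 := fun i => (S.cU i).continuous
    simp only [Φ, tau, conv]
    fun_prop
  have vΦ : ∀ k t, VO r (fun x => Φ k (t, x)) := fun k t x hx => by
    simp [Φ, tau, conv, vη x hx, vη.dd _ x hx, (vη.dd _).dd _ x hx, C.vq x hx]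
  have IΦ : ∀ k t, Integrable (fun x => Φ k (t, x)) := fun k t =>
    (vΦ k t).integrable ((cΦ k).comp (by fun_prop))
  have lim := (tendsto_int (cΦ 0) (fun t _ => vΦ 0 t)).add (tendsto_int (cΦ 1) (fun t _ => vΦ 1 t))
  have hEt : ∀ t, t ≠ 0 → 1 / 2 * Et h U θ t ≤ (∫ x, Φ 0 (t, x)) + ∫ x, Φ 1 (t, x) := by
    intro t ht
    have h0 := S.caccio_t hK hR C 0 t
    have h1 := S.caccio_t hK hR C 1 t
    have e : ∀ k x, 2 * c₂ * tau K R (q x) (fun i => dq k t (U i) x) (dq k t ψ x) ^ 2 +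
        conv (θ x ^ 2) (fun j => dd j (fun y => θ y ^ 2) x)
          (fun i j => dd i (dd j (fun y => θ y ^ 2)) x) (fun i => dq k t (U i) x) (dq k t ψ x)
          (fun i => U i (x + t • ee k)) (fun i => U i x) (fun i j => dd j (U i) x) = Φ k (t, x) := by
      intro k x
      have w1 : ∀ i, dq k t (U i) x = W k i (t, x) := fun i => (Wt k i t ht x).symm
      have w2 : dq k t ψ x = A k (t, x) := (At k t ht x).symm
      simp only [w1, w2, Φ, hη]
    simp only [e] at h0 h1
    have IP : ∀ k, Integrable (fun x => θ x ^ 2 * Pd h U k t x) := fun k =>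
      VO.integrable (r := r) (fun x hx => by simp [C.vθ x hx])
        ((C.cθ.continuous.pow 2).mul (S.Pd_continuous k t))
    have : Et h U θ t = (∫ x, θ x ^ 2 * Pd h U 0 t x) + ∫ x, θ x ^ 2 * Pd h U 1 t x := by
      rw [← integral_add (IP 0) (IP 1)]
      simp only [Et, mul_add]
    rw [this]
    linarith
  have hb : (∫ x, Φ 0 (0, x)) + ∫ x, Φ 1 (0, x) ≤
      C0 / R * (∫ x, q x ^ 2 * VV U x) + 2 * C0 / R ^ 3 * (∫ x, q x ^ 2) := by
    rw [← integral_add (IΦ 0 0) (IΦ 1 0), ← integral_const_mul, ← integral_const_mul,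
      ← integral_add]
    rotate_left
    · exact (VO.integrable (r := r) (fun x hx => by simp [C.vq x hx])
        ((C.cq.pow 2).mul (VV_continuous S.cU))).const_mul _
    · exact (VO.integrable (r := r) (fun x hx => by simp [C.vq x hx]) (C.cq.pow 2)).const_mul _
    refine integral_mono ((IΦ 0 0).add (IΦ 1 0)) ?_ ?_
    · exact ((VO.integrable (r := r) (fun x hx => by simp [C.vq x hx])
        ((C.cq.pow 2).mul (VV_continuous S.cU))).const_mul _).add
       ((VO.integrable (r := r) (fun x hx => by simp [C.vq x hx]) (C.cq.pow 2)).const_mul _)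
    · intro x
      have hA : ∀ k, |A k (0, x)| ≤ M := by
        intro k
        rw [A0]
        fin_cases k
        · simp only [Fin.zero_eta, S.s0, abs_neg]; exact S.bd 1 x
        · simp only [Fin.mk_one, S.s1]; exact S.bd 0 x
      have main := fun k => alg_conv (c := c₂) (K := K) (ρ := 1 / R) (M := M) (q := q x) (η := η x)
        (a := A k (0, x)) (n := fun j => dd j η x) (w := fun i => W k i (0, x))
        (U := fun i => U i x) (e := fun i j => dd i (dd j η) x) (g := fun i j => dd j (U i) x)
        hc hK (by positivity) (by rw [div_le_one hR0]; exact hR) S.hM (hA k)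
        (fun i => (C.d1' i x).trans (le_of_eq (by ring)))
        (fun i j => (C.d2' i j x).trans (le_of_eq (by ring)))
        (fun i => S.bd i x)
      have m0 := main 0
      have m1 := main 1
      have hdU := S.hdiv x
      simp only [Φ, zero_smul, add_zero, W0, tau, VV] at m0 m1 ⊢
      have cub : η x * (dd 0 (U 0) x * dd 0 (U 0) x * dd 0 (U 0) x + dd 0 (U 0) x * dd 0 (U 1) x *
          dd 1 (U 0) x + dd 0 (U 1) x * dd 0 (U 0) x * dd 0 (U 1) x + dd 0 (U 1) x * dd 0 (U 1) x *
          dd 1 (U 1) x) + η x * (dd 1 (U 0) x * dd 1 (U 0) x * dd 0 (U 0) x + dd 1 (U 0) x *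
          dd 1 (U 1) x * dd 1 (U 0) x + dd 1 (U 1) x * dd 1 (U 0) x * dd 0 (U 1) x + dd 1 (U 1) x *
          dd 1 (U 1) x * dd 1 (U 1) x) = 0 := by
        have : dd 1 (U 1) x = - dd 0 (U 0) x := by linarith
        rw [this]; ring
      have r1 : ∀ a s : ℝ, a / R ^ 2 + s / R = a * (1 / R) ^ 2 + s * (1 / R) := fun a s => by ring
      simp only [r1]
      have fin : C0 / R * (q x ^ 2 * (dd 0 (U 0) x ^ 2 + dd 1 (U 0) x ^ 2 + dd 0 (U 1) x ^ 2 +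
          dd 1 (U 1) x ^ 2)) + 2 * C0 / R ^ 3 * q x ^ 2 = C0 * (1 / R * (q x ^ 2 * (dd 0 (U 0) x ^ 2 +
          dd 0 (U 1) x ^ 2)) + (1 / R) ^ 3 * q x ^ 2) + C0 * (1 / R * (q x ^ 2 * (dd 1 (U 0) x ^ 2 +
          dd 1 (U 1) x ^ 2)) + (1 / R) ^ 3 * q x ^ 2) := by ring
      rw [fin]
      linarith
  have hev := lim.eventually (gt_mem_nhds (show (∫ x, Φ 0 (0, x)) + ∫ x, Φ 1 (0, x) <
    (∫ x, Φ 0 (0, x)) + (∫ x, Φ 1 (0, x)) + δ / 2 by linarith))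
  filter_upwards [nhdsWithin_le_nhds hev, self_mem_nhdsWithin] with t ht htpos
  have := hEt t (ne_of_gt htpos)
  have y1 : 0 ≤ ∫ x, q x ^ 2 * VV U x :=
    integral_nonneg fun x => mul_nonneg (sq_nonneg _) (VV_nonneg U x)
  have y2 : 0 ≤ ∫ x, q x ^ 2 := integral_nonneg fun x => sq_nonneg _
  have z1 : 2 * (C0 / R * (∫ x, q x ^ 2 * VV U x)) ≤ (4 * C0 + 1) / R * (∫ x, q x ^ 2 * VV U x) := by
    have : 2 * (C0 / R) ≤ (4 * C0 + 1) / R := by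
      rw [← mul_div_assoc]; gcongr; linarith
    calc _ = 2 * (C0 / R) * (∫ x, q x ^ 2 * VV U x) := by ring
      _ ≤ _ := mul_le_mul_of_nonneg_right this y1
  have z2 : 2 * (2 * C0 / R ^ 3 * (∫ x, q x ^ 2)) ≤ (4 * C0 + 1) / R ^ 3 * (∫ x, q x ^ 2) := by
    have : 2 * (2 * C0 / R ^ 3) ≤ (4 * C0 + 1) / R ^ 3 := by
      rw [← mul_div_assoc]; gcongr; linarith
    calc _ = 2 * (2 * C0 / R ^ 3) * (∫ x, q x ^ 2) := by ring
      _ ≤ _ := mul_le_mul_of_nonneg_right this y2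
  linarith

/-! ### Second inequality: control of the full gradient -/

lemma int_shift_sub {f g : E2 → ℝ} {r : ℝ} (hf : Continuous f) (hg : Continuous g) (hv : VO r f)
    (k : Fin 2) (t : ℝ) :
    ∫ x, f x * ((g (x + (-t) • ee k) - g x) / (-t)) = - ∫ x, dq k t f x * g x := by
  have I1 : Integrable (fun x => f x * g (x + (-t) • ee k)) :=
    VO.integrable (r := r) (fun x hx => by simp [hv x hx]) (by fun_prop)
  have I2 : Integrable (fun x => f x * g x) :=
    VO.integrable (r := r) (fun x hx => by simp [hv x hx]) (by fun_prop)
  have hsh : VO (r + ‖t • ee k‖) (fun x => f (x + t • ee k)) := by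
    intro x hx
    refine hv _ ?_
    have := norm_sub_le (x + t • ee k) (t • ee k)
    simp only [add_sub_cancel_right] at this
    linarith
  have I3 : Integrable (fun x => f (x + t • ee k) * g x) :=
    VO.integrable (r := r + ‖t • ee k‖) (fun x hx => by simp [hsh x hx]) (by fun_prop)
  have e1 : ∫ x, f x * g (x + (-t) • ee k) = ∫ x, f (x + t • ee k) * g x := by
    rw [← integral_add_right_eq_self _ (t • ee k)]
    congr 1
    funext x
    rw [show x + t • ee k + (-t) • ee k = x by simp]
  have e2 : ∀ x, f x * ((g (x + (-t) • ee k) - g x) / (-t)) =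
      t⁻¹ * (f x * g x - f x * g (x + (-t) • ee k)) := fun x => by
    rw [div_neg]; ring
  have e3 : ∀ x, dq k t f x * g x = t⁻¹ * (f (x + t • ee k) * g x - f x * g x) := fun x => by
    unfold dq; ring
  simp only [e2, e3]
  rw [integral_const_mul, integral_const_mul, integral_sub I2 I1, integral_sub I3 I2, e1]
  ring

lemma frob_entry (A : Matrix (Fin 2) (Fin 2) ℝ) (i j : Fin 2) : A i j ^ 2 ≤ frob A A := by
  have h1 := abs_le_fnorm A i j
  have := pow_le_pow_left₀ (abs_nonneg _) h1 2
  rwa [sq_abs, fnorm_sq] at this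

lemma young_w {θ ρ D B c μ lam : ℝ} (hc : 0 < c) (hl : 0 < lam) (hB : 0 < B) :
    θ * ρ * |D| ≤ lam * (θ ^ 2 * (c * B ^ (-μ) * D ^ 2)) + 1 / (4 * lam * c) * (ρ ^ 2 * B ^ μ) := by
  rw [Real.rpow_neg hB.le]
  have hb : 0 < B ^ μ := Real.rpow_pos_of_pos hB μ
  set b := B ^ μ
  rw [← sq_abs D]
  have : lam * (θ ^ 2 * (c * b⁻¹ * |D| ^ 2)) + 1 / (4 * lam * c) * (ρ ^ 2 * b) - θ * ρ * |D| =
      (2 * lam * c * (θ * |D|) - b * ρ) ^ 2 / (4 * lam * c * b) := by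
    field_simp
    ring
  have h2 : 0 ≤ (2 * lam * c * (θ * |D|) - b * ρ) ^ 2 / (4 * lam * c * b) := by positivity
  linarith

structure Cut2 (r : ℝ) (ζ θ ρ rr : E2 → ℝ) : Prop where
  cζ : ContDiff ℝ 1 ζ
  cθ : Continuous θ
  cρ : Continuous ρ
  cr : Continuous rr
  θ0 : ∀ x, 0 ≤ θ x
  ρ0 : ∀ x, 0 ≤ ρ x
  vθ : VO r θ
  vρ : VO r ρ
  vr : VO r rr
  eq : ∀ x, ζ x = θ x * ρ x
  bd : ∀ k x, |dd k ζ x| ≤ rr x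

lemma Cut2.vζ {r : ℝ} {ζ θ ρ rr : E2 → ℝ} (C : Cut2 r ζ θ ρ rr) : VO r ζ := fun x hx => by
  rw [C.eq, C.vθ x hx, zero_mul]

lemma fnorm_eps_continuous {U : Fin 2 → E2 → ℝ} (cU : ∀ i, ContDiff ℝ 1 (U i)) :
    Continuous (fun x => fnorm (eps U x)) := fnorm_continuous.comp (eps_continuous cU)

lemma Sol.partB {h : ℝ → ℝ} {c₁ c₂ μ M : ℝ} {U : Fin 2 → E2 → ℝ} {ψ : E2 → ℝ}
    (S : Sol h c₁ c₂ μ M U ψ) {r : ℝ} {ζ θ ρ rr : E2 → ℝ} (C : Cut2 r ζ θ ρ rr) (i k : Fin 2)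
    {lam δ : ℝ} (hl : 0 < lam) (hδ : 0 < δ) :
    ∀ᶠ t in nhdsWithin (0 : ℝ) (Set.Ioi 0),
      (∫ x, ζ x * eps U x i k * dd k (U i) x) + (∫ x, U i x * eps U x i k * dd k ζ x) ≤
      M * (lam * (∫ x, θ x ^ 2 * Pd h U k t x) +
        1 / (4 * lam * c₁) * ∫ x, ρ x ^ 2 * (1 + 2 * fnorm (eps U x)) ^ μ) + δ := by
  obtain ⟨W, cW, W0, Wt⟩ := exists_quot (S.cU i) k
  obtain ⟨Z, cZ, Z0, Zt⟩ := exists_quot C.cζ k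
  have hM0 : 0 < M := by linarith [S.hM]
  have hc := S.hH.hc₁
  have hμ := S.hH.hμ₁
  have ce : Continuous (fun x => eps U x i k) := by
    have := eps_continuous S.cU
    fun_prop
  have cfe := fnorm_eps_continuous S.cU
  have cUi := (S.cU i).continuous
  have cζ := C.cζ.continuous
  have cθ := C.cθ
  have cρ := C.cρ
  have vζ := C.vζ
  let G1 : ℝ × E2 → ℝ := fun p => ζ p.2 * eps U p.2 i k * W (-p.1, p.2)
  let G2 : ℝ × E2 → ℝ := fun p => U i p.2 * eps U (p.2 + p.1 • ee k) i k * Z p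
  let G3 : ℝ × E2 → ℝ := fun p => ρ p.2 ^ 2 *
    (1 + (fnorm (eps U (p.2 + p.1 • ee k)) + fnorm (eps U p.2))) ^ μ
  have cG1 : Continuous G1 := by fun_prop
  have cG2 : Continuous G2 := by
    have : Continuous (fun p : ℝ × E2 => eps U (p.2 + p.1 • ee k) i k) :=
      ce.comp (g := fun x => eps U x i k) (by fun_prop)
    fun_prop
  have cG3 : Continuous G3 := by
    refine Continuous.mul (by fun_prop) (Continuous.rpow_const ?_ ?_)
    · have : Continuous (fun p : ℝ × E2 => fnorm (eps U (p.2 + p.1 • ee k))) :=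
        cfe.comp (g := fun x => fnorm (eps U x)) (by fun_prop)
      have : Continuous (fun p : ℝ × E2 => fnorm (eps U p.2)) :=
        cfe.comp (g := fun x => fnorm (eps U x)) (by fun_prop)
      fun_prop
    · intro p
      right
      linarith
  have vζ1 : VO (r + 1) ζ := fun x hx => vζ x (by linarith)
  have hn : ∀ t : ℝ, |t| ≤ 1 → ‖t • ee k‖ ≤ 1 := fun t ht => by
    rw [norm_smul, Real.norm_eq_abs]
    simpa [ee] using ht
  have vsh : ∀ t : ℝ, |t| ≤ 1 → VO (r + 1) (fun x => ζ (x + t • ee k)) := by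
    intro t ht x hx
    refine vζ _ ?_
    have := norm_sub_le (x + t • ee k) (t • ee k)
    simp only [add_sub_cancel_right] at this
    linarith [hn t ht]
  have vZ : ∀ t : ℝ, |t| ≤ 1 → VO (r + 1) (fun x => Z (t, x)) := by
    intro t ht x hx
    by_cases h0 : t = 0
    · simp only [h0, Z0]
      exact vζ1.dd k x hx
    · simp only [Zt t h0, vsh t ht x hx, vζ1 x hx]
      simp
  have v1 : ∀ t : ℝ, |t| ≤ 1 → VO (r + 1) (fun x => G1 (t, x)) := fun t ht x hx => by
    simp [G1, vζ1 x hx]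
  have v2 : ∀ t : ℝ, |t| ≤ 1 → VO (r + 1) (fun x => G2 (t, x)) := fun t ht x hx => by
    have := vZ t ht x hx
    simp only [G2]
    simp only at this
    rw [this, mul_zero]
  have v3 : ∀ t : ℝ, |t| ≤ 1 → VO (r + 1) (fun x => G3 (t, x)) := fun t ht x hx => by
    simp [G3, C.vρ x (by linarith)]
  set κ := M * (1 / (4 * lam * c₁)) with hκ
  have lim := ((tendsto_int cG1 v1).add (tendsto_int cG2 v2)).sub
    ((tendsto_int cG3 v3).const_mul κ)
  have e1 : ∫ x, G1 (0, x) = ∫ x, ζ x * eps U x i k * dd k (U i) x := by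
    simp only [G1, neg_zero, W0]
  have e2 : ∫ x, G2 (0, x) = ∫ x, U i x * eps U x i k * dd k ζ x := by
    simp only [G2, zero_smul, add_zero, Z0]
  have e3 : ∫ x, G3 (0, x) = ∫ x, ρ x ^ 2 * (1 + 2 * fnorm (eps U x)) ^ μ := by
    simp only [G3, zero_smul, add_zero, two_mul]
  rw [e1, e2, e3] at lim
  have hev := lim.eventually (lt_mem_nhds (sub_lt_self _ hδ))
  have hsmall : ∀ᶠ t : ℝ in nhdsWithin (0 : ℝ) (Set.Ioi 0), t < 1 :=
    nhdsWithin_le_nhds (gt_mem_nhds one_pos)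
  filter_upwards [nhdsWithin_le_nhds hev, self_mem_nhdsWithin, hsmall] with t ht htpos ht1
  have htp : 0 < t := htpos
  have ht0 : t ≠ 0 := ne_of_gt htp
  have hta : |t| ≤ 1 := by rw [abs_of_pos htp]; exact ht1.le
  have IG1 : Integrable (fun x => G1 (t, x)) := (v1 t hta).integrable (cG1.comp (by fun_prop))
  have IG2 : Integrable (fun x => G2 (t, x)) := (v2 t hta).integrable (cG2.comp (by fun_prop))
  have IG3 : Integrable (fun x => G3 (t, x)) := (v3 t hta).integrable (cG3.comp (by fun_prop))
  have IP : Integrable (fun x => θ x ^ 2 * Pd h U k t x) :=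
      VO.integrable (r := r) (fun x hx => by simp [C.vθ x hx])
        ((C.cθ.pow 2).mul (S.Pd_continuous k t))
  -- shift identity
  have hs1 := int_shift_sub (f := fun x => ζ x * eps U x i k) (g := U i) (r := r) (by fun_prop) cUi
    (fun x hx => by simp [vζ x hx]) k t
  have hG1 : ∫ x, G1 (t, x) = - ∫ x, dq k t (fun x => ζ x * eps U x i k) x * U i x := by
    rw [← hs1]
    congr 1
    funext x
    simp only [G1]
    rw [Wt (-t) (neg_ne_zero.2 ht0)]
  have cdε : Continuous (fun x => dqm k t (eps U) x i k) := by
    have := dqm_continuous (eps_continuous S.cU) k t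
    fun_prop
  have ID : Integrable (fun x => - (U i x * ζ x * dqm k t (eps U) x i k)) :=
    (VO.integrable (r := r) (fun x hx => by simp [vζ x hx]) (by fun_prop))
  have hsum : (∫ x, G1 (t, x)) + ∫ x, G2 (t, x) = ∫ x, - (U i x * ζ x * dqm k t (eps U) x i k) := by
    have cq : Continuous (fun x => dq k t (fun x => ζ x * eps U x i k) x * U i x) :=
      (dq_continuous (by fun_prop) k t).mul cUi
    have vq : VO (r + 1) (fun x => dq k t (fun x => ζ x * eps U x i k) x * U i x) := by
      intro x hx
      have a1 := vsh t hta x hx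
      simp only at a1
      simp only [dq, a1, vζ1 x hx]
      simp
    have Iq : Integrable (fun x => -(dq k t (fun x => ζ x * eps U x i k) x * U i x)) :=
      (vq.integrable cq).neg
    rw [hG1, ← integral_neg, ← integral_add Iq IG2]
    congr 1
    funext x
    simp only [G2, dq, dqm_apply, Zt t ht0]
    ring
  have hle : ∫ x, - (U i x * ζ x * dqm k t (eps U) x i k) ≤
      ∫ x, (M * lam * (θ x ^ 2 * Pd h U k t x) + κ * G3 (t, x)) := by
    refine integral_mono ID ((IP.const_mul _).add (IG3.const_mul _)) fun x => ?_
    have hB : 0 < 1 + (fnorm (eps U (x + t • ee k)) + fnorm (eps U x)) := by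
      have := fnorm_nonneg (eps U (x + t • ee k))
      have := fnorm_nonneg (eps U x)
      linarith
    have hy := young_w (θ := θ x) (ρ := ρ x) (D := dqm k t (eps U) x i k) (μ := μ) hc hl hB
    have hp := S.Pd_mono k t x
    have hen := frob_entry (dqm k t (eps U) x) i k
    have hw : 0 < c₁ * (1 + (fnorm (eps U (x + t • ee k)) + fnorm (eps U x))) ^ (-μ) :=
      mul_pos hc (Real.rpow_pos_of_pos hB _)
    have hp2 := (mul_le_mul_of_nonneg_left hen hw.le).trans hp
    have hp3 := mul_le_mul_of_nonneg_left hp2 (sq_nonneg (θ x))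
    have hp4 := mul_le_mul_of_nonneg_left hp3 hl.le
    have hUb := S.bd i x
    have hz0 : 0 ≤ ζ x := by rw [C.eq]; exact mul_nonneg (C.θ0 x) (C.ρ0 x)
    have a1 : - (U i x * ζ x * dqm k t (eps U) x i k) ≤ M * (θ x * ρ x * |dqm k t (eps U) x i k|) := by
      rw [← C.eq]
      calc - (U i x * ζ x * dqm k t (eps U) x i k) ≤ |U i x * ζ x * dqm k t (eps U) x i k| :=
            neg_le_abs _
        _ = |U i x| * (ζ x * |dqm k t (eps U) x i k|) := by
          rw [abs_mul, abs_mul, abs_of_nonneg hz0]; ring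
        _ ≤ _ := mul_le_mul_of_nonneg_right hUb (by positivity)
    have a2 := mul_le_mul_of_nonneg_left (hy.trans (add_le_add_left hp4 _)) hM0.le
    refine a1.trans (a2.trans (le_of_eq ?_))
    simp only [G3, hκ]
    ring
  rw [integral_add (IP.const_mul _) (IG3.const_mul _), integral_const_mul, integral_const_mul] at hle
  have hfin : M * (lam * (∫ x, θ x ^ 2 * Pd h U k t x) +
        1 / (4 * lam * c₁) * ∫ x, ρ x ^ 2 * (1 + 2 * fnorm (eps U x)) ^ μ) =
      M * lam * (∫ x, θ x ^ 2 * Pd h U k t x) +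
        κ * ∫ x, ρ x ^ 2 * (1 + 2 * fnorm (eps U x)) ^ μ := by rw [hκ]; ring
  rw [hfin]
  linarith

lemma Sol.nullLag {h : ℝ → ℝ} {c₁ c₂ μ M : ℝ} {U : Fin 2 → E2 → ℝ} {ψ : E2 → ℝ}
    (S : Sol h c₁ c₂ μ M U ψ) {r : ℝ} {ζ : E2 → ℝ} (cζ : ContDiff ℝ 1 ζ) (vζ : VO r ζ) (k : Fin 2) :
    ∫ x, (ζ x * (dd k (U 0) x * dd 0 (U k) x + dd k (U 1) x * dd 1 (U k) x) +
      U k x * (dd 0 ζ x * dd k (U 0) x + dd 1 ζ x * dd k (U 1) x)) = 0 := by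
  choose W cW W0 Wt using fun i => exists_quot (S.cU i) k
  let G : ℝ × E2 → ℝ := fun p => ζ p.2 * (W 0 p * dd 0 (U k) p.2 + W 1 p * dd 1 (U k) p.2) +
      U k p.2 * (dd 0 ζ p.2 * W 0 p + dd 1 ζ p.2 * W 1 p)
  have cG : Continuous G := by
    have k1 := fun i => dd_continuous (S.cU k) i
    have k2 := fun i => dd_continuous cζ i
    have k3 := cζ.continuous
    have k4 := (S.cU k).continuous
    fun_prop
  have vG : ∀ t : ℝ, |t| ≤ 1 → VO r (fun x => G (t, x)) := fun t _ x hx => by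
    simp [G, vζ x hx, vζ.dd _ x hx]
  have lim := tendsto_int cG vG
  have hz : ∀ t : ℝ, t ≠ 0 → ∫ x, G (t, x) = 0 := by
    intro t ht
    set w : Fin 2 → E2 → ℝ := fun i => dq k t (U i) with hw
    have cw : ∀ i, ContDiff ℝ 1 (w i) := fun i => dq_contDiff (S.cU i) k t
    have cw0 := cw 0
    have cw1 := cw 1
    have cUk := S.cU k
    have divw : ∀ x, dd 0 (w 0) x + dd 1 (w 1) x = 0 := fun x => by
      rw [dd_dq (S.cU 0), dd_dq (S.cU 1)]
      simp only [dq]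
      rw [← add_div]
      have h1 := S.hdiv x
      have h2 := S.hdiv (x + t • ee k)
      rw [show dd 0 (U 0) (x + t • ee k) - dd 0 (U 0) x + (dd 1 (U 1) (x + t • ee k) - dd 1 (U 1) x)
        = 0 by linarith, zero_div]
    let F : Fin 2 → E2 → ℝ := fun i y => ζ y * (w i y * U k y)
    have cF : ∀ i, ContDiff ℝ 1 (F i) := fun i => cζ.mul ((cw i).mul cUk)
    have vF : ∀ i, VO r (F i) := fun i x hx => by simp [F, vζ x hx]
    have DF : ∀ i x, dd i (F i) x = _ := fun i x =>
      ((HD.of cζ i x).mul ((HD.of (cw i) i x).mul (HD.of cUk i x))).2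
    have e : ∀ x, G (t, x) = dd 0 (F 0) x + dd 1 (F 1) x := by
      intro x
      rw [DF, DF]
      simp only [G, Wt _ t ht]
      have : ∀ i, (U i (x + t • ee k) - U i x) / t = w i x := fun i => rfl
      simp only [this]
      linear_combination (- ζ x * U k x) * divw x
    simp only [e]
    rw [integral_add ((vF 0).dd 0 |>.integrable (dd_continuous (cF 0) 0))
      ((vF 1).dd 1 |>.integrable (dd_continuous (cF 1) 1)), int_dd (cF 0) (vF 0),
      int_dd (cF 1) (vF 1), add_zero]
  have l1 : Tendsto (fun t => ∫ x, G (t, x)) (nhdsWithin (0 : ℝ) (Set.Ioi 0)) (nhds 0) := by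
    refine tendsto_const_nhds.congr' ?_
    filter_upwards [self_mem_nhdsWithin] with t ht
    exact (hz t (ne_of_gt ht)).symm
  have := tendsto_nhds_unique (lim.mono_left nhdsWithin_le_nhds) l1
  simpa only [G, W0] using this

/-- Sum of absolute values of the gradient entries. -/
def AA (U : Fin 2 → E2 → ℝ) (x : E2) : ℝ :=
  |dd 0 (U 0) x| + |dd 1 (U 0) x| + |dd 0 (U 1) x| + |dd 1 (U 1) x|

lemma AA_continuous {U : Fin 2 → E2 → ℝ} (cU : ∀ i, ContDiff ℝ 1 (U i)) : Continuous (AA U) := by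
  have : ∀ i j, Continuous (dd i (U j)) := fun i j => dd_continuous (cU j) i
  unfold AA
  fun_prop

lemma AA_nonneg (U : Fin 2 → E2 → ℝ) (x : E2) : 0 ≤ AA U x := by unfold AA; positivity

lemma AA_sq (U : Fin 2 → E2 → ℝ) (x : E2) : AA U x ^ 2 ≤ 4 * VV U x := by
  unfold AA VV
  rw [← sq_abs (dd 0 (U 0) x), ← sq_abs (dd 1 (U 0) x), ← sq_abs (dd 0 (U 1) x),
    ← sq_abs (dd 1 (U 1) x)]
  generalize |dd 0 (U 0) x| = a
  generalize |dd 1 (U 0) x| = b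
  generalize |dd 0 (U 1) x| = c
  generalize |dd 1 (U 1) x| = d
  linarith [sq_nonneg (a - b), sq_nonneg (a - c), sq_nonneg (a - d), sq_nonneg (b - c),
    sq_nonneg (b - d), sq_nonneg (c - d)]

lemma Sol.second {h : ℝ → ℝ} {c₁ c₂ μ M : ℝ} {U : Fin 2 → E2 → ℝ} {ψ : E2 → ℝ}
    (S : Sol h c₁ c₂ μ M U ψ) {r : ℝ} {ζ θ ρ rr : E2 → ℝ} (C : Cut2 r ζ θ ρ rr)
    {lam δ : ℝ} (hl : 0 < lam) (hδ : 0 < δ) :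
    ∀ᶠ t in nhdsWithin (0 : ℝ) (Set.Ioi 0),
      ∫ x, ζ x * VV U x ≤ 4 * M * lam * Et h U θ t +
        2 * M / (lam * c₁) * (∫ x, ρ x ^ 2 * (1 + 2 * fnorm (eps U x)) ^ μ) +
        3 * M * (∫ x, rr x * AA U x) + δ := by
  have hM0 : 0 < M := by linarith [S.hM]
  have vζ := C.vζ
  have cg : ∀ i j, Continuous (dd i (U j)) := fun i j => dd_continuous (S.cU j) i
  have cz : ∀ i, Continuous (dd i ζ) := fun i => dd_continuous C.cζ i
  have cU := fun i => (S.cU i).continuous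
  have cζ := C.cζ.continuous
  have ce : ∀ i j, Continuous (fun x => eps U x i j) := fun i j => by
    have := eps_continuous S.cU
    fun_prop
  have I1 : ∀ i k, Integrable (fun x => ζ x * eps U x i k * dd k (U i) x) := fun i k =>
    VO.integrable (r := r) (fun x hx => by simp [vζ x hx]) (by fun_prop)
  have I2 : ∀ i k, Integrable (fun x => U i x * eps U x i k * dd k ζ x) := fun i k =>
    VO.integrable (r := r) (fun x hx => by simp [vζ.dd k x hx]) (by fun_prop)
  have I3 : ∀ k, Integrable (fun x => (ζ x * (dd k (U 0) x * dd 0 (U k) x + dd k (U 1) x *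
      dd 1 (U k) x) + U k x * (dd 0 ζ x * dd k (U 0) x + dd 1 ζ x * dd k (U 1) x))) := fun k =>
    VO.integrable (r := r) (fun x hx => by simp [vζ x hx, vζ.dd _ x hx]) (by fun_prop)
  have I4 : Integrable (fun x => 3 * M * (rr x * AA U x)) :=
    VO.integrable (r := r) (fun x hx => by simp [C.vr x hx])
      (continuous_const.mul (C.cr.mul (AA_continuous S.cU)))
  have IV : Integrable (fun x => ζ x * VV U x) :=
    VO.integrable (r := r) (fun x hx => by simp [vζ x hx]) (cζ.mul (VV_continuous S.cU))
  have J : ∀ i k, Integrable (fun x => ζ x * eps U x i k * dd k (U i) x +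
      U i x * eps U x i k * dd k ζ x) := fun i k => (I1 i k).add (I2 i k)
  let B : Fin 2 → Fin 2 → E2 → ℝ := fun i k x => ζ x * eps U x i k * dd k (U i) x +
      U i x * eps U x i k * dd k ζ x
  have JB : ∀ i k, Integrable (B i k) := J
  have key : ∫ x, ζ x * VV U x ≤ 2 * ((∫ x, B 0 0 x) + (∫ x, B 0 1 x) + (∫ x, B 1 0 x) +
      (∫ x, B 1 1 x)) + 3 * M * ∫ x, rr x * AA U x := by
    have n0 := S.nullLag C.cζ vζ 0
    have n1 := S.nullLag C.cζ vζ 1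
    have : ∫ x, (ζ x * VV U x) ≤ ∫ x, (((2 * B 0 0 x + 2 * B 0 1 x + 2 * B 1 0 x + 2 * B 1 1 x) -
        (ζ x * (dd 0 (U 0) x * dd 0 (U 0) x + dd 0 (U 1) x *
      dd 1 (U 0) x) + U 0 x * (dd 0 ζ x * dd 0 (U 0) x + dd 1 ζ x * dd 0 (U 1) x)) -
      (ζ x * (dd 1 (U 0) x * dd 0 (U 1) x + dd 1 (U 1) x *
      dd 1 (U 1) x) + U 1 x * (dd 0 ζ x * dd 1 (U 0) x + dd 1 ζ x * dd 1 (U 1) x)))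
      + 3 * M * (rr x * AA U x)) := by
      refine integral_mono IV (((((((JB 0 0).const_mul 2).add ((JB 0 1).const_mul 2)).add
        ((JB 1 0).const_mul 2)).add ((JB 1 1).const_mul 2)).sub (I3 0)).sub (I3 1) |>.add I4)
        fun x => ?_
      have hb : ∀ i k j l, |U i x * dd k ζ x * dd j (U l) x| ≤ M * (rr x * |dd j (U l) x|) := by
        intro i k j l
        rw [abs_mul, abs_mul, ← mul_assoc]
        refine mul_le_mul_of_nonneg_right ?_ (abs_nonneg _)
        exact mul_le_mul (S.bd i x) (C.bd k x) (abs_nonneg _) hM0.le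
      simp only [B, eps, VV, AA]
      have b1 := abs_le.1 (hb 0 0 0 0)
      have b2 := abs_le.1 (hb 0 1 1 0)
      have b3 := abs_le.1 (hb 0 1 0 1)
      have b4 := abs_le.1 (hb 1 0 1 0)
      have b5 := abs_le.1 (hb 1 0 0 1)
      have b6 := abs_le.1 (hb 1 1 1 1)
      have p : ∀ j l, 0 ≤ M * (rr x * |dd j (U l) x|) := fun j l => (abs_nonneg _).trans (hb 0 0 j l)
      have p1 := p 0 0
      have p2 := p 0 1
      have p3 := p 1 0
      have p4 := p 1 1
      ring_nf at b1 b2 b3 b4 b5 b6 p1 p2 p3 p4 ⊢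
      linarith
    have eq : ∫ x, (((2 * B 0 0 x + 2 * B 0 1 x + 2 * B 1 0 x + 2 * B 1 1 x) -
        (ζ x * (dd 0 (U 0) x * dd 0 (U 0) x + dd 0 (U 1) x *
      dd 1 (U 0) x) + U 0 x * (dd 0 ζ x * dd 0 (U 0) x + dd 1 ζ x * dd 0 (U 1) x)) -
      (ζ x * (dd 1 (U 0) x * dd 0 (U 1) x + dd 1 (U 1) x *
      dd 1 (U 1) x) + U 1 x * (dd 0 ζ x * dd 1 (U 0) x + dd 1 ζ x * dd 1 (U 1) x)))
      + 3 * M * (rr x * AA U x)) = 2 * ((∫ x, B 0 0 x) + (∫ x, B 0 1 x) + (∫ x, B 1 0 x) +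
      (∫ x, B 1 1 x)) + 3 * M * ∫ x, rr x * AA U x := by
      have j1 : Integrable (fun x => 2 * B 0 0 x) := (JB 0 0).const_mul 2
      have j2 : Integrable (fun x => 2 * B 0 1 x) := (JB 0 1).const_mul 2
      have j3 : Integrable (fun x => 2 * B 1 0 x) := (JB 1 0).const_mul 2
      have j4 : Integrable (fun x => 2 * B 1 1 x) := (JB 1 1).const_mul 2
      have j5 : Integrable (fun x => 2 * B 0 0 x + 2 * B 0 1 x) := j1.add j2
      have j6 : Integrable (fun x => 2 * B 0 0 x + 2 * B 0 1 x + 2 * B 1 0 x) := j5.add j3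
      have j7 : Integrable (fun x => 2 * B 0 0 x + 2 * B 0 1 x + 2 * B 1 0 x + 2 * B 1 1 x) :=
        j6.add j4
      have j8 := j7.sub (I3 0)
      have j9 := j8.sub (I3 1)
      simp only [Pi.sub_def] at j8 j9
      rw [integral_add j9 I4, integral_sub j8 (I3 1), integral_sub j7 (I3 0), n0, n1,
        integral_add j6 j4, integral_add j5 j3, integral_add j1 j2]
      simp only [integral_const_mul]
      ring
    rw [← eq]
    exact this
  have q00 := S.partB C 0 0 hl (show 0 < δ / 8 by positivity)
  have q01 := S.partB C 0 1 hl (show 0 < δ / 8 by positivity)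
  have q10 := S.partB C 1 0 hl (show 0 < δ / 8 by positivity)
  have q11 := S.partB C 1 1 hl (show 0 < δ / 8 by positivity)
  filter_upwards [q00, q01, q10, q11] with t h00 h01 h10 h11
  have IP : ∀ k, Integrable (fun x => θ x ^ 2 * Pd h U k t x) := fun k =>
      VO.integrable (r := r) (fun x hx => by simp [C.vθ x hx])
        ((C.cθ.pow 2).mul (S.Pd_continuous k t))
  have hE : Et h U θ t = (∫ x, θ x ^ 2 * Pd h U 0 t x) + ∫ x, θ x ^ 2 * Pd h U 1 t x := by
      rw [← integral_add (IP 0) (IP 1)]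
      simp only [Et, mul_add]
  have eB : ∀ i k, ∫ x, B i k x = (∫ x, ζ x * eps U x i k * dd k (U i) x) +
    (∫ x, U i x * eps U x i k * dd k ζ x) := fun i k => integral_add (I1 i k) (I2 i k)
  rw [eB, eB, eB, eB] at key
  rw [hE]
  have hc := S.hH.hc₁
  have hcoef : 2 * M / (lam * c₁) = 8 * (M * (1 / (4 * lam * c₁))) := by field_simp; norm_num
  rw [hcoef]
  linarith

/-! ### Cutoff functions -/

def bmp : ContDiffBump (0 : E2) := ⟨1, 2, one_pos, by norm_num⟩

def chi (R : ℝ) (x : E2) : ℝ := bmp (R⁻¹ • x)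

lemma chi_contDiff (R : ℝ) (n : ℕ) : ContDiff ℝ n (chi R) :=
  (bmp.contDiff (n := n)).comp (contDiff_const_smul R⁻¹)

lemma chi_continuous (R : ℝ) : Continuous (chi R) := (chi_contDiff R 0).continuous

lemma chi_nonneg (R : ℝ) (x : E2) : 0 ≤ chi R x := bmp.nonneg

lemma chi_le_one (R : ℝ) (x : E2) : chi R x ≤ 1 := bmp.le_one

lemma chi_one {R : ℝ} (hR : 0 < R) {x : E2} (hx : ‖x‖ ≤ R) : chi R x = 1 := by
  refine bmp.one_of_mem_closedBall ?_
  rw [mem_closedBall_zero_iff, norm_smul, norm_inv, Real.norm_of_nonneg hR.le]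
  show R⁻¹ * ‖x‖ ≤ 1
  rw [inv_mul_le_iff₀ hR]
  linarith

lemma chi_zero {R : ℝ} (hR : 0 < R) {x : E2} (hx : 2 * R ≤ ‖x‖) : chi R x = 0 := by
  refine bmp.zero_of_le_dist ?_
  rw [dist_zero_right, norm_smul, norm_inv, Real.norm_of_nonneg hR.le]
  show 2 ≤ R⁻¹ * ‖x‖
  rw [le_inv_mul_iff₀ hR]
  linarith

lemma chi_VO {R r : ℝ} (hR : 0 < R) (hr : 2 * R ≤ r) : VO r (chi R) := fun x hx =>
  chi_zero hR (by linarith)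

lemma dd_congr {f g : E2 → ℝ} {x : E2} (hfg : f =ᶠ[nhds x] g) (k : Fin 2) : dd k f x = dd k g x := by
  unfold dd
  rw [hfg.fderiv_eq]

lemma dd_const (k : Fin 2) (c : ℝ) (x : E2) : dd k (fun _ => c) x = 0 := by simp [dd]

lemma chi_dd_zero {R : ℝ} (hR : 0 < R) (k : Fin 2) {x : E2} (hx : ¬ (R ≤ ‖x‖ ∧ ‖x‖ ≤ 2 * R)) :
    dd k (chi R) x = 0 := by
  rcases lt_or_ge ‖x‖ R with h1 | h1
  · have : chi R =ᶠ[nhds x] fun _ => 1 := by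
      filter_upwards [(isOpen_lt continuous_norm continuous_const).mem_nhds h1] with y hy
      exact chi_one hR (le_of_lt hy)
    rw [dd_congr this, dd_const]
  · exact (chi_VO hR le_rfl).dd k x (by
      by_contra h2
      exact hx ⟨h1, not_lt.1 h2⟩)

lemma chi_dd2_zero {R : ℝ} (hR : 0 < R) (i j : Fin 2) {x : E2}
    (hx : ¬ (R ≤ ‖x‖ ∧ ‖x‖ ≤ 2 * R)) : dd i (dd j (chi R)) x = 0 := by
  rcases lt_or_ge ‖x‖ R with h1 | h1
  · have : dd j (chi R) =ᶠ[nhds x] fun _ => 0 := by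
      filter_upwards [(isOpen_lt continuous_norm continuous_const).mem_nhds h1] with y hy
      exact chi_dd_zero hR j (fun h => absurd h.1 (not_le.2 hy))
    rw [dd_congr this, dd_const]
  · exact ((chi_VO hR le_rfl).dd j).dd i x (by
      by_contra h2
      exact hx ⟨h1, not_lt.1 h2⟩)

lemma dd_scale {f : E2 → ℝ} (hf : ContDiff ℝ 1 f) (c : ℝ) (k : Fin 2) (x : E2) :
    dd k (fun y => f (c • y)) x = c * dd k f (c • x) := by
  unfold dd
  rw [fderiv_comp_smul]
  simp

lemma exists_bound {f : E2 → ℝ} {r : ℝ} (hf : Continuous f) (hv : VO r f) :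
    ∃ K, ∀ x, |f x| ≤ K := by
  obtain ⟨K, hK⟩ := hf.bounded_above_of_compact_support hv.hasCompactSupport
  exact ⟨K, hK⟩

lemma chi_bounds : ∃ K : ℝ, 1 ≤ K ∧ ∀ R : ℝ, 0 < R →
    (∀ k x, |dd k (chi R) x| ≤ K / R) ∧ (∀ i j x, |dd i (dd j (chi R)) x| ≤ K / R ^ 2) ∧
    ∫ x, chi R x ≤ K * R ^ 2 := by
  have c2 : ContDiff ℝ 2 (bmp : E2 → ℝ) := bmp.contDiff
  have c1 : ContDiff ℝ 1 (bmp : E2 → ℝ) := bmp.contDiff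
  have vb : VO 2 (bmp : E2 → ℝ) := fun x hx => bmp.zero_of_le_dist (by
    rw [dist_zero_right]
    exact hx.le)
  have cd : ∀ j, ContDiff ℝ 1 (dd j (bmp : E2 → ℝ)) := fun j => dd_contDiff (n := 1) c2 j
  choose A hA using fun k => exists_bound (dd_continuous c1 k) (vb.dd k)
  choose B hB using fun i => fun j => exists_bound (dd_continuous (cd j) i) ((vb.dd j).dd i)
  have A0 : ∀ k, 0 ≤ A k := fun k => (abs_nonneg _).trans (hA k 0)
  have B0 : ∀ i j, 0 ≤ B i j := fun i j => (abs_nonneg _).trans (hB i j 0)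
  have J0 : 0 ≤ ∫ x, bmp x := integral_nonneg fun x => bmp.nonneg
  have hAs : ∀ k, A k ≤ A 0 + A 1 := fun k => by
    fin_cases k
    · simpa using A0 1
    · simpa using A0 0
  have hBs : ∀ i j, B i j ≤ B 0 0 + B 0 1 + B 1 0 + B 1 1 := fun i j => by
    have := B0 0 0
    have := B0 0 1
    have := B0 1 0
    have := B0 1 1
    fin_cases i <;> fin_cases j <;> simp <;> linarith
  have b00 := B0 0 0
  have b01 := B0 0 1
  have b10 := B0 1 0
  have b11 := B0 1 1
  have a0 := A0 0
  have a1 := A0 1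
  refine ⟨1 + (A 0 + A 1) + (B 0 0 + B 0 1 + B 1 0 + B 1 1) + ∫ x, bmp x, by linarith,
    fun R hR => ⟨?_, ?_, ?_⟩⟩
  · intro k x
    have : dd k (chi R) x = R⁻¹ * dd k bmp (R⁻¹ • x) := dd_scale c1 R⁻¹ k x
    rw [this, abs_mul, abs_of_pos (inv_pos.2 hR), div_eq_inv_mul]
    refine mul_le_mul_of_nonneg_left ?_ (inv_pos.2 hR).le
    have := hA k (R⁻¹ • x)
    have := hAs k
    linarith
  · intro i j x
    have e1 : dd j (chi R) = fun x => R⁻¹ * dd j bmp (R⁻¹ • x) := funext fun x => dd_scale c1 R⁻¹ j x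
    have cc : ContDiff ℝ 1 (fun x => dd j bmp (R⁻¹ • x)) := (cd j).comp (contDiff_const_smul R⁻¹)
    rw [e1, ((HD.of cc i x).cmul R⁻¹).2, dd_scale (cd j), ← mul_assoc, abs_mul,
      abs_of_pos (by positivity), div_eq_inv_mul, show (R ^ 2)⁻¹ = R⁻¹ * R⁻¹ by rw [sq, mul_inv]]
    refine mul_le_mul_of_nonneg_left ?_ (by positivity)
    have := hB i j (R⁻¹ • x)
    have := hBs i j
    linarith
  · have : ∫ x, chi R x = R ^ 2 * ∫ x, bmp x := by
      have := Measure.integral_comp_inv_smul_of_nonneg (volume : Measure E2) (fun x => bmp x) hR.le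
      simpa [E2, chi] using this
    rw [this, mul_comm]
    refine mul_le_mul_of_nonneg_right ?_ (by positivity)
    linarith

lemma chi_pow_le (R : ℝ) (x : E2) {m n : ℕ} (h : m ≤ n) : chi R x ^ n ≤ chi R x ^ m :=
  pow_le_pow_of_le_one (chi_nonneg R x) (chi_le_one R x) h

lemma chi_pow_dd {R : ℝ} (m : ℕ) (k : Fin 2) (x : E2) :
    dd k (fun y => chi R y ^ m) x = m * chi R x ^ (m - 1) * dd k (chi R) x :=
  dd_pow (chi_contDiff R 1) m k x

lemma cut_chi {K : ℝ} (hK : 1 ≤ K) (hb : ∀ R : ℝ, 0 < R →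
    (∀ k x, |dd k (chi R) x| ≤ K / R) ∧ (∀ i j x, |dd i (dd j (chi R)) x| ≤ K / R ^ 2) ∧
    ∫ x, chi R x ≤ K * R ^ 2) (n : ℕ) (hn : 2 ≤ n) {R r : ℝ} (hR : 0 < R) (hr : 2 * R ≤ r)
    {q : E2 → ℝ} (cq : Continuous q) (q0 : ∀ x, 0 ≤ q x) (vq : VO r q)
    (hq : ∀ x, R ≤ ‖x‖ → ‖x‖ ≤ 2 * R → chi R x ^ (n - 2) ≤ q x) :
    Cut (4 * n ^ 2 * K ^ 2) R r (fun x => chi R x ^ n) q := by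
  obtain ⟨b1, b2, -⟩ := hb R hR
  have c0 := chi_nonneg R
  have c1 := chi_le_one R
  have hn1 : (2 : ℝ) ≤ n := by exact_mod_cast hn
  have e2 : (fun y => (chi R y ^ n) ^ 2) = fun y => chi R y ^ (2 * n) := by
    funext y
    rw [← pow_mul, mul_comm]
  have e3 : ∀ j, dd j (fun y => chi R y ^ (2 * n)) =
      fun x => (2 * n : ℝ) * (chi R x ^ (2 * n - 1) * dd j (chi R) x) := fun j => by
    funext x
    rw [chi_pow_dd]
    push_cast
    ring
  have cd : ∀ j, ContDiff ℝ 1 (dd j (chi R)) := fun j => dd_contDiff (n := 1) (chi_contDiff R 2) j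
  have e4 : ∀ i j x, dd i (dd j (fun y => chi R y ^ (2 * n))) x = (2 * n : ℝ) *
      (chi R x ^ (2 * n - 1) * dd i (dd j (chi R)) x +
        (2 * n - 1 : ℝ) * chi R x ^ (2 * n - 2) * dd i (chi R) x * dd j (chi R) x) := by
    intro i j x
    have cp : ContDiff ℝ 1 (fun x => chi R x ^ (2 * n - 1)) := (chi_contDiff R 1).pow _
    rw [e3, (((HD.of cp i x).mul (HD.of (cd j) i x)).cmul (2 * n : ℝ)).2, chi_pow_dd,
      show 2 * n - 1 - 1 = 2 * n - 2 by omega, Nat.cast_sub (by omega)]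
    push_cast
    ring
  have m1 : ∀ j x, |dd j (fun y => chi R y ^ (2 * n)) x| ≤
      4 * n ^ 2 * K ^ 2 / R * chi R x ^ (2 * n - 2) := by
    intro j x
    simp only [e3]
    rw [abs_mul, abs_of_nonneg (show (0:ℝ) ≤ 2 * n by linarith), abs_mul,
      abs_of_nonneg (pow_nonneg (c0 x) _)]
    have p1 := chi_pow_le R x (show 2 * n - 2 ≤ 2 * n - 1 by omega)
    have p2 := mul_le_mul p1 (b1 j x) (abs_nonneg _) (pow_nonneg (c0 x) _)
    have p3 : (2 * n : ℝ) * (K / R) ≤ 4 * n ^ 2 * K ^ 2 / R := by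
      rw [← mul_div_assoc]
      refine div_le_div_of_nonneg_right ?_ hR.le
      nlinarith [mul_nonneg (by linarith : (0:ℝ) ≤ n) (by linarith : (0:ℝ) ≤ K), mul_nonneg (by linarith : (0:ℝ) ≤ n - 2) (by linarith : (0:ℝ) ≤ K - 1)]
    have p4 := mul_le_mul_of_nonneg_right p3 (pow_nonneg (c0 x) (2 * n - 2))
    have p5 := mul_le_mul_of_nonneg_left p2 (show (0:ℝ) ≤ 2 * n by linarith)
    linarith
  have m2 : ∀ i j x, |dd i (dd j (fun y => chi R y ^ (2 * n))) x| ≤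
      4 * n ^ 2 * K ^ 2 / R ^ 2 * chi R x ^ (2 * n - 2) := by
    intro i j x
    rw [e4, abs_mul, abs_of_nonneg (by positivity)]
    have w0 := pow_nonneg (c0 x) (2 * n - 2)
    have p1 := chi_pow_le R x (show 2 * n - 2 ≤ 2 * n - 1 by omega)
    have p2 := mul_le_mul p1 (b2 i j x) (abs_nonneg _) w0
    have t1 : |chi R x ^ (2 * n - 1) * dd i (dd j (chi R)) x| ≤ chi R x ^ (2 * n - 2) * (K / R ^ 2) := by
      rw [abs_mul, abs_of_nonneg (pow_nonneg (c0 x) _)]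
      exact p2
    have t2 : |(2 * n - 1 : ℝ) * chi R x ^ (2 * n - 2) * dd i (chi R) x * dd j (chi R) x| ≤
        (2 * n - 1 : ℝ) * chi R x ^ (2 * n - 2) * (K / R * (K / R)) := by
      rw [mul_assoc, abs_mul, abs_of_nonneg (show (0:ℝ) ≤ (2 * n - 1 : ℝ) * chi R x ^ (2 * n - 2)
        from mul_nonneg (by linarith) w0), abs_mul]
      refine mul_le_mul_of_nonneg_left ?_ (mul_nonneg (by linarith) w0)
      exact mul_le_mul (b1 i x) (b1 j x) (abs_nonneg _) (by positivity)
    have t3 := (abs_add_le _ _).trans (add_le_add t1 t2)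
    have t4 := mul_le_mul_of_nonneg_left t3 (show (0:ℝ) ≤ 2 * n by linarith)
    refine t4.trans ?_
    have : (2 * n : ℝ) * (chi R x ^ (2 * n - 2) * (K / R ^ 2) +
        (2 * n - 1 : ℝ) * chi R x ^ (2 * n - 2) * (K / R * (K / R))) =
        ((2 * n) * (K + (2 * n - 1) * K ^ 2)) / R ^ 2 * chi R x ^ (2 * n - 2) := by
      field_simp
    rw [this]
    refine mul_le_mul_of_nonneg_right (div_le_div_of_nonneg_right ?_ (by positivity)) w0
    nlinarith [mul_nonneg (by linarith : (0:ℝ) ≤ n) (mul_nonneg (by linarith : (0:ℝ) ≤ K) (by linarith : (0:ℝ) ≤ K - 1))]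
  have z1 : ∀ j x, ¬ (R ≤ ‖x‖ ∧ ‖x‖ ≤ 2 * R) → dd j (fun y => chi R y ^ (2 * n)) x = 0 := by
    intro j x hx
    simp only [e3]
    rw [chi_dd_zero hR j hx, mul_zero, mul_zero]
  have z2 : ∀ i j x, ¬ (R ≤ ‖x‖ ∧ ‖x‖ ≤ 2 * R) →
      dd i (dd j (fun y => chi R y ^ (2 * n))) x = 0 := by
    intro i j x hx
    rw [e4, chi_dd_zero hR j hx, chi_dd2_zero hR i j hx]
    ring
  have k0 : ∀ s : ℝ, 0 < s → 0 ≤ 4 * n ^ 2 * K ^ 2 / s := fun s hs => by positivity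
  have w1 : ∀ x, R ≤ ‖x‖ → ‖x‖ ≤ 2 * R → chi R x ^ (2 * n - 2) ≤ chi R x ^ n * q x := by
    intro x h1 h2
    rw [show 2 * n - 2 = n + (n - 2) by omega, pow_add]
    exact mul_le_mul_of_nonneg_left (hq x h1 h2) (pow_nonneg (c0 x) _)
  have w2 : ∀ x, R ≤ ‖x‖ → ‖x‖ ≤ 2 * R → chi R x ^ (2 * n - 2) ≤ q x ^ 2 := by
    intro x h1 h2
    refine (chi_pow_le R x (show 2 * (n - 2) ≤ 2 * n - 2 by omega)).trans ?_
    rw [mul_comm, pow_mul]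
    exact pow_le_pow_left₀ (pow_nonneg (c0 x) _) (hq x h1 h2) 2
  have fin : ∀ (s D : ℝ) (x : E2) (Q : ℝ), 0 < s → 0 ≤ Q →
      (¬ (R ≤ ‖x‖ ∧ ‖x‖ ≤ 2 * R) → D = 0) → |D| ≤ 4 * n ^ 2 * K ^ 2 / s * chi R x ^ (2 * n - 2) →
      (R ≤ ‖x‖ → ‖x‖ ≤ 2 * R → chi R x ^ (2 * n - 2) ≤ Q) → |D| ≤ 4 * n ^ 2 * K ^ 2 / s * Q := by
    intro s D x Q hs hQ h1 h2 h3
    by_cases hx : R ≤ ‖x‖ ∧ ‖x‖ ≤ 2 * R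
    · exact h2.trans (mul_le_mul_of_nonneg_left (h3 hx.1 hx.2) (k0 s hs))
    · rw [h1 hx, abs_zero]
      exact mul_nonneg (k0 s hs) hQ
  have hR2 : 0 < R ^ 2 := by positivity
  refine ⟨(chi_contDiff R 2).pow n, fun x => pow_nonneg (c0 x) _, fun x hx => ?_, cq, q0, vq,
    ?_, ?_, ?_, ?_⟩
  · rw [chi_VO hR hr x hx, zero_pow (by omega)]
  · intro j x
    rw [e2]
    exact fin R _ x _ hR (mul_nonneg (pow_nonneg (c0 x) _) (q0 x)) (z1 j x) (m1 j x) (w1 x)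
  · intro j x
    rw [e2]
    exact fin R _ x _ hR (sq_nonneg _) (z1 j x) (m1 j x) (w2 x)
  · intro i j x
    rw [e2]
    exact fin _ _ x _ hR2 (mul_nonneg (pow_nonneg (c0 x) _) (q0 x)) (z2 i j x) (m2 i j x) (w1 x)
  · intro i j x
    rw [e2]
    exact fin _ _ x _ hR2 (sq_nonneg _) (z2 i j x) (m2 i j x) (w2 x)

/-! ### Linear growth of the gradient energy -/

lemma pw_est {μ : ℝ} (h1 : 1 < μ) (h2 : μ < 2) : ∃ m : ℕ, ∀ a s : ℝ, 0 ≤ a → a ≤ 1 → 0 ≤ s →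
    a ^ (4 * m + 2) * (1 + 2 * s) ^ μ ≤ 9 * (a + a ^ (4 * m + 6) * s ^ 2) := by
  obtain ⟨m, hm⟩ := exists_nat_ge (μ / (2 - μ))
  have h2' : 0 < 2 - μ := by linarith
  rw [div_le_iff₀ h2'] at hm
  refine ⟨m, fun a s ha ha1 hs => ?_⟩
  have hpa : a ^ (4 * m + 2) ≤ a := by
    simpa using pow_le_pow_of_le_one ha ha1 (show 1 ≤ 4 * m + 2 by omega)
  have hn : 0 ≤ a ^ (4 * m + 6) * s ^ 2 := by positivity
  rcases le_or_gt s 1 with hs1 | hs1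
  · have e1 : (1 + 2 * s) ^ μ ≤ 9 := by
      calc (1 + 2 * s) ^ μ ≤ (3:ℝ) ^ μ := Real.rpow_le_rpow (by linarith) (by linarith) (by linarith)
        _ ≤ (3:ℝ) ^ (2:ℝ) := Real.rpow_le_rpow_of_exponent_le (by norm_num) h2.le
        _ = 9 := by norm_num
    have := mul_le_mul hpa e1 (Real.rpow_nonneg (by linarith) _) ha
    linarith
  · have hs0 : 0 < s := by linarith
    have e1 : (1 + 2 * s) ^ μ ≤ 9 * s ^ μ := by
      calc (1 + 2 * s) ^ μ ≤ (3 * s) ^ μ := Real.rpow_le_rpow (by linarith) (by linarith) (by linarith)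
        _ = (3:ℝ) ^ μ * s ^ μ := Real.mul_rpow (by norm_num) hs
        _ ≤ (3:ℝ) ^ (2:ℝ) * s ^ μ := mul_le_mul_of_nonneg_right
          (Real.rpow_le_rpow_of_exponent_le (by norm_num) h2.le) (Real.rpow_nonneg hs _)
        _ = 9 * s ^ μ := by norm_num
    have hsp : 0 < s ^ μ := Real.rpow_pos_of_pos hs0 _
    have key : a ^ (4 * m + 2) * s ^ μ ≤ a + a ^ (4 * m + 6) * s ^ 2 := by
      have ess : s ^ 2 = s ^ μ * s ^ (2 - μ) := by
        rw [← Real.rpow_add hs0, show μ + (2 - μ) = (2:ℝ) by ring]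
        norm_num
      rcases le_or_gt 1 (a ^ 4 * s ^ (2 - μ)) with h | h
      · have : a ^ (4 * m + 6) * s ^ 2 = (a ^ (4 * m + 2) * s ^ μ) * (a ^ 4 * s ^ (2 - μ)) := by
          rw [ess]; ring
        rw [this]
        have := le_mul_of_one_le_right (show 0 ≤ a ^ (4 * m + 2) * s ^ μ by positivity) h
        linarith
      · have q1 : (a ^ 4 * s ^ (2 - μ)) ^ m ≤ 1 := pow_le_one₀ (by positivity) h.le
        have q2 : s ^ μ ≤ (s ^ (2 - μ)) ^ m := by
          rw [← Real.rpow_natCast, ← Real.rpow_mul hs]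
          exact Real.rpow_le_rpow_of_exponent_le hs1.le (by linarith)
        have q3 : a ^ (4 * m) * s ^ μ ≤ 1 := by
          refine le_trans ?_ q1
          rw [mul_pow, ← pow_mul]
          exact mul_le_mul_of_nonneg_left q2 (by positivity)
        have q4 : a ^ (4 * m + 2) * s ^ μ = a ^ 2 * (a ^ (4 * m) * s ^ μ) := by ring
        rw [q4]
        have q5 := mul_le_mul_of_nonneg_left q3 (sq_nonneg a)
        nlinarith
    have := mul_le_mul_of_nonneg_left e1 (pow_nonneg ha (4 * m + 2))
    linarith

lemma fnorm_eps_sq (U : Fin 2 → E2 → ℝ) (x : E2) : fnorm (eps U x) ^ 2 ≤ VV U x := by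
  rw [fnorm_sq]
  simp only [frob, Fin.sum_univ_two, eps, VV]
  nlinarith [sq_nonneg (dd 1 (U 0) x - dd 0 (U 1) x)]

lemma Sol.growth {h : ℝ → ℝ} {c₁ c₂ μ M : ℝ} {U : Fin 2 → E2 → ℝ} {ψ : E2 → ℝ}
    (S : Sol h c₁ c₂ μ M U ψ) : ∃ m : ℕ, ∃ C R₀ : ℝ, 1 ≤ C ∧ 1 ≤ R₀ ∧ ∀ R, R₀ ≤ R →
      (∫ x, chi R x ^ (4 * m + 6) * VV U x ≤ C * R) ∧
      ∀ᶠ t in nhdsWithin (0 : ℝ) (Set.Ioi 0), Et h U (fun x => chi R x ^ (2 * m + 5)) t ≤ C := by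
  obtain ⟨m, hm⟩ := pw_est S.hH.hμ₁ S.hH.hμ₂
  obtain ⟨K, hK, hb⟩ := chi_bounds
  obtain ⟨C0, hC0, hI⟩ := S.caccio (K := 4 * ((2 * m + 5 : ℕ) : ℝ) ^ 2 * K ^ 2) (by positivity)
  have hM0 : 0 < M := by linarith [S.hM]
  have hc := S.hH.hc₁
  set A := 32 * M ^ 2 * C0 / c₁ with hA
  have A0 : 0 < A := by positivity
  set B := (4 * m + 6) * K with hB
  have B0 : 0 < B := by positivity
  set D := 2 * (K + 1 / (4 * C0) + 9 * A * K + 3 * M * B * K + 1) with hD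
  have D0 : 0 < D := by positivity
  refine ⟨m, D + C0 * D + C0 * K + 1, 1 + 4 * (9 * A + 6 * M * B), ?_, ?_, fun R hR => ?_⟩
  · have : 0 < D + C0 * D + C0 * K := by positivity
    linarith
  · have : 0 < 4 * (9 * A + 6 * M * B) := by positivity
    linarith
  have hAB : 0 < 4 * (9 * A + 6 * M * B) := by positivity
  have hR1 : 1 ≤ R := by linarith
  have hR0 : 0 < R := by linarith
  obtain ⟨b1, b2, b3⟩ := hb R hR0
  have c0 := chi_nonneg R
  have cc := chi_continuous R
  have cV := VV_continuous S.cU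
  have cA := AA_continuous S.cU
  have vc := chi_VO hR0 le_rfl
  set Y := ∫ x, chi R x ^ (4 * m + 6) * VV U x with hY
  have IY : Integrable (fun x => chi R x ^ (4 * m + 6) * VV U x) :=
    VO.integrable (r := 2 * R) (fun x hx => by simp [vc x hx]) (by fun_prop)
  have Ic : Integrable (fun x => chi R x) := vc.integrable cc
  have Y0 : 0 ≤ Y := integral_nonneg fun x => mul_nonneg (pow_nonneg (c0 x) _) (VV_nonneg U x)
  have cut := cut_chi hK hb (2 * m + 5) (by omega) hR0 le_rfl (q := fun x => chi R x ^ (2 * m + 3))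
    (by fun_prop) (fun x => pow_nonneg (c0 x) _) (fun x hx => by simp [vc x hx])
    (fun x _ _ => le_rfl)
  have cut2 : Cut2 (2 * R) (fun x => chi R x ^ (4 * m + 6)) (fun x => chi R x ^ (2 * m + 5))
      (fun x => chi R x ^ (2 * m + 1)) (fun x => B / R * chi R x ^ (4 * m + 5)) := by
    refine ⟨(chi_contDiff R 1).pow _, by fun_prop, by fun_prop, by fun_prop,
      fun x => pow_nonneg (c0 x) _, fun x => pow_nonneg (c0 x) _, fun x hx => by simp [vc x hx],
      fun x hx => by simp [vc x hx], fun x hx => by simp [vc x hx], fun x => ?_, fun k x => ?_⟩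
    · rw [← pow_add]
      congr 1
      omega
    · rw [chi_pow_dd, abs_mul, show 4 * m + 6 - 1 = 4 * m + 5 by omega,
        abs_of_nonneg (mul_nonneg (by positivity) (pow_nonneg (c0 x) _))]
      have := mul_le_mul_of_nonneg_left (b1 k x) (show (0:ℝ) ≤ ((4 * m + 6 : ℕ) : ℝ) * chi R x ^ (4 * m + 5) from
        mul_nonneg (by positivity) (pow_nonneg (c0 x) _))
      refine this.trans (le_of_eq ?_)
      rw [hB]
      push_cast
      ring
  have lamp : 0 < R / (16 * M * C0) := by positivity
  have ev1 := hI R _ _ _ hR1 cut 1 one_pos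
  have ev2 := S.second cut2 lamp one_pos
  have eq1 : ∫ x, (chi R x ^ (2 * m + 3)) ^ 2 * VV U x = Y := by
    rw [hY]
    congr 1
    funext x
    rw [← pow_mul]
    congr 2
    omega
  have eq2 : ∫ x, (chi R x ^ (2 * m + 3)) ^ 2 ≤ K * R ^ 2 := by
    refine le_trans (integral_mono ?_ Ic fun x => ?_) b3
    · exact VO.integrable (r := 2 * R) (fun x hx => by simp [vc x hx]) (by fun_prop)
    · simp only
      rw [← pow_mul]
      simpa using chi_pow_le R x (show 1 ≤ (2 * m + 3) * 2 by omega)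
  simp only [eq1] at ev1
  have eq3 : ∫ x, (chi R x ^ (2 * m + 1)) ^ 2 * (1 + 2 * fnorm (eps U x)) ^ μ ≤ 9 * (K * R ^ 2) + 9 * Y := by
    have : ∫ x, (chi R x ^ (2 * m + 1)) ^ 2 * (1 + 2 * fnorm (eps U x)) ^ μ ≤
        ∫ x, (9 * chi R x + 9 * (chi R x ^ (4 * m + 6) * VV U x)) := by
      refine integral_mono ?_ ((Ic.const_mul 9).add (IY.const_mul 9)) fun x => ?_
      · refine VO.integrable (r := 2 * R) (fun x hx => by simp [vc x hx]) ?_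
        have := fnorm_eps_continuous S.cU
        refine Continuous.mul (by fun_prop) (Continuous.rpow_const (by fun_prop) fun x => ?_)
        right
        linarith [S.hH.hμ₁]
      · simp only
        rw [← pow_mul, show (2 * m + 1) * 2 = 4 * m + 2 by omega]
        have e1 := hm _ _ (c0 x) (chi_le_one R x) (fnorm_nonneg (eps U x))
        have e2 := mul_le_mul_of_nonneg_left (fnorm_eps_sq U x) (pow_nonneg (c0 x) (4 * m + 6))
        linarith
    rw [integral_add (Ic.const_mul 9) (IY.const_mul 9), integral_const_mul, integral_const_mul] at this
    linarith
  have eq4 : ∫ x, B / R * chi R x ^ (4 * m + 5) * AA U x ≤ B / R * (2 * Y + K * R ^ 2) := by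
    have : ∫ x, B / R * chi R x ^ (4 * m + 5) * AA U x ≤
        ∫ x, (B / R * (2 * (chi R x ^ (4 * m + 6) * VV U x) + chi R x)) := by
      refine integral_mono ?_ (((IY.const_mul 2).add Ic).const_mul _) fun x => ?_
      · exact VO.integrable (r := 2 * R) (fun x hx => by simp [vc x hx]) (by fun_prop)
      · simp only
        rw [mul_assoc]
        refine mul_le_mul_of_nonneg_left ?_ (by positivity)
        have e1 := mul_le_mul_of_nonneg_left (AA_sq U x) (pow_nonneg (c0 x) (4 * m + 6))
        have e2 : chi R x ^ (4 * m + 4) ≤ chi R x := by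
          simpa using chi_pow_le R x (show 1 ≤ 4 * m + 4 by omega)
        have e3 : 0 ≤ chi R x ^ (4 * m + 4) * (chi R x * AA U x - 1) ^ 2 :=
          mul_nonneg (pow_nonneg (c0 x) _) (sq_nonneg _)
        have e4 : chi R x ^ (4 * m + 4) * (chi R x * AA U x - 1) ^ 2 = chi R x ^ (4 * m + 6) * AA U x ^ 2 -
          2 * (chi R x ^ (4 * m + 5) * AA U x) + chi R x ^ (4 * m + 4) := by ring
        have := c0 x
        linarith
    rw [integral_const_mul, integral_add (IY.const_mul 2) Ic, integral_const_mul] at this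
    refine this.trans (mul_le_mul_of_nonneg_left ?_ (by positivity))
    linarith
  have hYle : Y ≤ D * R := by
    obtain ⟨t, h1, h2⟩ := (ev1.and ev2).exists
    set E := Et h U (fun x => chi R x ^ (2 * m + 5)) t
    have f1 : 4 * M * (R / (16 * M * C0)) = R / (4 * C0) := by field_simp; norm_num
    have f2 : 2 * M / (R / (16 * M * C0) * c₁) = A / R := by rw [hA]; field_simp; norm_num
    rw [f1, f2] at h2
    have g1 : R / (4 * C0) * E ≤ Y / 4 + K / 4 + R / (4 * C0) := by
      have : E ≤ C0 / R * Y + C0 / R ^ 3 * (K * R ^ 2) + 1 := by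
        have := mul_le_mul_of_nonneg_left eq2 (show 0 ≤ C0 / R ^ 3 by positivity)
        linarith
      refine (mul_le_mul_of_nonneg_left this (by positivity)).trans (le_of_eq ?_)
      field_simp
    have g2 := mul_le_mul_of_nonneg_left eq3 (show 0 ≤ A / R by positivity)
    have g3 := mul_le_mul_of_nonneg_left eq4 (show 0 ≤ 3 * M by positivity)
    have g4 : (9 * A + 6 * M * B) / R * Y ≤ 1 / 4 * Y := by
      refine mul_le_mul_of_nonneg_right ?_ Y0
      rw [div_le_iff₀ hR0]
      linarith
    have g5 : A / R * (9 * (K * R ^ 2) + 9 * Y) + 3 * M * (B / R * (2 * Y + K * R ^ 2)) =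
        (9 * A + 6 * M * B) / R * Y + (9 * A * K + 3 * M * B * K) * R := by
      field_simp
      ring
    have g6 : K / 4 ≤ K * R := by nlinarith
    have g7 : R / (4 * C0) = 1 / (4 * C0) * R := by ring
    rw [g7] at g1
    have : Y / 2 ≤ (K + 1 / (4 * C0) + 9 * A * K + 3 * M * B * K + 1) * R := by
      rw [g7] at h2
      linarith
    rw [hD]
    linarith
  refine ⟨hYle.trans (mul_le_mul_of_nonneg_right ?_ hR0.le), ?_⟩
  · have : 0 < C0 * D + C0 * K + 1 := by positivity
    linarith
  · filter_upwards [ev1] with t ht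
    have g1 := mul_le_mul_of_nonneg_left hYle (show 0 ≤ C0 / R by positivity)
    have g2 := mul_le_mul_of_nonneg_left eq2 (show 0 ≤ C0 / R ^ 3 by positivity)
    have g3 : C0 / R * (D * R) = C0 * D := by field_simp
    have g4 : C0 / R ^ 3 * (K * R ^ 2) ≤ C0 * K := by
      have : C0 / R ^ 3 * (K * R ^ 2) = C0 * K / R := by field_simp
      rw [this]
      exact div_le_self (by positivity) hR1
    linarith

/-! ### Decay of the second-order energy -/

lemma seq_zero {a : ℕ → ℝ} {B C : ℝ} (hmono : Monotone a) (hB : ∀ j, a j ≤ B)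
    (hrec : ∀ lam : ℝ, 1 ≤ lam → ∃ D : ℝ, ∀ j, a (j + 3) ≤ C * lam * (a (j + 5) - a j) + C / lam +
      D * (1 / 2) ^ j) : ∀ j, a j ≤ 0 := by
  have hbdd : BddAbove (Set.range a) := ⟨B, by rintro _ ⟨j, rfl⟩; exact hB j⟩
  have hL := tendsto_atTop_ciSup hmono hbdd
  set L := ⨆ i, a i
  have h1 : ∀ lam : ℝ, 1 ≤ lam → L ≤ C / lam := by
    intro lam hl
    obtain ⟨D, hD⟩ := hrec lam hl
    have t3 := (tendsto_add_atTop_iff_nat 3).2 hL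
    have t5 := (tendsto_add_atTop_iff_nat 5).2 hL
    have tp : Tendsto (fun j : ℕ => ((1:ℝ) / 2) ^ j) atTop (nhds 0) :=
      tendsto_pow_atTop_nhds_zero_of_lt_one (by norm_num) (by norm_num)
    have := le_of_tendsto_of_tendsto' t3
      ((((t5.sub hL).const_mul (C * lam)).add_const (C / lam)).add (tp.const_mul D)) hD
    simpa using this
  have h2 : L ≤ 0 := by
    have : Tendsto (fun lam : ℝ => C / lam) atTop (nhds 0) := tendsto_const_nhds.div_atTop tendsto_id
    refine ge_of_tendsto this ?_
    filter_upwards [eventually_ge_atTop 1] with lam hl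
    exact h1 lam hl
  intro j
  exact (le_ciSup hbdd j).trans h2

lemma chi_mono {R R' : ℝ} (hR : 0 < R) (h : 2 * R ≤ R') (x : E2) : chi R x ≤ chi R' x := by
  rcases le_total ‖x‖ R' with h1 | h1
  · rw [chi_one (by linarith) h1]
    exact chi_le_one R x
  · rw [chi_zero hR (by linarith)]
    exact chi_nonneg R' x

def ann (R : ℝ) (x : E2) : ℝ := chi (16 * R) x - chi (2 * R) x

lemma ann_nonneg {R : ℝ} (hR : 0 < R) (x : E2) : 0 ≤ ann R x :=
  sub_nonneg.2 (chi_mono (by linarith) (by linarith) x)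

lemma ann_le_one {R : ℝ} (x : E2) : ann R x ≤ 1 := by
  unfold ann
  linarith [chi_le_one (16 * R) x, chi_nonneg (2 * R) x]

lemma ann_continuous (R : ℝ) : Continuous (ann R) :=
  (chi_continuous (16 * R)).sub (chi_continuous (2 * R))

lemma ann_zero_out {R : ℝ} (hR : 0 < R) {x : E2} (hx : 32 * R ≤ ‖x‖) : ann R x = 0 := by
  unfold ann
  rw [chi_zero (by linarith) (by linarith), chi_zero (by linarith) (by linarith), sub_zero]

lemma ann_zero_in {R : ℝ} (hR : 0 < R) {x : E2} (hx : ‖x‖ ≤ 2 * R) : ann R x = 0 := by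
  unfold ann
  rw [chi_one (by linarith) (by linarith), chi_one (by linarith) (by linarith), sub_self]

lemma ann_one {R : ℝ} (hR : 0 < R) {x : E2} (h1 : 8 * R ≤ ‖x‖) (h2 : ‖x‖ ≤ 16 * R) :
    ann R x = 1 := by
  unfold ann
  rw [chi_one (by linarith) (by linarith), chi_zero (by linarith) (by linarith), sub_zero]

lemma ann_le_chi {R : ℝ} (hR : 0 < R) (k : ℕ) (x : E2) : ann R x ≤ chi (32 * R) x ^ k := by
  rcases le_total ‖x‖ (32 * R) with h1 | h1
  · rw [chi_one (by linarith) h1, one_pow]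
    exact ann_le_one x
  · rw [ann_zero_out hR h1]
    exact pow_nonneg (chi_nonneg _ x) _

lemma ann_sq_le {R : ℝ} (hR : 0 < R) {n : ℕ} (hn : 1 ≤ n) (x : E2) :
    ann R x ^ 2 ≤ (chi (32 * R) x ^ n) ^ 2 - (chi R x ^ n) ^ 2 := by
  rcases le_total ‖x‖ (2 * R) with h1 | h1
  · rw [ann_zero_in hR h1]
    have := pow_le_pow_left₀ (pow_nonneg (chi_nonneg R x) n)
      (pow_le_pow_left₀ (chi_nonneg R x) (chi_mono hR (show 2 * R ≤ 32 * R by linarith) x) n) 2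
    linarith
  · rw [chi_zero hR h1, zero_pow (by omega)]
    have := ann_le_chi hR n x
    have := pow_le_pow_left₀ (ann_nonneg hR x) this 2
    linarith

lemma Sol.Et_int {h : ℝ → ℝ} {c₁ c₂ μ M : ℝ} {U : Fin 2 → E2 → ℝ} {ψ : E2 → ℝ}
    (S : Sol h c₁ c₂ μ M U ψ) {r : ℝ} {θ : E2 → ℝ} (cθ : Continuous θ) (vθ : VO r θ) (t : ℝ) :
    Integrable (fun x => θ x ^ 2 * (Pd h U 0 t x + Pd h U 1 t x)) :=
  VO.integrable (r := r) (fun x hx => by simp [vθ x hx])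
    ((cθ.pow 2).mul ((S.Pd_continuous 0 t).add (S.Pd_continuous 1 t)))

lemma Sol.Et_nonneg {h : ℝ → ℝ} {c₁ c₂ μ M : ℝ} {U : Fin 2 → E2 → ℝ} {ψ : E2 → ℝ}
    (S : Sol h c₁ c₂ μ M U ψ) (θ : E2 → ℝ) (t : ℝ) : 0 ≤ Et h U θ t :=
  integral_nonneg fun x => mul_nonneg (sq_nonneg _) (add_nonneg (S.Pd_nonneg 0 t x) (S.Pd_nonneg 1 t x))

set_option maxHeartbeats 1000000 in
lemma Sol.recur {h : ℝ → ℝ} {c₁ c₂ μ M : ℝ} {U : Fin 2 → E2 → ℝ} {ψ : E2 → ℝ}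
    (S : Sol h c₁ c₂ μ M U ψ) : ∃ m : ℕ, ∃ C P R₀ : ℝ, 1 ≤ R₀ ∧
      (∀ R, R₀ ≤ R → ∀ᶠ t in nhdsWithin (0 : ℝ) (Set.Ioi 0),
        Et h U (fun x => chi R x ^ (2 * m + 5)) t ≤ C) ∧
      (∀ R lam, R₀ ≤ R → 1 ≤ lam → ∀ᶠ t in nhdsWithin (0 : ℝ) (Set.Ioi 0),
        Et h U (fun x => chi (8 * R) x ^ (2 * m + 5)) t ≤
          P * lam * (Et h U (fun x => chi (32 * R) x ^ (2 * m + 5)) t -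
            Et h U (fun x => chi R x ^ (2 * m + 5)) t) + P / lam + P * lam / R) := by
  obtain ⟨m, C, R₀, hC1, hR₀, hg⟩ := S.growth
  obtain ⟨K, hK, hb⟩ := chi_bounds
  obtain ⟨C0, hC0, hI⟩ := S.caccio (K := 4 * ((2 * m + 5 : ℕ) : ℝ) ^ 2 * K ^ 2) (by positivity)
  have hM0 : 0 < M := by linarith [S.hM]
  have hc := S.hH.hc₁
  set P1 := 4 * M * C0 with hP1
  set P2 := 2 * M * C0 / c₁ * (2048 * K + 256 * C) + 6 * M * K * C0 * (1024 * K) with hP2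
  set P3 := 6 * M * K * C0 * (32 * C) + (C0 + 1024 * K * C0 + 1) with hP3
  have P10 : 0 < P1 := by positivity
  have P20 : 0 < P2 := by positivity
  have P30 : 0 < P3 := by positivity
  refine ⟨m, C, P1 + P2 + P3, R₀, hR₀, fun R hR => (hg R hR).2, fun R lam hR hl => ?_⟩
  have hR1 : 1 ≤ R := by linarith
  have hR0 : 0 < R := by linarith
  have hl0 : 0 < lam := by linarith
  obtain ⟨hW, -⟩ := hg (32 * R) (by linarith)
  obtain ⟨-, -, hJ⟩ := hb (32 * R) (by linarith)
  have a0 := ann_nonneg hR0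
  have a1 := ann_le_one (R := R)
  have ca := ann_continuous R
  have c0 := chi_nonneg (32 * R)
  have cc := chi_continuous (32 * R)
  have cV := VV_continuous S.cU
  have cA := AA_continuous S.cU
  have vc : VO (64 * R) (chi (32 * R)) := chi_VO (by linarith) (by linarith)
  have va : VO (64 * R) (ann R) := fun x hx => ann_zero_out hR0 (by linarith)
  set W := ∫ x, chi (32 * R) x ^ (4 * m + 6) * VV U x with hWd
  set J := ∫ x, chi (32 * R) x with hJd
  have IW : Integrable (fun x => chi (32 * R) x ^ (4 * m + 6) * VV U x) :=
    VO.integrable (r := 64 * R) (fun x hx => by simp [vc x hx]) (by fun_prop)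
  have IJ : Integrable (fun x => chi (32 * R) x) := vc.integrable cc
  have cut := cut_chi hK hb (2 * m + 5) (by omega) (show 0 < 8 * R by linarith)
    (show 2 * (8 * R) ≤ 64 * R by linarith) (q := ann R) ca a0 va
    (fun x h1 h2 => by
      rw [ann_one hR0 h1 (by linarith)]
      exact pow_le_one₀ (chi_nonneg _ x) (chi_le_one _ x))
  have cd : ContDiff ℝ 1 (ann R) := (chi_contDiff (16 * R) 1).sub (chi_contDiff (2 * R) 1)
  have cut2 : Cut2 (64 * R) (fun x => ann R x ^ 2) (ann R) (ann R) (fun x => 2 * K / R * ann R x) := by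
    refine ⟨cd.pow 2, ca, ca, by fun_prop, a0, a0, va, va, fun x hx => by simp [va x hx],
      fun x => sq _, fun k x => ?_⟩
    have e1 : dd k (ann R) x = dd k (chi (16 * R)) x + -dd k (chi (2 * R)) x :=
      ((HD.of (chi_contDiff (16 * R) 1) k x).add (HD.of (chi_contDiff (2 * R) 1) k x).neg).2
    have e2 : |dd k (ann R) x| ≤ K / R := by
      rw [e1]
      refine (abs_add_le _ _).trans ?_
      rw [abs_neg]
      have b1 := (hb (16 * R) (by linarith)).1 k x
      have b2 := (hb (2 * R) (by linarith)).1 k x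
      have e3 : K / (16 * R) + K / (2 * R) ≤ K / R := by
        have : K / (16 * R) + K / (2 * R) = 9 / 16 * (K / R) := by field_simp; norm_num
        rw [this]
        have : 0 < K / R := by positivity
        linarith
      linarith
    rw [dd_pow cd, abs_mul, abs_of_nonneg (mul_nonneg (by positivity) (pow_nonneg (a0 x) _))]
    have := mul_le_mul_of_nonneg_left e2 (show 0 ≤ 2 * ann R x by linarith [a0 x])
    simp only [Nat.cast_ofNat, Nat.add_one_sub_one, pow_one]
    refine this.trans (le_of_eq ?_)
    ring
  have lamp : 0 < R * lam := by positivity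
  have ev1 := hI (8 * R) _ _ _ (by linarith) cut (1 / R) (by positivity)
  have ev2 := S.second cut2 lamp one_pos
  have eq2 : ∫ x, ann R x ^ 2 ≤ J := by
    refine integral_mono ?_ IJ fun x => ?_
    · exact VO.integrable (r := 64 * R) (fun x hx => by simp [va x hx]) (by fun_prop)
    · have e1 := ann_le_chi hR0 1 x
      rw [pow_one] at e1
      simp only
      nlinarith [a0 x, a1 x]
  have eq3 : ∫ x, ann R x ^ 2 * (1 + 2 * fnorm (eps U x)) ^ μ ≤ 2 * J + 8 * W := by
    have : ∫ x, ann R x ^ 2 * (1 + 2 * fnorm (eps U x)) ^ μ ≤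
        ∫ x, (2 * chi (32 * R) x + 8 * (chi (32 * R) x ^ (4 * m + 6) * VV U x)) := by
      refine integral_mono ?_ ((IJ.const_mul 2).add (IW.const_mul 8)) fun x => ?_
      · refine VO.integrable (r := 64 * R) (fun x hx => by simp [va x hx]) ?_
        have := fnorm_eps_continuous S.cU
        refine Continuous.mul (by fun_prop) (Continuous.rpow_const (by fun_prop) fun x => ?_)
        right
        linarith [S.hH.hμ₁]
      · have f0 := fnorm_nonneg (eps U x)
        have e1 : (1 + 2 * fnorm (eps U x)) ^ μ ≤ 2 + 8 * VV U x := by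
          have g1 : (1 + 2 * fnorm (eps U x)) ^ μ ≤ (1 + 2 * fnorm (eps U x)) ^ (2:ℝ) :=
            Real.rpow_le_rpow_of_exponent_le (by linarith) S.hH.hμ₂.le
          rw [Real.rpow_two] at g1
          have g2 := fnorm_eps_sq U x
          nlinarith [sq_nonneg (1 - 2 * fnorm (eps U x))]
        have e2 := ann_le_chi hR0 1 x
        rw [pow_one] at e2
        have e3 := ann_le_chi hR0 (4 * m + 6) x
        have e4 : ann R x ^ 2 ≤ ann R x := by nlinarith [a0 x, a1 x]
        have e5 := mul_le_mul_of_nonneg_left e1 (sq_nonneg (ann R x))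
        have e6 := mul_le_mul_of_nonneg_right (e4.trans e3) (VV_nonneg U x)
        simp only
        linarith
    rw [integral_add (IJ.const_mul 2) (IW.const_mul 8), integral_const_mul, integral_const_mul] at this
    exact this
  have eq4 : ∫ x, 2 * K / R * ann R x * AA U x ≤ 2 * K / R * (lam * W + 1 / lam * J) := by
    have : ∫ x, 2 * K / R * ann R x * AA U x ≤
        ∫ x, (2 * K / R * (lam * (chi (32 * R) x ^ (4 * m + 6) * VV U x) + 1 / lam * chi (32 * R) x)) := by
      refine integral_mono ?_ (((IW.const_mul _).add (IJ.const_mul _)).const_mul _) fun x => ?_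
      · exact VO.integrable (r := 64 * R) (fun x hx => by simp [va x hx]) (by fun_prop)
      · simp only
        rw [mul_assoc]
        refine mul_le_mul_of_nonneg_left ?_ (by positivity)
        have e1 : AA U x ≤ lam * VV U x + 1 / lam := by
          have g1 : lam / 4 * AA U x ^ 2 + 1 / lam - AA U x = (lam * AA U x / 2 - 1) ^ 2 / lam := by
            field_simp
            ring
          have g2 : 0 ≤ (lam * AA U x / 2 - 1) ^ 2 / lam := by positivity
          have g3 := mul_le_mul_of_nonneg_left (AA_sq U x) hl0.le
          linarith
        have e2 := ann_le_chi hR0 1 x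
        rw [pow_one] at e2
        have e3 := ann_le_chi hR0 (4 * m + 6) x
        have e4 := mul_le_mul_of_nonneg_left e1 (a0 x)
        have e5 := mul_le_mul_of_nonneg_right e3 (mul_nonneg hl0.le (VV_nonneg U x))
        have e6 := mul_le_mul_of_nonneg_right e2 (show 0 ≤ 1 / lam by positivity)
        linarith
    rw [integral_const_mul, integral_add (IW.const_mul _) (IJ.const_mul _), integral_const_mul,
      integral_const_mul] at this
    exact this
  filter_upwards [ev1, ev2] with t h1 h2
  have hE : Et h U (ann R) t ≤ Et h U (fun x => chi (32 * R) x ^ (2 * m + 5)) t -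
      Et h U (fun x => chi R x ^ (2 * m + 5)) t := by
    have i1 := S.Et_int (r := 64 * R) (θ := fun x => chi (32 * R) x ^ (2 * m + 5)) (by fun_prop)
      (fun x hx => by simp [vc x hx]) t
    have i2 := S.Et_int (r := 64 * R) (θ := fun x => chi R x ^ (2 * m + 5))
      ((chi_continuous R).pow _) (fun x hx => by
        have := chi_VO hR0 (show 2 * R ≤ 64 * R by linarith) x hx
        simp [this]) t
    unfold Et
    rw [← integral_sub i1 i2]
    refine integral_mono (S.Et_int ca va t) (i1.sub i2) fun x => ?_
    have e1 := mul_le_mul_of_nonneg_right (ann_sq_le hR0 (show 1 ≤ 2 * m + 5 by omega) x)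
      (add_nonneg (S.Pd_nonneg 0 t x) (S.Pd_nonneg 1 t x))
    simp only
    linarith
  set E := Et h U (ann R) t
  set Δ := Et h U (fun x => chi (32 * R) x ^ (2 * m + 5)) t -
      Et h U (fun x => chi R x ^ (2 * m + 5)) t
  have E0 : 0 ≤ E := S.Et_nonneg _ t
  set Z := ∫ x, ann R x ^ 2 * VV U x with hZ
  have Z0 : 0 ≤ Z := integral_nonneg fun x => mul_nonneg (sq_nonneg _) (VV_nonneg U x)
  have hJ2 : J ≤ 1024 * K * R ^ 2 := by linarith
  have hW2 : W ≤ 32 * C * R := by linarith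
  have z1 : Z ≤ 4 * M * (R * lam) * E + 2 * M / (R * lam * c₁) * (2048 * K * R ^ 2 + 256 * C * R) +
      3 * M * (2 * K / R * (lam * (32 * C * R) + 1 / lam * (1024 * K * R ^ 2))) + 1 := by
    have k1 := mul_le_mul_of_nonneg_left (eq3.trans (show 2 * J + 8 * W ≤
      2048 * K * R ^ 2 + 256 * C * R by linarith)) (show 0 ≤ 2 * M / (R * lam * c₁) by positivity)
    have k2 : 2 * K / R * (lam * W + 1 / lam * J) ≤
        2 * K / R * (lam * (32 * C * R) + 1 / lam * (1024 * K * R ^ 2)) := by gcongr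
    have k3 := mul_le_mul_of_nonneg_left (eq4.trans k2) (show 0 ≤ 3 * M by positivity)
    linarith
  have z2 : Et h U (fun x => chi (8 * R) x ^ (2 * m + 5)) t ≤ C0 / R * Z + C0 / R ^ 3 * (1024 * K * R ^ 2) + 1 / R := by
    have k1 : C0 / (8 * R) * Z ≤ C0 / R * Z := by
      refine mul_le_mul_of_nonneg_right ?_ Z0
      exact div_le_div_of_nonneg_left hC0.le hR0 (by linarith)
    have k2 : C0 / (8 * R) ^ 3 * (∫ x, ann R x ^ 2) ≤ C0 / R ^ 3 * (1024 * K * R ^ 2) := by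
      refine mul_le_mul ?_ (eq2.trans hJ2) (integral_nonneg fun x => sq_nonneg _) (by positivity)
      refine div_le_div_of_nonneg_left hC0.le (by positivity) ?_
      exact pow_le_pow_left₀ hR0.le (by linarith) 3
    linarith
  have z3 := mul_le_mul_of_nonneg_left z1 (show 0 ≤ C0 / R by positivity)
  have z4 : C0 / R * (4 * M * (R * lam) * E + 2 * M / (R * lam * c₁) * (2048 * K * R ^ 2 + 256 * C * R) +
      3 * M * (2 * K / R * (lam * (32 * C * R) + 1 / lam * (1024 * K * R ^ 2))) + 1) =
      P1 * lam * E + (2 * M * C0 / c₁ * (2048 * K + 256 * C / R) + 6 * M * K * C0 * (1024 * K)) / lam +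
      6 * M * K * C0 * (32 * C) * lam / R + C0 / R := by
    rw [hP1]
    field_simp
    ring
  have z5 : (2 * M * C0 / c₁ * (2048 * K + 256 * C / R) + 6 * M * K * C0 * (1024 * K)) / lam ≤ P2 / lam := by
    refine div_le_div_of_nonneg_right ?_ hl0.le
    rw [hP2]
    have : 256 * C / R ≤ 256 * C := div_le_self (by positivity) hR1
    gcongr
  have z6 : C0 / R ^ 3 * (1024 * K * R ^ 2) = 1024 * K * C0 / R := by field_simp
  have z7 : 6 * M * K * C0 * (32 * C) * lam / R + C0 / R + 1024 * K * C0 / R + 1 / R ≤ P3 * lam / R := by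
    have : 6 * M * K * C0 * (32 * C) * lam / R + C0 / R + 1024 * K * C0 / R + 1 / R =
      (6 * M * K * C0 * (32 * C) * lam + (C0 + 1024 * K * C0 + 1)) / R := by ring
    rw [this, hP3]
    refine div_le_div_of_nonneg_right ?_ hR0.le
    have : 0 < C0 + 1024 * K * C0 + 1 := by positivity
    rw [add_mul]
    exact add_le_add_right (le_mul_of_one_le_right this.le hl) _
  have y1 : P1 * lam * E ≤ (P1 + P2 + P3) * lam * Δ := by
    have : P1 * lam ≤ (P1 + P2 + P3) * lam := by gcongr; linarith
    exact mul_le_mul this hE E0 (by positivity)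
  have y2 : P2 / lam ≤ (P1 + P2 + P3) / lam := by gcongr; linarith
  have y3 : P3 * lam / R ≤ (P1 + P2 + P3) * lam / R := by gcongr; linarith
  linarith

lemma Sol.energy {h : ℝ → ℝ} {c₁ c₂ μ M : ℝ} {U : Fin 2 → E2 → ℝ} {ψ : E2 → ℝ}
    (S : Sol h c₁ c₂ μ M U ψ) : ∃ n : ℕ, 1 ≤ n ∧ ∃ (F : Filter ℝ) (R₀ : ℝ), F.NeBot ∧
      F ≤ nhdsWithin (0 : ℝ) (Set.Ioi 0) ∧ 1 ≤ R₀ ∧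
      ∀ j : ℕ, Tendsto (Et h U (fun x => chi (R₀ * 2 ^ j) x ^ n)) F (nhds 0) := by
  obtain ⟨m, C, P, R₀, hR₀, hb, hr⟩ := S.recur
  let F : Ultrafilter ℝ := Ultrafilter.of (nhdsWithin (0 : ℝ) (Set.Ioi 0))
  have hF : (F : Filter ℝ) ≤ nhdsWithin (0 : ℝ) (Set.Ioi 0) := Ultrafilter.of_le _
  have hRj : ∀ j : ℕ, R₀ ≤ R₀ * 2 ^ j := fun j =>
    le_mul_of_one_le_right (by linarith) (one_le_pow₀ (by norm_num))
  have hRp : ∀ j : ℕ, 0 < R₀ * 2 ^ j := fun j => by linarith [hRj j]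
  let f : ℕ → ℝ → ℝ := fun j => Et h U (fun x => chi (R₀ * 2 ^ j) x ^ (2 * m + 5))
  have hex : ∀ j, ∃ e ∈ Set.Icc 0 C, Tendsto (f j) F (nhds e) := fun j => by
    obtain ⟨e, he, hle⟩ := isCompact_Icc.ultrafilter_le_nhds' (F.map (f j)) (s := Set.Icc 0 C) (by
      have : ∀ᶠ t in (F : Filter ℝ), f j t ∈ Set.Icc 0 C := by
        filter_upwards [hF (hb _ (hRj j))] with t ht
        exact ⟨S.Et_nonneg _ t, ht⟩
      exact this)
    exact ⟨e, he, hle⟩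
  choose e he hte using hex
  have hmono : Monotone e := monotone_nat_of_le_succ fun j => by
    refine le_of_tendsto_of_tendsto' (hte j) (hte (j + 1)) fun t => ?_
    refine integral_mono (S.Et_int (r := 2 * (R₀ * 2 ^ j)) ((chi_continuous _).pow _) (fun x hx => by
        have := chi_VO (hRp j) le_rfl x hx
        simp [this]) t) (S.Et_int (r := 2 * (R₀ * 2 ^ (j + 1))) ((chi_continuous _).pow _) (fun x hx => by
        have := chi_VO (hRp (j + 1)) le_rfl x hx
        simp [this]) t) fun x => ?_
    refine mul_le_mul_of_nonneg_right ?_ (add_nonneg (S.Pd_nonneg 0 t x) (S.Pd_nonneg 1 t x))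
    have c1 := chi_mono (hRp j) (show 2 * (R₀ * 2 ^ j) ≤ R₀ * 2 ^ (j + 1) by
      rw [pow_succ]; linarith) x
    exact pow_le_pow_left₀ (pow_nonneg (chi_nonneg _ x) _)
      (pow_le_pow_left₀ (chi_nonneg _ x) c1 _) 2
  have hz := seq_zero (C := P) hmono (fun j => (he j).2) (fun lam hl => ⟨P * lam / R₀, fun j => by
    have hev := hF (hr (R₀ * 2 ^ j) lam (hRj j) hl)
    have e8 : 8 * (R₀ * 2 ^ j) = R₀ * 2 ^ (j + 3) := by ring
    have e32 : 32 * (R₀ * 2 ^ j) = R₀ * 2 ^ (j + 5) := by ring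
    have hlim := ((((hte (j + 5)).sub (hte j)).const_mul (P * lam)).add_const (P / lam)).add_const
      (P * lam / (R₀ * 2 ^ j))
    have := le_of_tendsto_of_tendsto (hte (j + 3)) hlim (by
      filter_upwards [hev] with t ht
      simp only [f]
      simp only [e8, e32] at ht
      exact ht)
    refine this.trans (le_of_eq ?_)
    rw [one_div, inv_pow]
    field_simp⟩)
  refine ⟨2 * m + 5, by omega, F, R₀, F.neBot, hF, hR₀, fun j => ?_⟩
  have : e j = 0 := le_antisymm (hz j) (he j).1
  rw [← this]
  exact hte j

/-! ### Conclusion -/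

lemma Sol.third {h : ℝ → ℝ} {c₁ c₂ μ M : ℝ} {U : Fin 2 → E2 → ℝ} {ψ : E2 → ℝ}
    (S : Sol h c₁ c₂ μ M U ψ) {n : ℕ} (hn : 1 ≤ n) {F : Filter ℝ} (hF0 : F.NeBot)
    (hF : F ≤ nhdsWithin (0 : ℝ) (Set.Ioi 0)) {R : ℝ} (hR : 0 < R)
    (ht : Tendsto (Et h U (fun x => chi R x ^ n)) F (nhds 0)) :
    ∫ x, chi R x ^ (2 * n) * VV U x ≤ 3 * M * ∫ x, (|dd 0 (fun y => chi R y ^ (2 * n)) x| +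
      |dd 1 (fun y => chi R y ^ (2 * n)) x|) * AA U x := by
  have cz : ContDiff ℝ 1 (fun y => chi R y ^ (2 * n)) := (chi_contDiff R 1).pow _
  have vc := chi_VO hR le_rfl
  have vz : VO (2 * R) (fun y => chi R y ^ (2 * n)) := fun x hx => by
    simp only [vc x hx]
    rw [zero_pow (by omega)]
  have vn : VO (2 * R) (fun y => chi R y ^ n) := fun x hx => by
    simp only [vc x hx]
    rw [zero_pow (by omega)]
  have cn : Continuous (fun y => chi R y ^ n) := (chi_continuous R).pow _
  have n0 : ∀ x, 0 ≤ chi R x ^ n := fun x => pow_nonneg (chi_nonneg R x) _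
  have cut2 : Cut2 (2 * R) (fun y => chi R y ^ (2 * n)) (fun y => chi R y ^ n)
      (fun y => chi R y ^ n) (fun x => |dd 0 (fun y => chi R y ^ (2 * n)) x| +
      |dd 1 (fun y => chi R y ^ (2 * n)) x|) := by
    refine ⟨cz, cn, cn, ?_, n0, n0, vn, vn, fun x hx => ?_, fun x => ?_, fun k x => ?_⟩
    · exact (dd_continuous cz 0).abs.add (dd_continuous cz 1).abs
    · simp [vz.dd 0 x hx, vz.dd 1 x hx]
    · rw [← pow_add, two_mul]
    · fin_cases k
      · exact le_add_of_nonneg_right (abs_nonneg _)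
      · exact le_add_of_nonneg_left (abs_nonneg _)
  set Y := ∫ x, chi R x ^ (2 * n) * VV U x
  set X := ∫ x, (|dd 0 (fun y => chi R y ^ (2 * n)) x| +
      |dd 1 (fun y => chi R y ^ (2 * n)) x|) * AA U x
  set I := ∫ x, (chi R x ^ n) ^ 2 * (1 + 2 * fnorm (eps U x)) ^ μ with hI
  have key : ∀ lam : ℝ, 0 < lam → Y ≤ (2 * M / c₁ * I) / lam + 3 * M * X + 1 / lam := by
    intro lam hl
    have ev := hF (S.second cut2 hl (show 0 < 1 / lam by positivity))
    have lim := (((ht.const_mul (4 * M * lam)).add_const (2 * M / (lam * c₁) * I)).add_const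
      (3 * M * X)).add_const (1 / lam)
    have := ge_of_tendsto lim ev
    refine this.trans (le_of_eq ?_)
    have hc := S.hH.hc₁
    field_simp
    ring
  have lim : Tendsto (fun lam : ℝ => (2 * M / c₁ * I) / lam + 3 * M * X + 1 / lam) atTop
      (nhds (0 + 3 * M * X + 0)) :=
    ((tendsto_const_nhds.div_atTop tendsto_id).add_const _).add
      (tendsto_const_nhds.div_atTop tendsto_id)
  rw [zero_add, add_zero] at lim
  refine ge_of_tendsto lim ?_
  filter_upwards [eventually_gt_atTop 0] with lam hl
  exact key lam hl

lemma AA_young (U : Fin 2 → E2 → ℝ) (x : E2) {lam : ℝ} (hl0 : 0 < lam) :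
    AA U x ≤ lam * VV U x + 1 / lam := by
  have g1 : lam / 4 * AA U x ^ 2 + 1 / lam - AA U x = (lam * AA U x / 2 - 1) ^ 2 / lam := by
    field_simp
    ring
  have g2 : 0 ≤ (lam * AA U x / 2 - 1) ^ 2 / lam := by positivity
  have g3 := mul_le_mul_of_nonneg_left (AA_sq U x) hl0.le
  linarith

lemma Sol.VV_zero {h : ℝ → ℝ} {c₁ c₂ μ M : ℝ} {U : Fin 2 → E2 → ℝ} {ψ : E2 → ℝ}
    (S : Sol h c₁ c₂ μ M U ψ) (x : E2) : VV U x = 0 := by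
  obtain ⟨n, hn, F, R₀, hF0, hF, hR₀, hlim⟩ := S.energy
  obtain ⟨K, hK, hb⟩ := chi_bounds
  have hM0 : 0 < M := by linarith [S.hM]
  have hRp : ∀ j : ℕ, 0 < R₀ * 2 ^ j := fun j => by positivity
  have cV := VV_continuous S.cU
  have cA := AA_continuous S.cU
  let Y : ℝ → ℝ := fun R => ∫ x, chi R x ^ (2 * n) * VV U x
  have IY : ∀ R, 0 < R → Integrable (fun x => chi R x ^ (2 * n) * VV U x) := fun R hR => by
    have := chi_continuous R
    refine VO.integrable (r := 2 * R) (fun x hx => ?_) (by fun_prop)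
    simp only [chi_VO hR le_rfl x hx]
    rw [zero_pow (by omega), zero_mul]
  have Ic : ∀ R, 0 < R → Integrable (fun x => chi R x) := fun R hR =>
    (chi_VO hR le_rfl).integrable (chi_continuous R)
  set B := 4 * n * K with hB
  have hn0 : (1:ℝ) ≤ n := by exact_mod_cast hn
  have B0 : 0 < B := by positivity
  -- bound on the gradient of the cutoff
  have hrr : ∀ R, 0 < R → ∀ x, (|dd 0 (fun y => chi R y ^ (2 * n)) x| +
      |dd 1 (fun y => chi R y ^ (2 * n)) x|) ≤ B / R * chi R x ^ n := by
    intro R hR x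
    have e : ∀ k, |dd k (fun y => chi R y ^ (2 * n)) x| ≤ (2 * n * K) / R * chi R x ^ n := by
      intro k
      rw [chi_pow_dd, abs_mul, abs_of_nonneg (mul_nonneg (by positivity) (pow_nonneg (chi_nonneg R x) _))]
      have p1 := chi_pow_le R x (show n ≤ 2 * n - 1 by omega)
      have p2 := mul_le_mul p1 ((hb R hR).1 k x) (abs_nonneg _) (pow_nonneg (chi_nonneg R x) _)
      have p3 := mul_le_mul_of_nonneg_left p2 (show (0:ℝ) ≤ 2 * n by positivity)
      push_cast
      refine le_trans (le_of_eq ?_) (p3.trans (le_of_eq ?_))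
      · ring
      · ring
    have e0 := e 0
    have e1 := e 1
    have : B / R * chi R x ^ n = 2 * ((2 * n * K) / R * chi R x ^ n) := by rw [hB]; ring
    linarith
  have hrr0 : ∀ R, 0 < R → ∀ x, ¬ (R ≤ ‖x‖ ∧ ‖x‖ ≤ 2 * R) →
      (|dd 0 (fun y => chi R y ^ (2 * n)) x| + |dd 1 (fun y => chi R y ^ (2 * n)) x|) = 0 := by
    intro R hR x hx
    rw [chi_pow_dd, chi_pow_dd, chi_dd_zero hR 0 hx, chi_dd_zero hR 1 hx]
    simp
  have Ir : ∀ R, 0 < R → Integrable (fun x => (|dd 0 (fun y => chi R y ^ (2 * n)) x| +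
      |dd 1 (fun y => chi R y ^ (2 * n)) x|) * AA U x) := fun R hR => by
    have cz : ContDiff ℝ 1 (fun y => chi R y ^ (2 * n)) := (chi_contDiff R 1).pow _
    refine VO.integrable (r := 2 * R) (fun x hx => ?_)
      (((dd_continuous cz 0).abs.add (dd_continuous cz 1).abs).mul cA)
    have := hrr0 R hR x (fun h => absurd h.2 (not_le.2 hx))
    simp only [this, zero_mul]
  have hbd : ∀ j : ℕ, Y (R₀ * 2 ^ j) ≤ 144 * M ^ 2 * B ^ 2 * K := by
    intro j
    set R := R₀ * 2 ^ j
    have hR : 0 < R := hRp j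
    have h3 := S.third hn hF0 hF hR (hlim j)
    have h4 : 3 * M * ∫ x, (|dd 0 (fun y => chi R y ^ (2 * n)) x| +
      |dd 1 (fun y => chi R y ^ (2 * n)) x|) * AA U x ≤ ∫ x, (1 / 2 * (chi R x ^ (2 * n) * VV U x) +
        2 * (3 * M * B / R) ^ 2 * chi (2 * R) x) := by
      rw [← integral_const_mul]
      refine integral_mono ((Ir R hR).const_mul _) (((IY R hR).const_mul _).add
        ((Ic (2 * R) (by linarith)).const_mul _)) fun x => ?_
      have p1 := mul_le_mul_of_nonneg_right (hrr R hR x) (AA_nonneg U x)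
      have p2 := mul_le_mul_of_nonneg_left p1 (show 0 ≤ 3 * M by positivity)
      refine p2.trans ?_
      have hv := mul_nonneg (pow_nonneg (chi_nonneg R x) (2 * n)) (VV_nonneg U x)
      rcases le_total ‖x‖ (2 * R) with hx | hx
      · simp only [chi_one (by linarith) hx]
        have p3 := mul_le_mul_of_nonneg_left (AA_sq U x) (pow_nonneg (chi_nonneg R x) (2 * n))
        have p4 : chi R x ^ (2 * n) = (chi R x ^ n) ^ 2 := by rw [← pow_mul, mul_comm]
        rw [p4] at p3 ⊢
        have p5 : 3 * M * (B / R * chi R x ^ n * AA U x) = 3 * M * B / R * (chi R x ^ n * AA U x) := by ring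
        rw [p5]
        nlinarith [sq_nonneg (chi R x ^ n * AA U x - 4 * (3 * M * B / R))]
      · rw [chi_zero hR hx, zero_pow (by omega), zero_pow (by omega)]
        have := chi_nonneg (2 * R) x
        have : 0 ≤ 2 * (3 * M * B / R) ^ 2 * chi (2 * R) x := by positivity
        linarith
    rw [integral_add ((IY R hR).const_mul _) ((Ic (2 * R) (by linarith)).const_mul _),
      integral_const_mul, integral_const_mul] at h4
    have h5 := mul_le_mul_of_nonneg_left (hb (2 * R) (by linarith)).2.2
      (show 0 ≤ 2 * (3 * M * B / R) ^ 2 by positivity)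
    have h6 : 2 * (3 * M * B / R) ^ 2 * (K * (2 * R) ^ 2) = 72 * M ^ 2 * B ^ 2 * K := by
      field_simp
      norm_num
    rw [h6] at h5
    simp only [Y]
    linarith
  have hmono : Monotone (fun j : ℕ => Y (R₀ * 2 ^ j)) := monotone_nat_of_le_succ fun j => by
    refine integral_mono (IY _ (hRp j)) (IY _ (hRp (j + 1))) fun x => ?_
    have c1 := chi_mono (hRp j) (show 2 * (R₀ * 2 ^ j) ≤ R₀ * 2 ^ (j + 1) by
      rw [pow_succ]; linarith) x
    exact mul_le_mul_of_nonneg_right (pow_le_pow_left₀ (chi_nonneg _ x) c1 _) (VV_nonneg U x)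
  have hz := seq_zero (C := 3 * M * B * (1 + 1024 * K)) hmono hbd (fun lam hl => ⟨0, fun j => by
    have hl0 : 0 < lam := by linarith
    have e8 : R₀ * 2 ^ (j + 3) = 8 * (R₀ * 2 ^ j) := by ring
    have e32 : R₀ * 2 ^ (j + 5) = 32 * (R₀ * 2 ^ j) := by ring
    have h3 := S.third hn hF0 hF (hRp (j + 3)) (hlim (j + 3))
    simp only [e8, e32] at h3 ⊢
    set R := R₀ * 2 ^ j
    have hR : 0 < R := hRp j
    have h8 : 0 < 8 * R := by linarith
    have h32 : 0 < 32 * R := by linarith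
    have hle : ∀ x, chi R x ^ (2 * n) ≤ chi (32 * R) x ^ (2 * n) := fun x =>
      pow_le_pow_left₀ (chi_nonneg _ x) (chi_mono hR (by linarith) x) _
    have IΔ : Integrable (fun x => chi (32 * R) x ^ (2 * n) * VV U x - chi R x ^ (2 * n) * VV U x) :=
      (IY _ h32).sub (IY _ hR)
    have h4 : ∫ x, (|dd 0 (fun y => chi (8 * R) y ^ (2 * n)) x| +
      |dd 1 (fun y => chi (8 * R) y ^ (2 * n)) x|) * AA U x ≤
        ∫ x, (B * lam * (chi (32 * R) x ^ (2 * n) * VV U x - chi R x ^ (2 * n) * VV U x) +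
          B / (lam * R ^ 2) * chi (32 * R) x) := by
      refine integral_mono (Ir _ h8) ((IΔ.const_mul _).add ((Ic _ h32).const_mul _)) fun x => ?_
      have d0 := sub_nonneg.2 (hle x)
      have v0 := VV_nonneg U x
      have c0 := chi_nonneg (32 * R) x
      by_cases hx : 8 * R ≤ ‖x‖ ∧ ‖x‖ ≤ 2 * (8 * R)
      · simp only
        rw [chi_one h32 (by linarith), chi_zero hR (by linarith), one_pow, zero_pow (by omega)]
        have p1 := hrr _ h8 x
        have p2 : B / (8 * R) * chi (8 * R) x ^ n ≤ B / R := by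
          have q1 : chi (8 * R) x ^ n ≤ 1 := pow_le_one₀ (chi_nonneg _ x) (chi_le_one _ x)
          have q2 : B / (8 * R) ≤ B / R := div_le_div_of_nonneg_left B0.le hR (by linarith)
          have := mul_le_mul q2 q1 (pow_nonneg (chi_nonneg _ x) _) (by positivity)
          linarith
        have p3 := mul_le_mul_of_nonneg_right (p1.trans p2) (AA_nonneg U x)
        have p4 := AA_young U x (show 0 < lam * R by positivity)
        have p5 := mul_le_mul_of_nonneg_left p4 (show 0 ≤ B / R by positivity)
        refine p3.trans (p5.trans (le_of_eq ?_))
        field_simp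
        ring
      · have := hrr0 _ h8 x hx
        simp only at this ⊢
        rw [this, zero_mul, ← sub_mul]
        positivity
    rw [integral_add (IΔ.const_mul _) ((Ic _ h32).const_mul _), integral_const_mul,
      integral_const_mul, integral_sub (IY _ h32) (IY _ hR)] at h4
    have h5 := mul_le_mul_of_nonneg_left (hb (32 * R) h32).2.2
      (show 0 ≤ B / (lam * R ^ 2) by positivity)
    have h6 : B / (lam * R ^ 2) * (K * (32 * R) ^ 2) = 1024 * B * K / lam := by
      field_simp
      norm_num
    rw [h6] at h5
    have hYm : 0 ≤ Y (32 * R) - Y R := by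
      refine sub_nonneg.2 (integral_mono (IY _ hR) (IY _ h32) fun x => ?_)
      exact mul_le_mul_of_nonneg_right (hle x) (VV_nonneg U x)
    have h7 := mul_le_mul_of_nonneg_left (h4.trans (add_le_add_right h5 _)) (show 0 ≤ 3 * M by positivity)
    refine (h3.trans h7).trans ?_
    change 3 * M * (B * lam * (Y (32 * R) - Y R) + 1024 * B * K / lam) ≤ _
    have k1 : 3 * M * (B * lam * (Y (32 * R) - Y R) + 1024 * B * K / lam) =
      3 * M * B * lam * (Y (32 * R) - Y R) + 3 * M * B * (1024 * K) / lam := by ring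
    rw [k1, zero_mul, add_zero]
    refine add_le_add ?_ ?_
    · refine mul_le_mul_of_nonneg_right ?_ hYm
      refine mul_le_mul_of_nonneg_right ?_ hl0.le
      refine le_mul_of_one_le_right (by positivity) ?_
      linarith
    · refine div_le_div_of_nonneg_right ?_ hl0.le
      refine mul_le_mul_of_nonneg_left ?_ (by positivity)
      linarith⟩)
  obtain ⟨j, hj⟩ := pow_unbounded_of_one_lt ‖x‖ (show (1:ℝ) < 2 by norm_num)
  have hxj : ‖x‖ ≤ R₀ * 2 ^ j := by
    have := le_mul_of_one_le_left (show (0:ℝ) ≤ 2 ^ j by positivity) hR₀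
    linarith
  have nn : ∀ y, 0 ≤ chi (R₀ * 2 ^ j) y ^ (2 * n) * VV U y := fun y =>
    mul_nonneg (pow_nonneg (chi_nonneg _ y) _) (VV_nonneg U y)
  have hzero : ∫ y, chi (R₀ * 2 ^ j) y ^ (2 * n) * VV U y = 0 :=
    le_antisymm (hz j) (integral_nonneg nn)
  rw [integral_eq_zero_iff_of_nonneg nn (IY _ (hRp j))] at hzero
  have cf : Continuous (fun y => chi (R₀ * 2 ^ j) y ^ (2 * n) * VV U y) :=
    ((chi_continuous _).pow _).mul cV
  have := (Continuous.ae_eq_iff_eq volume cf continuous_const).1 hzero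
  have h1 := congrFun this x
  simp only [chi_one (hRp j) hxj, one_pow, one_mul] at h1
  exact h1

/-- Theorem 3 of the paper: Liouville theorem for bounded weak solutions
of the 2D generalized Navier–Stokes system with a μ-elliptic potential of linear
growth, 1 < μ < 2. -/
theorem liouville_mu_elliptic
    (h : ℝ → ℝ) (c₁ c₂ μ : ℝ)
    (hc₁ : 0 < c₁) (hc₂ : 0 < c₂) (hμ₁ : 1 < μ) (hμ₂ : μ < 2)
    (hreg : ContDiff ℝ 2 h)
    (hnonneg : ∀ t, 0 ≤ t → 0 ≤ h t)
    (h0 : h 0 = 0) (h0' : deriv h 0 = 0)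
    (hlow : ∀ t, 0 ≤ t →
      c₁ * (1 + t) ^ (-μ) ≤ min (deriv (deriv h) t) (slopeH h t))
    (hup : ∀ t, 0 ≤ t →
      max (deriv (deriv h) t) (slopeH h t) ≤ c₂ / (1 + t))
    (u : EuclideanSpace ℝ (Fin 2) → EuclideanSpace ℝ (Fin 2))
    (hu : ContDiff ℝ 1 u)
    (hdiv : ∀ x, divg u x = 0)
    (hbdd : ∃ M : ℝ, ∀ x, ‖u x‖ ≤ M)
    (hweak : IsWeakSolution h u) :
    ∃ c, ∀ x, u x = c := by
  obtain ⟨M, ψ, S⟩ := exists_sol (⟨hc₁, hc₂, hμ₁, hμ₂, hreg, h0', hlow, hup⟩ : HypH h c₁ c₂ μ)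
    hu hdiv hbdd hweak
  have hdd : ∀ i k x, dd k (fun y => u y i) x = 0 := by
    intro i k x
    have hv := S.VV_zero x
    unfold VV at hv
    fin_cases i <;> fin_cases k <;> simp only [Fin.zero_eta, Fin.mk_one] <;>
      refine pow_eq_zero_iff (n := 2) (by norm_num) |>.1 ?_ <;>
      nlinarith [sq_nonneg (dd 0 (fun y => u y 0) x), sq_nonneg (dd 1 (fun y => u y 0) x),
        sq_nonneg (dd 0 (fun y => u y 1) x), sq_nonneg (dd 1 (fun y => u y 1) x)]
  have hf : ∀ i x, fderiv ℝ (fun y => u y i) x = 0 := by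
    intro i x
    ext y
    rw [fderiv_apply_eq, hdd, hdd]
    simp
  refine ⟨u 0, fun x => ?_⟩
  ext i
  exact is_const_of_fderiv_eq_zero ((S.cU i).differentiable (by norm_num)) (hf i) x 0
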